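/- arXiv:2404.13952 — 8 statements merged into one kernel-verified Lean document; each statement's English description precedes it below -/
import Mathlib

section
/- Let F be a binary form of degree 4 with rational coefficients and nonzero discriminant such that F(ℤ²) = {m ∈ ℤ : m = t⁴ + u⁴ for some (t,u) ∈ ℤ²}. Then there exist integers a, b, c, d with ad − bc = ±1 such that F(X,Y) = (aX + cY)⁴ + (bX + dY)⁴. -/
open MvPolynomial in
/-- The action `F ∘ γ` of a matrix `γ = [[a,b],[c,d]]` on a binary form:
`(F ∘ γ)(X, Y) = F(aX + bY, cX + dY)`. -/
noncomputable def compForm (F : MvPolynomial (Fin 2) ℚ) (γ : Matrix (Fin 2) (Fin 2) ℚ) :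
    MvPolynomial (Fin 2) ℚ :=
  aeval (fun i => C (γ i 0) * X 0 + C (γ i 1) * X 1) F

/-- `F ∈ Bin(d, ℚ)`: a binary form of degree `d` with rational coefficients and
nonzero discriminant (equivalently, squarefree as a polynomial). -/
def IsBinForm (d : ℕ) (F : MvPolynomial (Fin 2) ℚ) : Prop :=
  F.IsHomogeneous d ∧ Squarefree F

/-- The set of values `F(ℤ²) = {F(x,y) : (x,y) ∈ ℤ²}`. -/
def valueSet (F : MvPolynomial (Fin 2) ℚ) : Set ℚ :=
  {q | ∃ x y : ℤ, MvPolynomial.eval ![(x : ℚ), (y : ℚ)] F = q}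

/-- one Newton step for the integer square root (no correctness needed) -/
def stp (n g : ℕ) : ℕ := Nat.div (Nat.add g (Nat.div n g)) 2

def sq0 (n : ℕ) : ℕ :=
  stp n (stp n (stp n (stp n (stp n (stp n (Nat.pow 2 (Nat.add (Nat.div (Nat.log2 n) 2) 1)))))))

/-- evaluate the argument before passing it on -/
def forceN (k : ℕ → Bool) (n : ℕ) : Bool := Nat.rec (k 0) (fun m _ => k (m + 1)) n

/-- two-pointer search showing that `X - Y` is not a sum of two fourth powers -/
def notV (X Y : ℕ) : ℕ → ℕ → ℕ → Bool
  | 0, _, _ => false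
  | k + 1, t, u =>
    cond (Nat.blt u t) true
      (cond (Nat.blt (t ^ 4 + u ^ 4 + Y) X) (notV X Y k (t + 1) u)
        (cond (Nat.blt X (t ^ 4 + u ^ 4 + Y))
          (Nat.rec true (fun u' _ => notV X Y k t u') u) false))

def notV0 (X Y : ℕ) : Bool := Nat.blt X (Y + 2560000) && notV X Y 100 0 40

def killed (S q r : ℕ) : Bool :=
  Nat.beq ((q + r) % 2) 1 ||
  notV0 (1 + 40 * q + S) (2000 + 40 * r) ||
  notV0 (1 + 40 * q + 40 * r + S) 2000 ||
  notV0 (16 + 160 * q + S) (8000 + 80 * r)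

def certB (S q a r : ℕ) : Bool :=
  Nat.blt (((4 * a ^ 3 + 80 * q * a * 4096) - (4000 * a * 4096 + 40 * r * 262144)
     + ((4000 * a * 4096 + 40 * r * 262144) - (4 * a ^ 3 + 80 * q * a * 4096))) ^ 2)
    (4 * (3 * a ^ 2 + 40 * q * 4096 - 2000 * 4096) *
      (a ^ 4 + 40 * q * a ^ 2 * 4096 + S * 16777216 -
        (2000 * a ^ 2 * 4096 + 40 * r * a * 262144 + 2 * 16777216)))

def down (S q a : ℕ) : ℕ → ℕ → Bool
  | 0, _ => false
  | k + 1, r => Nat.rec true (fun r' _ =>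
      certB S q a (r' + 1) || (killed S q (r' + 1) && down S q a k r')) r

def chk1 (S q a r : ℕ) : Bool :=
  Nat.blt 0 a && Nat.blt (a ^ 4 + 40 * q * a ^ 2 * 4096 + S * 16777216)
    (40 * a * 262144 * (r + 1) + 2000 * a ^ 2 * 4096) && down S q a 60 r

def chk (S q : ℕ) : Bool :=
  forceN (fun g => forceN (fun a => forceN (fun r => chk1 S q a r)
      ((a ^ 4 + 40 * q * a ^ 2 * 4096 + S * 16777216 - 2000 * a ^ 2 * 4096) / (40 * a * 262144)))
    (sq0 ((g + 2000 * 4096 - 40 * q * 4096) / 6)))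
  (sq0 (((40 * q - 2000 + (2000 - 40 * q)) ^ 2 + 12 * S) * 16777216))

/-- bounded universal quantification -/
def allN (P : ℕ → Bool) (n : ℕ) : Bool := Nat.rec true (fun q acc => P q && acc) n

def chkP (S : ℕ) : Bool := allN (fun q => chk S q) 152

def chkTU (t u : ℕ) : Bool := !(Nat.beq ((t ^ 4 + u ^ 4) % 80) 1) || forceN chkP (t ^ 4 + u ^ 4)

def chkT (t : ℕ) : Bool := allN (fun u => chkTU t u) (t + 1)

def chkAll : Bool := allN chkT 35

theorem chkAll_true : chkAll = true := by decide +kernel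


theorem forceN_eq (k : ℕ → Bool) (n : ℕ) : forceN k n = k n := by
  cases n <;> rfl

theorem natrec_all (P : ℕ → Bool) (n : ℕ)
    (h : allN P n = true) : ∀ q < n, P q = true := by
  induction n with
  | zero => intro q hq; omega
  | succ n ih =>
    intro q hq
    have h' : (P n && allN P n) = true := h
    rw [Bool.and_eq_true] at h'
    rcases Nat.lt_succ_iff_lt_or_eq.mp hq with h1 | h1
    · exact ih h'.2 q h1
    · rw [h1]; exact h'.1

theorem blt_iff (a b : ℕ) : Nat.blt a b = true ↔ a < b := by
  simp [Nat.blt]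

theorem notV_sound (X Y : ℕ) : ∀ k t u, notV X Y k t u = true →
    ∀ t' u', t ≤ t' → t' ≤ u' → u' ≤ u → t' ^ 4 + u' ^ 4 + Y ≠ X := by
  intro k
  induction k with
  | zero => intro t u h; simp [notV] at h
  | succ k ih =>
    intro t u h t' u' h1 h2 h3 heq
    rw [notV] at h
    have a1 : t ^ 4 ≤ t' ^ 4 := Nat.pow_le_pow_left h1 4
    have a2 : u' ^ 4 ≤ u ^ 4 := Nat.pow_le_pow_left h3 4
    by_cases c1 : Nat.blt u t = true
    · rw [blt_iff] at c1; omega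
    · rw [Bool.not_eq_true] at c1
      rw [c1, cond_false] at h
      by_cases c2 : Nat.blt (t ^ 4 + u ^ 4 + Y) X = true
      · rw [c2, cond_true] at h
        rw [blt_iff] at c2
        have : t ≠ t' := by rintro rfl; omega
        exact ih (t + 1) u h t' u' (by omega) h2 h3 heq
      · rw [Bool.not_eq_true] at c2
        rw [c2, cond_false] at h
        by_cases c3 : Nat.blt X (t ^ 4 + u ^ 4 + Y) = true
        · rw [c3, cond_true] at h
          rw [blt_iff] at c3
          have hne : u ≠ u' := by rintro rfl; omega
          cases u with
          | zero => omega
          | succ u0 => exact ih t u0 h t' u' h1 h2 (by omega) heq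
        · rw [Bool.not_eq_true] at c3
          rw [c3, cond_false] at h
          exact absurd h (by simp)

theorem notV0_sound (X Y : ℕ) (h : notV0 X Y = true) (t u : ℕ) : t ^ 4 + u ^ 4 + Y ≠ X := by
  rw [notV0, Bool.and_eq_true, blt_iff] at h
  intro heq
  have key : ∀ w : ℕ, w ^ 4 < 2560000 → w ≤ 40 := by
    intro w hw
    by_contra hc
    have : 41 ^ 4 ≤ w ^ 4 := Nat.pow_le_pow_left (by omega) 4
    omega
  rcases le_total t u with hc | hc
  · exact notV_sound X Y _ _ _ h.2 t u (Nat.zero_le _) hc (key u (by omega)) heq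
  · exact notV_sound X Y _ _ _ h.2 u t (Nat.zero_le _) hc (key t (by omega)) (by omega)

/-- the reduced quartic form -/
def ff (p r S x y : ℤ) : ℤ := x ^ 4 + 40 * p * x ^ 2 * y ^ 2 - 40 * r * x * y ^ 3 + S * y ^ 4

/-- membership in the set of sums of two fourth powers -/
def InV (v : ℤ) : Prop := ∃ t u : ℕ, v = (t : ℤ) ^ 4 + (u : ℤ) ^ 4

theorem killed_sound (S q r : ℕ) (h : killed S q r = true)
    (hpar : ((q : ℤ) - 50 - r) % 2 = 0)
    (h1 : InV (ff (q - 50) r S 1 1)) (h2 : InV (ff (q - 50) r S (-1) 1))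
    (h3 : InV (ff (q - 50) r S 2 1)) : False := by
  simp only [killed, Bool.or_eq_true] at h
  rcases h with ((h | h) | h) | h
  · have := Nat.eq_of_beq_eq_true h
    omega
  · obtain ⟨t, u, e⟩ := h1
    refine notV0_sound _ _ h t u ?_
    simp only [ff] at e
    zify; linarith
  · obtain ⟨t, u, e⟩ := h2
    refine notV0_sound _ _ h t u ?_
    simp only [ff] at e
    zify; linarith
  · obtain ⟨t, u, e⟩ := h3
    refine notV0_sound _ _ h t u ?_
    simp only [ff] at e
    zify; linarith

theorem certB_real (p r S a x : ℝ) (hx : 0 ≤ x) (ha : 0 < a) (hE : 0 < 3 * a ^ 2 + p)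
    (h : (4 * a ^ 3 + 2 * p * a - r) ^ 2 <
      4 * (3 * a ^ 2 + p) * (a ^ 4 + p * a ^ 2 - r * a + S - 2)) :
    2 < x ^ 4 + p * x ^ 2 - r * x + S := by
  have e : x ^ 4 + p * x ^ 2 - r * x + S = (a ^ 4 + p * a ^ 2 - r * a + S) +
      (4 * a ^ 3 + 2 * p * a - r) * (x - a) + (x - a) ^ 2 * ((x + a) ^ 2 + 2 * a ^ 2 + p) := by ring
  have h1 : (x - a) ^ 2 * (3 * a ^ 2 + p) ≤ (x - a) ^ 2 * ((x + a) ^ 2 + 2 * a ^ 2 + p) := by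
    apply mul_le_mul_of_nonneg_left _ (sq_nonneg _)
    nlinarith
  set E := 3 * a ^ 2 + p
  set G := 4 * a ^ 3 + 2 * p * a - r
  have h2 : 0 ≤ (2 * E * (x - a) + G) ^ 2 := sq_nonneg _
  have h3 : 0 < 4 * E * ((a ^ 4 + p * a ^ 2 - r * a + S - 2) + G * (x - a) + (x - a) ^ 2 * E) := by
    nlinarith
  have h4 := (mul_pos_iff_of_pos_left (by positivity : 0 < 4 * E)).mp h3
  linarith

theorem absdiff_sq (X Y : ℕ) : (((X - Y + (Y - X)) ^ 2 : ℕ) : ℝ) = ((X : ℝ) - Y) ^ 2 := by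
  rcases le_total X Y with h | h
  · rw [Nat.sub_eq_zero_of_le h]; push_cast [Nat.cast_sub h]; ring
  · rw [Nat.sub_eq_zero_of_le h]; push_cast [Nat.cast_sub h]; ring

theorem certB_sound (S q a r : ℕ) (h : certB S q a r = true) (ha : 0 < a) (x : ℝ) (hx : 0 ≤ x) :
    2 < x ^ 4 + 40 * ((q : ℝ) - 50) * x ^ 2 - 40 * r * x + S := by
  rw [certB, blt_iff] at h
  set E := 3 * a ^ 2 + 40 * q * 4096 - 2000 * 4096 with hE
  set V := a ^ 4 + 40 * q * a ^ 2 * 4096 + S * 16777216 -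
        (2000 * a ^ 2 * 4096 + 40 * r * a * 262144 + 2 * 16777216) with hV
  have hpos : 0 < 4 * E * V := lt_of_le_of_lt (Nat.zero_le _) h
  have hE0 : E ≠ 0 := by rintro h0; simp [h0] at hpos
  have hV0 : V ≠ 0 := by rintro h0; simp [h0] at hpos
  have hEr : (E : ℝ) = 3 * a ^ 2 + 40 * q * 4096 - 2000 * 4096 := by
    rw [hE, Nat.cast_sub (by omega)]; push_cast; ring
  have hVr : (V : ℝ) = a ^ 4 + 40 * q * a ^ 2 * 4096 + S * 16777216 -
        (2000 * a ^ 2 * 4096 + 40 * r * a * 262144 + 2 * 16777216) := by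
    rw [hV, Nat.cast_sub (by omega)]; push_cast; ring
  have hr : ((4 * (a:ℝ) ^ 3 + 80 * q * a * 4096) - (4000 * a * 4096 + 40 * r * 262144)) ^ 2 <
      4 * E * V := by
    have h' := (Nat.cast_lt (α := ℝ)).mpr h
    rw [absdiff_sq] at h'
    push_cast at h'
    exact h'
  have hEp : (0 : ℝ) < E := by exact_mod_cast Nat.pos_of_ne_zero hE0
  have har : (0 : ℝ) < a := by exact_mod_cast ha
  have := certB_real (40 * ((q : ℝ) - 50)) (40 * r) S (a / 64) x hx (by positivity)
    (by
      have e0 : 3 * ((a:ℝ) / 64) ^ 2 + 40 * ((q:ℝ) - 50) = E / 4096 := by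
        rw [hEr]; ring
      rw [e0]; exact div_pos hEp (by norm_num)) (by
      have e1 : (4 * ((a:ℝ) / 64) ^ 3 + 2 * (40 * ((q:ℝ) - 50)) * (a / 64) - 40 * r) ^ 2 =
        ((4 * (a:ℝ) ^ 3 + 80 * q * a * 4096) - (4000 * a * 4096 + 40 * r * 262144)) ^ 2 / 262144 ^ 2 := by
        field_simp; ring
      have e2 : 4 * (3 * ((a:ℝ) / 64) ^ 2 + 40 * ((q:ℝ) - 50)) * (((a:ℝ) / 64) ^ 4 + 40 * ((q:ℝ) - 50) * ((a:ℝ) / 64) ^ 2 - 40 * r * ((a:ℝ) / 64) + S - 2)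
         = (4 * E * V) / 262144 ^ 2 := by
        rw [hEr, hVr]; field_simp; ring
      rw [e1, e2]
      exact div_lt_div_of_pos_right hr (by norm_num))
  linarith

theorem down_sound (S q a : ℕ) (ha : 0 < a) : ∀ k r, down S q a k r = true → ∀ r', 1 ≤ r' → r' ≤ r →
    killed S q r' = true ∨ ∀ x : ℝ, 0 ≤ x →
      2 < x ^ 4 + 40 * ((q : ℝ) - 50) * x ^ 2 - 40 * r' * x + S := by
  intro k
  induction k with
  | zero => intro r h; simp [down] at h
  | succ k ih =>
    intro r h r' h1 h2
    cases r with
    | zero => omega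
    | succ r0 =>
      have h' : (certB S q a (r0 + 1) || (killed S q (r0 + 1) && down S q a k r0)) = true := h
      rw [Bool.or_eq_true, Bool.and_eq_true] at h'
      rcases h' with h' | ⟨h3, h4⟩
      · right
        intro x hx
        have := certB_sound _ _ _ _ h' ha x hx
        have hle : (r' : ℝ) * x ≤ ((r0 + 1 : ℕ) : ℝ) * x :=
          mul_le_mul_of_nonneg_right (by exact_mod_cast h2) hx
        linarith
      · rcases Nat.lt_or_ge r0 r' with hc | hc
        · have : r' = r0 + 1 := by omega
          subst this; exact Or.inl h3
        · exact ih r0 h4 r' h1 hc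

theorem chk_sound (S q r : ℕ) (h : chk S q = true) (hr : 1 ≤ r)
    (hnn : ∀ a : ℕ, 0 ≤ ff (q - 50) r S a 64)
    (hpar : ((q : ℤ) - 50 - r) % 2 = 0)
    (h1 : InV (ff (q - 50) r S 1 1)) (h2 : InV (ff (q - 50) r S (-1) 1))
    (h3 : InV (ff (q - 50) r S 2 1)) (x : ℝ) (hx : 0 ≤ x)
    (hx2 : x ^ 4 + 40 * ((q : ℝ) - 50) * x ^ 2 - 40 * r * x + S ≤ 2) : False := by
  simp only [chk, forceN_eq] at h
  generalize sq0 (((40 * q - 2000 + (2000 - 40 * q)) ^ 2 + 12 * S) * 16777216) = g at h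
  generalize sq0 ((g + 2000 * 4096 - 40 * q * 4096) / 6) = a at h
  generalize (a ^ 4 + 40 * q * a ^ 2 * 4096 + S * 16777216 - 2000 * a ^ 2 * 4096) / (40 * a * 262144) = R at h
  simp only [chk1, Bool.and_eq_true, blt_iff] at h
  obtain ⟨⟨ha, hN⟩, hd⟩ := h
  rcases Nat.lt_or_ge R r with hc | hc
  · have := hnn a
    simp only [ff] at this
    zify at hN
    have h5 : 40 * (a : ℤ) * 262144 * (R + 1) ≤ 40 * (a : ℤ) * 262144 * r :=
      mul_le_mul_of_nonneg_left (by exact_mod_cast hc) (by positivity)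
    nlinarith
  · rcases down_sound S q a ha _ _ hd r hr hc with h6 | h6
    · exact killed_sound S q r h6 hpar h1 h2 h3
    · exact absurd (h6 x hx) (not_lt.mpr hx2)

theorem chkAll_sound (t u q : ℕ) (ht : t < 35) (hu : u ≤ t) (hq : q < 152)
    (hS : (t ^ 4 + u ^ 4) % 80 = 1) : chk (t ^ 4 + u ^ 4) q = true := by
  have h1 : chkT t = true := natrec_all chkT 35 chkAll_true t ht
  have h2 : chkTU t u = true := natrec_all (fun u => chkTU t u) (t + 1) h1 u (by omega)
  rw [chkTU, Bool.or_eq_true, forceN_eq] at h2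
  rcases h2 with h2 | h2
  · simp [hS] at h2
  · exact natrec_all (fun q => chk (t ^ 4 + u ^ 4) q) 152 h2 q hq

theorem finite_check (p r S : ℤ) (hp : -50 ≤ p) (hp' : p < 102) (hr : 1 ≤ r)
    (hSV : InV S) (hSb : S < 1500625) (hS80 : S % 80 = 1)
    (hpar : (p - r) % 2 = 0)
    (hV : ∀ x y : ℤ, InV (ff p r S x y)) (x : ℝ) (hx : 0 ≤ x)
    (hx2 : x ^ 4 + 40 * (p : ℝ) * x ^ 2 - 40 * r * x + S ≤ 2) : False := by
  obtain ⟨t, u, e⟩ := hSV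
  wlog htu : u ≤ t generalizing t u
  · exact this u t (by linarith) (by omega)
  obtain ⟨q, hq⟩ : ∃ q : ℕ, (q : ℤ) = p + 50 := ⟨(p + 50).toNat, by omega⟩
  obtain ⟨r', hr'⟩ : ∃ q : ℕ, (q : ℤ) = r := ⟨r.toNat, by omega⟩
  have hp1 : p = q - 50 := by omega
  have hSn : S = ((t ^ 4 + u ^ 4 : ℕ) : ℤ) := by rw [e]; push_cast; ring
  have ht : t < 35 := by
    by_contra hc
    have : 35 ^ 4 ≤ t ^ 4 := Nat.pow_le_pow_left (by omega) 4
    omega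
  have hc := chkAll_sound t u q ht htu (by omega) (by omega)
  generalize t ^ 4 + u ^ 4 = S' at hc hSn
  subst hp1 hSn hr'
  refine chk_sound S' q r' hc (by omega) ?_ hpar (hV 1 1) (hV (-1) 1) (hV 2 1) x hx ?_
  · intro a
    obtain ⟨t, u, e⟩ := hV a 64
    rw [e]; positivity
  · push_cast at hx2; exact hx2


theorem real_factor (P R S : ℝ) (hR : 0 < R) (hf : ∀ x : ℝ, 0 ≤ x ^ 4 + P * x ^ 2 - R * x + S) :
    ∃ h B1 B2 : ℝ, 0 < h ∧ 0 ≤ B1 ∧ B1 < B2 ∧ P = B1 + B2 - 2 * h ^ 2 ∧ R = 2 * h * (B2 - B1) ∧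
      S = (h ^ 2 + B1) * (h ^ 2 + B2) := by
  -- positive root of the resolvent
  obtain ⟨u, hu, hroot⟩ : ∃ u : ℝ, 0 < u ∧ u * (P + u) ^ 2 - R ^ 2 - 4 * S * u = 0 := by
    set M : ℝ := 1 + R ^ 2 + 4 * |S| + |P| with hM
    have hM0 : 0 ≤ M := by positivity
    have hcont : ContinuousOn (fun u : ℝ => u * (P + u) ^ 2 - R ^ 2 - 4 * S * u) (Set.Icc 0 M) := by
      fun_prop
    have hivt := intermediate_value_Icc hM0 hcont
    have hmem : (0 : ℝ) ∈ Set.Icc ((fun u : ℝ => u * (P + u) ^ 2 - R ^ 2 - 4 * S * u) 0)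
        ((fun u : ℝ => u * (P + u) ^ 2 - R ^ 2 - 4 * S * u) M) := by
      constructor
      · simp only; nlinarith [sq_nonneg R]
      · simp only
        have h1 : 1 + R ^ 2 + 4 * |S| ≤ P + M := by
          rw [hM]; linarith [neg_abs_le P]
        have h2 : (1 + R ^ 2 + 4 * |S|) ≤ (P + M) ^ 2 := by
          have : 1 ≤ 1 + R ^ 2 + 4 * |S| := by have := sq_nonneg R; have := abs_nonneg S; linarith
          nlinarith
        have h3 : 1 ≤ M := by
          rw [hM]; have := sq_nonneg R; have := abs_nonneg S; have := abs_nonneg P; linarith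
        have h4 : M * (1 + R ^ 2 + 4 * |S|) ≤ M * (P + M) ^ 2 := mul_le_mul_of_nonneg_left h2 hM0
        have h5 : S * M ≤ |S| * M := mul_le_mul_of_nonneg_right (le_abs_self S) hM0
        have h6 : R ^ 2 ≤ M * R ^ 2 := le_mul_of_one_le_left (sq_nonneg R) h3
        nlinarith
    obtain ⟨u, hu, hu0⟩ := hivt hmem
    refine ⟨u, ?_, hu0⟩
    rcases hu.1.lt_or_eq with h | h
    · exact h
    · exfalso
      simp only at hu0
      rw [← h] at hu0
      nlinarith [pow_pos hR 2]
  set h : ℝ := √u / 2 with hh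
  have hsu : 0 < √u := Real.sqrt_pos.mpr hu
  have hpos : 0 < h := by positivity
  have hu4 : u = 4 * h ^ 2 := by
    rw [hh, div_pow, Real.sq_sqrt hu.le]; ring
  clear_value h
  subst hu4
  set D : ℝ := R / (2 * h) with hD
  have hDR : R = 2 * h * D := by rw [hD]; field_simp
  have hD0 : 0 < D := by positivity
  clear_value D
  have hDu : (P + 4 * h ^ 2) ^ 2 - D ^ 2 = 4 * S := by
    have : 4 * h ^ 2 * ((P + 4 * h ^ 2) ^ 2 - D ^ 2 - 4 * S) = 0 := by
      rw [hDR] at hroot; linarith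
    have h4 : (4 * h ^ 2) ≠ 0 := by positivity
    have := (mul_eq_zero.mp this).resolve_left h4
    linarith
  set B1 := (P + 2 * h ^ 2 - D) / 2 with hB1
  set B2 := (P + 2 * h ^ 2 + D) / 2 with hB2
  have e1 : P = B1 + B2 - 2 * h ^ 2 := by rw [hB1, hB2]; ring
  have e2 : D = B2 - B1 := by rw [hB1, hB2]; ring
  have e3 : S = (h ^ 2 + B1) * (h ^ 2 + B2) := by rw [hB1, hB2]; linarith
  clear_value B1 B2
  have hff : ∀ x : ℝ, 0 ≤ ((x - h) ^ 2 + B1) * ((x + h) ^ 2 + B2) := by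
    intro x
    have := hf x
    rw [e3, hDR, e2, e1] at this
    linarith
  refine ⟨h, B1, B2, hpos, ?_, by linarith, e1, by rw [hDR, e2], e3⟩
  by_contra hneg
  push Not at hneg
  rcases le_or_gt 0 B2 with hb | hb
  · have := hff h
    have h7 : 0 < 4 * h ^ 2 + B2 := by positivity
    nlinarith
  · have hs : √(-B2) ^ 2 = -B2 := Real.sq_sqrt (by linarith)
    have hs0 : 0 ≤ √(-B2) := Real.sqrt_nonneg _
    have := hff (h + √(-B2))
    have h8 : (h + √(-B2) - h) ^ 2 + B1 < 0 := by
      rw [add_sub_cancel_left, hs]; linarith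
    have h9 : 0 < (h + √(-B2) + h) ^ 2 + B2 := by nlinarith
    nlinarith

theorem real_nonneg (p r S : ℤ) (hV : ∀ x y : ℤ, 0 ≤ ff p r S x y) (x : ℝ) :
    0 ≤ x ^ 4 + (40 * p : ℝ) * x ^ 2 - (40 * r : ℝ) * x + S := by
  have hcl : IsClosed {x : ℝ | 0 ≤ x ^ 4 + (40 * p : ℝ) * x ^ 2 - (40 * r : ℝ) * x + S} :=
    isClosed_le continuous_const (by fun_prop)
  have hd : Dense (Set.range ((↑) : ℚ → ℝ)) := Rat.denseRange_cast
  have hsub : Set.range ((↑) : ℚ → ℝ) ⊆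
      {x : ℝ | 0 ≤ x ^ 4 + (40 * p : ℝ) * x ^ 2 - (40 * r : ℝ) * x + S} := by
    rintro _ ⟨q, rfl⟩
    have h1 := hV q.num q.den
    have h2 : (0 : ℝ) ≤ (ff p r S q.num q.den : ℤ) := by exact_mod_cast h1
    have hden : (0 : ℝ) < q.den := by exact_mod_cast q.den_pos
    have e : (q : ℝ) = q.num / q.den := by exact_mod_cast (Rat.num_div_den q).symm
    simp only [Set.mem_ofPred_eq]
    have e2 : (q : ℝ) ^ 4 + (40 * p : ℝ) * (q : ℝ) ^ 2 - (40 * r : ℝ) * q + S =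
        (ff p r S q.num q.den : ℤ) / (q.den : ℝ) ^ 4 := by
      rw [e, ff]; push_cast; field_simp
    rw [e2]; positivity
  have := hcl.closure_subset_iff.mpr hsub
  rw [hd.closure_eq] at this
  exact this (Set.mem_univ x)

theorem disc_bound (p r S : ℤ) (hS80 : S % 80 = 1) (h B1 B2 : ℝ) (h1 : 0 ≤ B1) (h2 : B1 < B2)
    (e1 : (40 * p : ℝ) = B1 + B2 - 2 * h ^ 2) (e2 : (40 * r : ℝ) = 2 * h * (B2 - B1))
    (e3 : (S : ℝ) = (h ^ 2 + B1) * (h ^ 2 + B2)) :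
    16 ≤ B1 * B2 * (4 * h ^ 2 + B2 + B1) ^ 4 := by
  set N : ℤ := S ^ 3 - 800 * p ^ 2 * S ^ 2 + 36000 * p * r ^ 2 * S + 160000 * p ^ 4 * S
    - 1600000 * p ^ 3 * r ^ 2 - 270000 * r ^ 4 with hN
  have hNr : (16 * N : ℝ) = B1 * B2 * ((4 * h ^ 2 + B1 + B2) ^ 2 - 4 * B1 * B2) ^ 2 := by
    rw [hN]; push_cast
    have ep : (p : ℝ) = (B1 + B2 - 2 * h ^ 2) / 40 := by linarith
    have er : (r : ℝ) = (2 * h * (B2 - B1)) / 40 := by linarith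
    rw [ep, er, e3]; ring
  have hodd : N % 2 = 1 := by
    have : N = S ^ 3 + 2 * (- 400 * p ^ 2 * S ^ 2 + 18000 * p * r ^ 2 * S + 80000 * p ^ 4 * S
    - 800000 * p ^ 3 * r ^ 2 - 135000 * r ^ 4) := by rw [hN]; ring
    have hS2 : S % 2 = 1 := by omega
    have h3 : S ^ 3 % 2 = 1 := by
      rw [← Int.odd_iff] at hS2 ⊢; exact hS2.pow
    omega
  have hb2 : 0 ≤ B2 := by linarith
  have hN0 : (0 : ℝ) ≤ 16 * N := by rw [hNr]; positivity
  have hN1 : 1 ≤ N := by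
    have : 0 ≤ N := by
      have : (0 : ℝ) ≤ N := by linarith
      exact_mod_cast this
    omega
  have hN1r : (1 : ℝ) ≤ N := by exact_mod_cast hN1
  have h5 : (0 : ℝ) ≤ (4 * h ^ 2 + B1 + B2) ^ 2 - 4 * B1 * B2 := by
    nlinarith [sq_nonneg (B1 - B2), sq_nonneg h, mul_nonneg (sq_nonneg h) h1, mul_nonneg (sq_nonneg h) hb2, sq_nonneg (h^2)]
  have h6 : (4 * h ^ 2 + B1 + B2) ^ 2 - 4 * B1 * B2 ≤ (4 * h ^ 2 + B2 + B1) ^ 2 := by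
    nlinarith [mul_nonneg h1 hb2]
  have h7 : ((4 * h ^ 2 + B1 + B2) ^ 2 - 4 * B1 * B2) ^ 2 ≤ (4 * h ^ 2 + B2 + B1) ^ 4 := by
    calc _ ≤ ((4 * h ^ 2 + B2 + B1) ^ 2) ^ 2 := by gcongr
      _ = _ := by ring
  calc (16 : ℝ) ≤ 16 * N := by linarith
    _ = _ := hNr
    _ ≤ _ := by gcongr


theorem chain_ineq (y : ℕ → ℝ) (K : ℝ) (hK : 0 < K) (s : Finset ℕ) :
    s.Nonempty → (∀ i ∈ s, 1 ≤ y i ∧ 0 < i) →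
    (∀ i ∈ s, ∀ j ∈ s, i ≠ j → y i ≤ y j → K * (y i) ^ 2 ≤ (y j) ^ 2 * i) →
    ∃ m ∈ s, (∀ j ∈ s, y j ≤ y m) ∧ K ^ (s.card - 1) * m ≤ (y m) ^ 2 * ∏ i ∈ s, (i : ℝ) := by
  induction s using Finset.induction_on_max_value y with
  | empty => intro h; exact absurd h (by simp)
  | insert a s has hmax ih =>
    intro _ hpos hsp
    have hya := (hpos a (Finset.mem_insert_self a s)).1
    rcases s.eq_empty_or_nonempty with rfl | hne
    · refine ⟨a, by simp, by simp, ?_⟩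
      simp only [insert_empty_eq, Finset.card_singleton, Finset.prod_singleton]
      have : (0 : ℝ) ≤ a := by positivity
      have h2 : 1 ≤ y a ^ 2 := one_le_pow₀ hya
      simp only [Nat.sub_self, pow_zero]
      exact mul_le_mul_of_nonneg_right h2 this
    · obtain ⟨m, hm, hmm, hprod⟩ := ih hne (fun i hi => hpos i (Finset.mem_insert_of_mem hi))
        (fun i hi j hj => hsp i (Finset.mem_insert_of_mem hi) j (Finset.mem_insert_of_mem hj))
      refine ⟨a, by simp, ?_, ?_⟩
      · intro j hj
        rcases Finset.mem_insert.mp hj with rfl | hj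
        · exact le_rfl
        · exact hmax j hj
      · rw [Finset.card_insert_of_notMem has, Finset.prod_insert has]
        have hmpos : (0 : ℝ) < m := by exact_mod_cast (hpos m (Finset.mem_insert_of_mem hm)).2
        have hPpos : (0 : ℝ) ≤ ∏ i ∈ s, (i : ℝ) := Finset.prod_nonneg (fun i _ => by positivity)
        have h1 := hsp m (Finset.mem_insert_of_mem hm) a (Finset.mem_insert_self a s)
          (by rintro rfl; exact has hm) (hmax m hm)
        obtain ⟨c, hc⟩ : ∃ c, s.card = c + 1 := ⟨s.card - 1, by have := hne.card_pos; omega⟩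
        rw [hc] at hprod ⊢
        simp only [Nat.add_sub_cancel] at hprod ⊢
        set Pr := ∏ i ∈ s, (i : ℝ)
        have h2 : K ^ (c + 1) * m ≤ y a ^ 2 * m * Pr := by
          calc K ^ (c + 1) * m = K * (K ^ c * m) := by ring
            _ ≤ K * (y m ^ 2 * Pr) := by gcongr
            _ = (K * y m ^ 2) * Pr := by ring
            _ ≤ _ := by gcongr
        have h3 : K ^ (c + 1) ≤ y a ^ 2 * Pr := by
          have : K ^ (c + 1) * m ≤ (y a ^ 2 * Pr) * m := by linarith
          exact le_of_mul_le_mul_right this hmpos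
        calc K ^ (c + 1) * a ≤ (y a ^ 2 * Pr) * a := by gcongr
          _ = _ := by ring

theorem point_bound (h B1 B2 v x y : ℝ) (hh : 0 < h) (hB1 : 0 ≤ B1) (hB12 : B1 < B2)
    (hW : 4000 ≤ 4 * h ^ 2 + B2) (hr : 20 ≤ h * (B2 - B1)) (hv : v ≤ 337) (hy : 1 ≤ y)
    (hx : x ≤ -1 ∨ 0 ≤ x) (e : v = ((x - h * y) ^ 2 + B1 * y ^ 2) * ((x + h * y) ^ 2 + B2 * y ^ 2)) :
    ((x - h * y) ^ 2 + B1 * y ^ 2) * (0.9 * (4 * h ^ 2 + B2) * y ^ 2) ≤ v := by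
  have hB2 : 0 ≤ B2 := by linarith
  have hy2 : 1 ≤ y ^ 2 := by nlinarith
  have hhy : h ≤ h * y := le_mul_of_one_le_right hh.le hy
  have hBy : B2 ≤ B2 * y ^ 2 := le_mul_of_one_le_right hB2 hy2
  have hB1y : 0 ≤ B1 * y ^ 2 := by positivity
  have hx0 : 0 ≤ x := by
    rcases hx with hx | hx
    · exfalso
      have h1 : (1 + h) ^ 2 ≤ (x - h * y) ^ 2 + B1 * y ^ 2 := by nlinarith
      have h2 : B2 ≤ (x + h * y) ^ 2 + B2 * y ^ 2 := by nlinarith [sq_nonneg (x + h * y)]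
      have h3 : (1 + h) ^ 2 * B2 ≤ v := by rw [e]; gcongr
      have h4 : 20 ≤ h * B2 := by nlinarith
      rcases le_or_gt 15 h with h5 | h5
      · nlinarith
      · nlinarith
    · exact hx
  have h1 : (h * y) ^ 2 ≤ (x + h * y) ^ 2 := by
    have : 0 ≤ h * y := by positivity
    nlinarith
  have h2 : (x - h * y) ^ 2 ≤ 1 := by
    have h3 : (x - h * y) ^ 2 * 1000 ≤ v := by
      rw [e]
      gcongr
      · linarith
      · nlinarith [sq_nonneg h, mul_nonneg (sq_nonneg h) (sub_nonneg.mpr hy2)]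
    nlinarith
  have h3 : -1 ≤ x - h * y := by nlinarith
  have h40 : 40 * h ≤ 4 * h ^ 2 + B2 := by nlinarith [sq_nonneg (h - 20)]
  have h4 : (4 * h ^ 2 - 4 * h) * y ^ 2 ≤ (x + h * y) ^ 2 := by
    have e5 : (x + h * y) ^ 2 = 4 * h ^ 2 * y ^ 2 + 4 * (h * y) * (x - h * y) + (x - h * y) ^ 2 := by ring
    have h6 : -(4 * (h * y)) ≤ 4 * (h * y) * (x - h * y) := by
      nlinarith [mul_nonneg (by positivity : 0 ≤ 4 * (h * y)) (by linarith : 0 ≤ x - h * y + 1)]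
    have h7 : 4 * (h * y) ≤ 4 * h * y ^ 2 := by nlinarith [mul_nonneg hh.le (by nlinarith : 0 ≤ y ^ 2 - y)]
    nlinarith [sq_nonneg (x - h * y)]
  rw [e]
  apply mul_le_mul_of_nonneg_left _ (by positivity)
  nlinarith [mul_nonneg (by linarith : 0 ≤ 4 * h ^ 2 + B2 - 40 * h) (sq_nonneg y)]

theorem spacing (L h xi yi xj yj vi vj : ℝ) (hL : 3600 ≤ L) (hyi : 1 ≤ yi) (hij : yi ≤ yj)
    (hvi : vi ≤ 337) (hvj : vj ≤ 337)
    (ei : (xi - h * yi) ^ 2 * (L * yi ^ 2) ≤ vi) (ej : (xj - h * yj) ^ 2 * (L * yj ^ 2) ≤ vj)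
    (hdet : 1 ≤ |xi * yj - xj * yi|) :
    (0.88 ^ 2 * L) * yi ^ 2 ≤ yj ^ 2 * vi := by
  set a := |xi - h * yi| * yi with ha
  set b := |xj - h * yj| * yj with hb
  have hyj : 1 ≤ yj := by linarith
  have ha0 : 0 ≤ a := by positivity
  have hb0 : 0 ≤ b := by positivity
  have ha2 : a ^ 2 * L ≤ vi := by rw [ha, mul_pow, sq_abs]; linarith
  have hb2 : b ^ 2 * L ≤ vj := by rw [hb, mul_pow, sq_abs]; linarith
  have ha3 : a ≤ 0.306 := by
    by_contra hc
    push Not at hc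
    have h1 : 0.306 ^ 2 < a ^ 2 := by gcongr
    have h2 : a ^ 2 * 3600 ≤ a ^ 2 * L := by gcongr
    norm_num at h1; linarith
  have hb3 : b ≤ 0.306 := by
    by_contra hc
    push Not at hc
    have h1 : 0.306 ^ 2 < b ^ 2 := by gcongr
    have h2 : b ^ 2 * 3600 ≤ b ^ 2 * L := by gcongr
    norm_num at h1; linarith
  set ρ := yj / yi with hρ
  have hyi0 : 0 < yi := by linarith
  have hρ1 : 1 ≤ ρ := (one_le_div hyi0).mpr hij
  have hyjρ : yj = ρ * yi := by rw [hρ]; field_simp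
  have hsum : 1 ≤ a * ρ + b / ρ := by
    have h1 : |xi * yj - xj * yi| ≤ |xi - h * yi| * yj + |xj - h * yj| * yi := by
      have : xi * yj - xj * yi = (xi - h * yi) * yj - (xj - h * yj) * yi := by ring
      rw [this]
      refine (abs_sub _ _).trans ?_
      rw [abs_mul, abs_mul, abs_of_pos hyi0, abs_of_pos (by linarith : 0 < yj)]
    have h2 : a * ρ + b / ρ = |xi - h * yi| * yj + |xj - h * yj| * yi := by
      rw [ha, hb, hρ]; field_simp
    rw [h2]; linarith
  have ht : 0.88 ≤ a * ρ := by
    by_contra hc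
    push Not at hc
    set s := b / ρ with hs
    set t := a * ρ with ht
    have hs0 : 0 ≤ s := by positivity
    have hs1 : s ≤ 0.306 := by
      rw [hs, div_le_iff₀ (by linarith)]; nlinarith
    have hts : t * s = a * b := by rw [hs, ht]; field_simp
    have hab : a * b ≤ 0.306 * 0.306 := by gcongr
    have ht1 : 0.694 ≤ t := by linarith
    nlinarith
  have h5 : 0.88 ^ 2 ≤ (a * ρ) ^ 2 := by gcongr
  calc (0.88 ^ 2 * L) * yi ^ 2 ≤ ((a * ρ) ^ 2 * L) * yi ^ 2 := by gcongr
    _ = (ρ * yi) ^ 2 * (a ^ 2 * L) := by ring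
    _ = yj ^ 2 * (a ^ 2 * L) := by rw [← hyjρ]
    _ ≤ _ := by gcongr


/-- the values used -/
def vals : Finset ℕ := {2, 17, 82, 97, 257, 337}

theorem vals_le : ∀ v ∈ vals, v ≤ 337 ∧ 2 ≤ v := by decide

theorem vals_ratio : ∀ i ∈ vals, ∀ j ∈ vals, i ≠ j → ∀ n < 400, n ^ 4 ≠ i * j ^ 3 := by
  decide +kernel

theorem vals_pow : ∀ i ∈ vals, ∀ n < 400, n ^ 4 ≠ i := by
  decide +kernel

theorem vals_pow' (i : ℕ) (hi : i ∈ vals) (x : ℤ) : x ^ 4 ≠ i := by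
  intro h
  have h1 : x.natAbs ^ 4 = i := by
    have h2 : ((x.natAbs : ℤ)) ^ 4 = i := by
      rw [← h]
      have : (x.natAbs : ℤ) ^ 2 = x ^ 2 := Int.natAbs_sq x
      calc (x.natAbs : ℤ) ^ 4 = ((x.natAbs : ℤ) ^ 2) ^ 2 := by ring
        _ = _ := by rw [this]; ring
    exact_mod_cast h2
  refine vals_pow i hi x.natAbs ?_ h1
  by_contra hc
  have : 400 ^ 4 ≤ x.natAbs ^ 4 := Nat.pow_le_pow_left (by omega) 4
  have := (vals_le i hi).1
  omega

theorem det_ne (i j : ℕ) (hi : i ∈ vals) (hj : j ∈ vals) (hij : i ≠ j) (yi yj : ℕ) (hyj : 0 < yj) :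
    i * yj ^ 4 ≠ j * yi ^ 4 := by
  intro h
  have h1 : yj ^ 4 ∣ (j * yi) ^ 4 := ⟨i * j ^ 3, by
    calc (j * yi) ^ 4 = j ^ 3 * (j * yi ^ 4) := by ring
      _ = _ := by rw [← h]; ring⟩
  obtain ⟨n, hn⟩ := (Nat.pow_dvd_pow_iff (by norm_num)).mp h1
  have h2 : n ^ 4 = i * j ^ 3 := by
    have : yj ^ 4 * n ^ 4 = yj ^ 4 * (i * j ^ 3) := by
      calc yj ^ 4 * n ^ 4 = (j * yi) ^ 4 := by rw [hn]; ring
        _ = j ^ 3 * (j * yi ^ 4) := by ring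
        _ = _ := by rw [← h]; ring
    exact Nat.eq_of_mul_eq_mul_left (by positivity) this
  refine vals_ratio i hi j hj hij n ?_ h2
  by_contra hc
  have h3 : 400 ^ 4 ≤ n ^ 4 := Nat.pow_le_pow_left (by omega) 4
  have h4 : i * j ^ 3 ≤ 337 * 337 ^ 3 :=
    Nat.mul_le_mul (vals_le i hi).1 (Nat.pow_le_pow_left (vals_le j hj).1 3)
  omega

theorem ff_hom (p r S x y k : ℤ) : ff p r S (k * x) (k * y) = k ^ 4 * ff p r S x y := by
  simp only [ff]; ring

theorem ff_neg (p r S x y : ℤ) : ff p r S (-x) (-y) = ff p r S x y := by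
  simp only [ff]; ring

theorem pos_point (p r S : ℤ) (v : ℕ) (hv : v ∈ vals) (h : ∃ x y : ℤ, ff p r S x y = v) :
    ∃ x y : ℤ, 1 ≤ y ∧ ff p r S x y = v := by
  obtain ⟨x, y, e⟩ := h
  rcases lt_trichotomy y 0 with hy | hy | hy
  · exact ⟨-x, -y, by omega, by rw [ff_neg, e]⟩
  · exfalso
    subst hy
    refine vals_pow' v hv x ?_
    rw [← e]; simp only [ff]; ring
  · exact ⟨x, y, by omega, e⟩

theorem det_int (p r S : ℤ) (i j : ℕ) (hi : i ∈ vals) (hj : j ∈ vals) (hij : i ≠ j)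
    (xi yi xj yj : ℤ) (hyi : 1 ≤ yi) (hyj : 1 ≤ yj) (ei : ff p r S xi yi = i)
    (ej : ff p r S xj yj = j) : 1 ≤ |xi * yj - xj * yi| := by
  refine Int.one_le_abs ?_
  intro h0
  have h1 : ff p r S (yj * xi) (yj * yi) = ff p r S (yi * xj) (yi * yj) := by
    rw [show yj * xi = yi * xj by linarith, mul_comm yj yi]
  rw [ff_hom, ff_hom, ei, ej] at h1
  obtain ⟨a, rfl⟩ : ∃ a : ℕ, yi = a := ⟨yi.toNat, by omega⟩
  obtain ⟨b, rfl⟩ : ∃ b : ℕ, yj = b := ⟨yj.toNat, by omega⟩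
  refine det_ne i j hi hj hij a b (by omega) ?_
  zify; linarith

theorem final_num (W B1 : ℝ) (hW : 4000 ≤ W) (hB : B1 ≤ 1) (hB0 : 0 ≤ B1)
    (h1 : 16 ≤ B1 * W * (W + B1) ^ 4)
    (h2 : B1 * (0.9 * W) * ((0.88 ^ 2 * (0.9 * W)) ^ 5) ^ 2 ≤ (2 * 17 * 82 * 97 * 257 * 337) ^ 2 / 2) :
    False := by
  have hW0 : 0 < W := by linarith
  have h3 : B1 * W * (W + B1) ^ 4 ≤ B1 * W * (1.00025 * W) ^ 4 := by
    gcongr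
    linarith
  have h4 : 16 ≤ (1.00025 ^ 4) * (B1 * W ^ 5) := by
    calc (16 : ℝ) ≤ B1 * W * (1.00025 * W) ^ 4 := h1.trans h3
      _ = _ := by ring
  have h5 : (4000 : ℝ) ^ 6 ≤ W ^ 6 := by gcongr
  have h6 : B1 * (0.9 * W) * ((0.88 ^ 2 * (0.9 * W)) ^ 5) ^ 2 =
      0.9 ^ 11 * 0.88 ^ 20 * (B1 * W ^ 5) * W ^ 6 := by ring
  have h7 : 15.9 ≤ B1 * W ^ 5 := by norm_num at h4 ⊢; linarith
  have h8 : 0.9 ^ 11 * 0.88 ^ 20 * 15.9 * (4000 : ℝ) ^ 6 ≤ 0.9 ^ 11 * 0.88 ^ 20 * (B1 * W ^ 5) * W ^ 6 := by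
    gcongr
  rw [← h6] at h8
  have h9 := h8.trans h2
  norm_num at h9

set_option maxHeartbeats 2000000 in
theorem big_W (p r S : ℤ) (hr : 1 ≤ r) (hS80 : S % 80 = 1) (h B1 B2 : ℝ) (hh : 0 < h)
    (h1 : 0 ≤ B1) (h2 : B1 < B2)
    (e1 : (40 * p : ℝ) = B1 + B2 - 2 * h ^ 2) (e2 : (40 * r : ℝ) = 2 * h * (B2 - B1))
    (e3 : (S : ℝ) = (h ^ 2 + B1) * (h ^ 2 + B2)) (hsm : B1 * (h ^ 2 + B2) ≤ 2)
    (hW : 4000 ≤ 4 * h ^ 2 + B2)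
    (hval : ∀ v ∈ vals, ∃ x y : ℤ, ff p r S x y = v) : False := by
  have hpt : ∀ v : ℕ, ∃ x y : ℤ, v ∈ vals → (1 ≤ y ∧ ff p r S x y = v) := by
    intro v
    by_cases hv : v ∈ vals
    · obtain ⟨x, y, hxy⟩ := pos_point p r S v hv (hval v hv)
      exact ⟨x, y, fun _ => hxy⟩
    · exact ⟨0, 0, fun h => absurd h hv⟩
  choose x y hxy using hpt
  have hr1 : (1 : ℝ) ≤ r := by exact_mod_cast hr
  have hB2 : 0 < B2 := by linarith
  set W := 4 * h ^ 2 + B2 with hWd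
  have hb : ∀ v ∈ vals, (((x v : ℝ) - h * y v) ^ 2 + B1 * (y v : ℝ) ^ 2) * (0.9 * W * (y v : ℝ) ^ 2) ≤ v := by
    intro v hv
    obtain ⟨hy, e⟩ := hxy v hv
    refine point_bound h B1 B2 v (x v) (y v) hh h1 h2 hW (by nlinarith)
      (by exact_mod_cast (vals_le v hv).1) (by exact_mod_cast hy) ?_ ?_
    · rcases le_or_gt 0 (x v) with hc | hc
      · right; exact_mod_cast hc
      · left; exact_mod_cast (by omega : x v ≤ -1)
    · have er : (v : ℝ) = ((ff p r S (x v) (y v) : ℤ) : ℝ) := by rw [e]; simp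
      rw [er, ff]; push_cast
      rw [e1, e2, e3]; ring
  have hchain := chain_ineq (fun v => (y v : ℝ)) (0.88 ^ 2 * (0.9 * W)) (by positivity) vals
    ⟨2, by decide⟩ (by
      intro i hi
      refine ⟨by exact_mod_cast (hxy i hi).1, by have := (vals_le i hi).2; omega⟩) (by
      intro i hi j hj hij hyy
      have hyi : (1 : ℝ) ≤ y i := by exact_mod_cast (hxy i hi).1
      have hyj : (1 : ℝ) ≤ y j := by exact_mod_cast (hxy j hj).1
      refine spacing (0.9 * W) h (x i) (y i) (x j) (y j) i j (by linarith) hyi hyy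
        (by exact_mod_cast (vals_le i hi).1) (by exact_mod_cast (vals_le j hj).1) ?_ ?_ ?_
      · refine le_trans ?_ (hb i hi)
        gcongr
        have : 0 ≤ B1 * (y i : ℝ) ^ 2 := by positivity
        linarith
      · refine le_trans ?_ (hb j hj)
        gcongr
        have : 0 ≤ B1 * (y j : ℝ) ^ 2 := by positivity
        linarith
      · have := det_int p r S i j hi hj hij _ _ _ _ (hxy i hi).1 (hxy j hj).1 (hxy i hi).2 (hxy j hj).2
        exact_mod_cast this)
  obtain ⟨m, hm, -, hprod⟩ := hchain
  have hcard : vals.card = 6 := by decide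
  have hpr : ∏ i ∈ vals, (i : ℝ) = 2 * 17 * 82 * 97 * 257 * 337 := by
    simp [vals]; norm_num
  rw [hcard, hpr] at hprod
  simp only [show 6 - 1 = 5 from rfl] at hprod
  have hbm := hb m hm
  have hm2 : (2 : ℝ) ≤ m := by exact_mod_cast (vals_le m hm).2
  have hym : (1 : ℝ) ≤ y m := by exact_mod_cast (hxy m hm).1
  set Y := (y m : ℝ)
  set Q : ℝ := (0.88 ^ 2 * (0.9 * W)) ^ 5 with hQ
  have hQ0 : 0 ≤ Q := by positivity
  have hbm2 : B1 * (0.9 * W) * Y ^ 4 ≤ m := by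
    refine le_trans ?_ hbm
    have : B1 * (0.9 * W) * Y ^ 4 = (B1 * Y ^ 2) * (0.9 * W * Y ^ 2) := by ring
    rw [this]
    gcongr
    have := sq_nonneg ((x m : ℝ) - h * Y)
    linarith
  have hsq : (Q * m) ^ 2 ≤ (Y ^ 2 * (2 * 17 * 82 * 97 * 257 * 337)) ^ 2 := by gcongr
  have hfin : B1 * (0.9 * W) * Q ^ 2 ≤ (2 * 17 * 82 * 97 * 257 * 337) ^ 2 / 2 := by
    have h5 : (B1 * (0.9 * W) * Q ^ 2) * m ^ 2 ≤ m * (2 * 17 * 82 * 97 * 257 * 337) ^ 2 := by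
      calc (B1 * (0.9 * W) * Q ^ 2) * m ^ 2 = B1 * (0.9 * W) * (Q * m) ^ 2 := by ring
        _ ≤ B1 * (0.9 * W) * (Y ^ 2 * (2 * 17 * 82 * 97 * 257 * 337)) ^ 2 := by gcongr
        _ = (B1 * (0.9 * W) * Y ^ 4) * (2 * 17 * 82 * 97 * 257 * 337) ^ 2 := by ring
        _ ≤ _ := by gcongr
    have h6 : (B1 * (0.9 * W) * Q ^ 2) * m ≤ (2 * 17 * 82 * 97 * 257 * 337) ^ 2 := by
      have hm0 : (0 : ℝ) < m := by linarith
      refine le_of_mul_le_mul_right ?_ hm0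
      linarith
    have h7 : (B1 * (0.9 * W) * Q ^ 2) * 2 ≤ (B1 * (0.9 * W) * Q ^ 2) * m := by gcongr
    rw [le_div_iff₀ (by norm_num)]
    exact h7.trans h6
  have hB1 : B1 ≤ 1 := by
    have : (1000 : ℝ) ≤ h ^ 2 + B2 := by nlinarith
    nlinarith
  refine final_num W B1 hW hB1 h1 ?_ hfin
  refine (disc_bound p r S hS80 h B1 B2 h1 h2 e1 e2 e3).trans ?_
  rw [← hWd]
  gcongr
  rw [hWd]; nlinarith [sq_nonneg h]

theorem step4 (p r S : ℤ) (hr : 1 ≤ r) (hS80 : S % 80 = 1) (hpar : (p - r) % 2 = 0)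
    (hV : ∀ x y : ℤ, InV (ff p r S x y))
    (hval : ∀ v ∈ vals, ∃ x y : ℤ, ff p r S x y = v) : False := by
  have hnn : ∀ x y : ℤ, 0 ≤ ff p r S x y := by
    intro x y
    obtain ⟨t, u, e⟩ := hV x y
    rw [e]; positivity
  have hr1 : (1 : ℝ) ≤ r := by exact_mod_cast hr
  obtain ⟨h, B1, B2, hh, h1, h2, e1, e2, e3⟩ := real_factor (40 * p) (40 * r) S (by linarith)
    (real_nonneg p r S hnn)
  obtain ⟨m, n, hn, emn⟩ := pos_point p r S 2 (by decide) (hval 2 (by decide))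
  have hm : 0 ≤ m := by
    by_contra hc
    push Not at hc
    have h5 := hnn (-m) n
    have h6 : ff p r S m n = ff p r S (-m) n + 80 * (r * (-m) * n ^ 3) := by
      simp only [ff]; ring
    have h7 : 1 ≤ r * (-m) * n ^ 3 := by
      have : 0 < r * (-m) * n ^ 3 := by
        have : 0 < -m := by linarith
        have : 0 < r := by linarith
        have : 0 < n := by linarith
        positivity
      linarith
    rw [emn] at h6
    push_cast at h6
    linarith
  have hn1 : (1 : ℝ) ≤ n := by exact_mod_cast hn
  have hm1 : (0 : ℝ) ≤ m := by exact_mod_cast hm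
  have emnR : ((ff p r S m n : ℤ) : ℝ) = 2 := by rw [emn]; norm_num
  have hB2 : 0 < B2 := by linarith
  have hn2 : (1 : ℝ) ≤ (n : ℝ) ^ 2 := by nlinarith
  have hsm : B1 * (h ^ 2 + B2) ≤ 2 := by
    have e4 : (2 : ℝ) = ((m - h * n) ^ 2 + B1 * n ^ 2) * ((m + h * n) ^ 2 + B2 * n ^ 2) := by
      rw [← emnR, ff]; push_cast
      rw [e1, e2, e3]; ring
    rw [e4]
    apply mul_le_mul _ _ (by positivity) (by positivity)
    · nlinarith [sq_nonneg ((m : ℝ) - h * n)]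
    · have : 0 ≤ (m : ℝ) * (h * n) := by positivity
      nlinarith [sq_nonneg (m : ℝ), mul_nonneg (sq_nonneg h) (sub_nonneg.mpr hn2),
        mul_nonneg hB2.le (sub_nonneg.mpr hn2)]
  rcases le_or_gt 4000 (4 * h ^ 2 + B2) with hW | hW
  · exact big_W p r S hr hS80 h B1 B2 hh h1 h2 e1 e2 e3 hsm hW hval
  · have hB1 : B1 < 2 := by
      by_contra hc
      push Not at hc
      nlinarith [sq_nonneg h]
    have hS : S < 1500625 := by
      have : (S : ℝ) < 1500625 := by
        rw [e3]
        nlinarith [sq_nonneg (h ^ 2 - 2000 / 3), sq_nonneg h, mul_nonneg (sq_nonneg h) (by linarith : 0 ≤ 4000 - (4 * h ^ 2 + B2))]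
      exact_mod_cast this
    have hp1 : -50 ≤ p := by
      have : (-50 : ℝ) ≤ p := by nlinarith [sq_nonneg h]
      exact_mod_cast this
    have hp2 : p < 102 := by
      have : (p : ℝ) < 102 := by nlinarith [sq_nonneg h]
      exact_mod_cast this
    have hSV : InV S := by
      have := hV 0 1
      simpa [ff] using this
    refine finite_check p r S hp1 hp2 hr hSV hS hS80 hpar hV (m / n) (by positivity) ?_
    have e5 : ((m : ℝ) / n) ^ 4 + 40 * (p : ℝ) * (m / n) ^ 2 - 40 * r * (m / n) + S =
        ((ff p r S m n : ℤ) : ℝ) / n ^ 4 := by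
      rw [ff]; push_cast; field_simp
    rw [e5, emnR, div_le_iff₀ (by positivity)]
    nlinarith


theorem InV_mod16 (v : ℤ) (h : InV v) : v % 16 = 0 ∨ v % 16 = 1 ∨ v % 16 = 2 := by
  obtain ⟨t, u, rfl⟩ := h
  have key : ∀ t : ℤ, t ^ 4 % 16 = 0 ∨ t ^ 4 % 16 = 1 := by
    intro t
    rcases Int.even_or_odd' t with ⟨k, rfl | rfl⟩
    · left; ring_nf; omega
    · right
      have e : (2 * k + 1) ^ 4 = 16 * (k ^ 4 + 2 * k ^ 3 + k ^ 2) + 8 * (k * (k + 1)) + 1 := by ring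
      obtain ⟨j, hj⟩ := Int.even_mul_succ_self k
      rw [e, hj]; omega
  have h1 := key t
  have h2 := key u
  omega

theorem InV_mod3 (v : ℤ) (h : InV v) (h0 : v % 3 = 0) : v % 9 = 0 := by
  obtain ⟨t, u, rfl⟩ := h
  have key : ∀ t : ℤ, (t ^ 4 % 9 = 0 ∨ t ^ 4 % 3 = 1) := by
    intro t
    have : t % 3 = 0 ∨ t % 3 = 1 ∨ t % 3 = 2 := by omega
    rcases this with h | h | h
    · left
      obtain ⟨k, rfl⟩ : ∃ k, t = 3 * k := ⟨t / 3, by omega⟩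
      ring_nf; omega
    · right; simp [pow_succ, Int.mul_emod, h]
    · right; simp [pow_succ, Int.mul_emod, h]
  have h1 := key t
  have h2 := key u
  omega

theorem InV_mod5 (v : ℤ) (h : InV v) : v % 25 = 0 ∨ v % 5 = 1 ∨ v % 5 = 2 := by
  obtain ⟨t, u, rfl⟩ := h
  have key : ∀ t : ℤ, (t ^ 4 % 25 = 0 ∨ t ^ 4 % 5 = 1) := by
    intro t
    have : t % 5 = 0 ∨ t % 5 = 1 ∨ t % 5 = 2 ∨ t % 5 = 3 ∨ t % 5 = 4 := by omega
    rcases this with h | h | h | h | h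
    · left
      obtain ⟨k, rfl⟩ : ∃ k, t = 5 * k := ⟨t / 5, by omega⟩
      ring_nf; omega
    all_goals right; simp [pow_succ, Int.mul_emod, h]
  have h1 := key t
  have h2 := key u
  omega

set_option maxHeartbeats 4000000 in
theorem pat16 (A B C D : ℤ)
    (m1 : A % 16 = 0 ∨ A % 16 = 1 ∨ A % 16 = 2) (m2 : B % 16 = 0 ∨ B % 16 = 1 ∨ B % 16 = 2)
    (m3 : C % 16 = 0 ∨ C % 16 = 1 ∨ C % 16 = 2) (m4 : D % 16 = 0 ∨ D % 16 = 1 ∨ D % 16 = 2)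
    (m5 : (225 - 144 * A + 40 * B + 360 * C - 30 * (D - 12 + 3 * A - 3 * B - C)) % 16 = 0 ∨
      (225 - 144 * A + 40 * B + 360 * C - 30 * (D - 12 + 3 * A - 3 * B - C)) % 16 = 1 ∨
      (225 - 144 * A + 40 * B + 360 * C - 30 * (D - 12 + 3 * A - 3 * B - C)) % 16 = 2)
    (m6 : (1260 - 35 * A + 15 * B + 21 * C - 35 * (D - 12 + 3 * A - 3 * B - C)) % 16 = 0 ∨
      (1260 - 35 * A + 15 * B + 21 * C - 35 * (D - 12 + 3 * A - 3 * B - C)) % 16 = 1 ∨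
      (1260 - 35 * A + 15 * B + 21 * C - 35 * (D - 12 + 3 * A - 3 * B - C)) % 16 = 2) :
    (A % 16 = 0 ∧ B % 16 = 1 ∧ C % 16 = 1 ∧ (D - 12 + 3 * A - 3 * B - C) % 16 = 0) ∨
    (A % 16 = 1 ∧ B % 16 = 2 ∧ C % 16 = 2 ∧ (D - 12 + 3 * A - 3 * B - C) % 16 = 0) ∨
    (D - 12 + 3 * A - 3 * B - C) % 16 = 8 := by
  rcases m1 with m1 | m1 | m1 <;> rcases m2 with m2 | m2 | m2 <;> rcases m3 with m3 | m3 | m3 <;>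
    rcases m4 with m4 | m4 | m4 <;> omega

set_option maxHeartbeats 1000000 in
theorem local_pat (b c d e : ℚ)
    (hφ : ∀ x y : ℤ, ∃ v : ℤ, InV v ∧
      (x : ℚ) ^ 4 + b * x ^ 3 * y + c * x ^ 2 * y ^ 2 + d * x * y ^ 3 + e * y ^ 4 = v) :
    ∃ A B C β : ℤ, e = A ∧ 1 + b + c + d + e = B ∧ 1 - b + c - d + e = C ∧ 6 * b = β ∧ β % 24 = 0 ∧
      ((A % 16 = 0 ∧ B % 16 = 1 ∧ C % 16 = 1 ∧ β % 16 = 0) ∨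
       (A % 16 = 1 ∧ B % 16 = 2 ∧ C % 16 = 2 ∧ β % 16 = 0) ∨ β % 16 = 8) := by
  obtain ⟨A, hA, eA⟩ := hφ 0 1
  obtain ⟨B, hB, eB⟩ := hφ 1 1
  obtain ⟨C, hC, eC⟩ := hφ (-1) 1
  obtain ⟨D, hD, eD⟩ := hφ 2 1
  obtain ⟨v5, hv5, e5⟩ := hφ 5 1
  obtain ⟨v8, hv8, e8⟩ := hφ 8 1
  obtain ⟨v11, hv11, e11⟩ := hφ 11 1
  obtain ⟨v14, hv14, e14⟩ := hφ 14 1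
  obtain ⟨w, hw, ew⟩ := hφ (-5) 4
  obtain ⟨z, hz, ez⟩ := hφ (-6) 1
  push_cast at eA eB eC eD e5 e8 e11 e14 ew ez
  set β : ℤ := D - 12 + 3 * A - 3 * B - C with hβ
  have hβb : 6 * b = β := by rw [hβ]; push_cast; linarith
  have i5 : v5 = 625 + 20 * β + 15 * B + 10 * C - 25 * (1 + A) + A := by
    have : (v5 : ℚ) = 625 + 20 * β + 15 * B + 10 * C - 25 * (1 + A) + A := by linarith
    exact_mod_cast this
  have i8 : v8 = 4096 + 84 * β + 36 * B + 28 * C - 64 * (1 + A) + A := by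
    have : (v8 : ℚ) = 4096 + 84 * β + 36 * B + 28 * C - 64 * (1 + A) + A := by linarith
    exact_mod_cast this
  have i11 : v11 = 14641 + 220 * β + 66 * B + 55 * C - 121 * (1 + A) + A := by
    have : (v11 : ℚ) = 14641 + 220 * β + 66 * B + 55 * C - 121 * (1 + A) + A := by linarith
    exact_mod_cast this
  have i14 : v14 = 38416 + 455 * β + 105 * B + 91 * C - 196 * (1 + A) + A := by
    have : (v14 : ℚ) = 38416 + 455 * β + 105 * B + 91 * C - 196 * (1 + A) + A := by linarith
    exact_mod_cast this
  have iw : w = 225 - 144 * A + 40 * B + 360 * C - 30 * β := by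
    have : (w : ℚ) = 225 - 144 * A + 40 * B + 360 * C - 30 * β := by linarith
    exact_mod_cast this
  have iz : z = 1260 - 35 * A + 15 * B + 21 * C - 35 * β := by
    have : (z : ℚ) = 1260 - 35 * A + 15 * B + 21 * C - 35 * β := by linarith
    exact_mod_cast this
  have h3 : β % 3 = 0 := by
    have a1 := InV_mod3 _ hC
    have a2 := InV_mod3 _ hD
    have a3 := InV_mod3 _ hv5
    have a4 := InV_mod3 _ hv8
    have a5 := InV_mod3 _ hv11
    have a6 := InV_mod3 _ hv14
    have iD : D = β + 12 - 3 * A + 3 * B + C := by omega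
    clear_value β
    subst i5 i8 i11 i14 iD
    clear hv5 hv8 hv11 hv14 hD eD e5 e8 e11 e14 hβ
    by_contra hne
    have hc : C % 3 = 0 ∨ (β + C) % 3 = 0 ∨ (2 * β + C) % 3 = 0 := by
      clear a1 a2 a3 a4 a5 a6 iw iz
      have c1 : β % 3 = 1 ∨ β % 3 = 2 := by omega
      have c2 : C % 3 = 0 ∨ C % 3 = 1 ∨ C % 3 = 2 := by omega
      rcases c1 with c1 | c1 <;> rcases c2 with c2 | c2 | c2 <;> omega
    rcases hc with hc | hc | hc
    · have := a1 hc
      have := a4 (by omega)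
      omega
    · have := a2 (by omega)
      have := a5 (by omega)
      omega
    · have := a3 (by omega)
      have := a6 (by omega)
      omega
  have m1 := InV_mod16 _ hA
  have m2 := InV_mod16 _ hB
  have m3 := InV_mod16 _ hC
  have m4 := InV_mod16 _ hD
  have m5 := InV_mod16 _ hw
  have m6 := InV_mod16 _ hz
  have pat : ((A % 16 = 0 ∧ B % 16 = 1 ∧ C % 16 = 1 ∧ β % 16 = 0) ∨
       (A % 16 = 1 ∧ B % 16 = 2 ∧ C % 16 = 2 ∧ β % 16 = 0) ∨ β % 16 = 8) := by
    rw [iw, hβ] at m5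
    rw [iz, hβ] at m6
    exact pat16 A B C D m1 m2 m3 m4 m5 m6
  refine ⟨A, B, C, β, by linarith, by linarith, by linarith, hβb, by omega, pat⟩

theorem mod5_dec : ∀ P R S : ZMod 5,
    (∀ n : ZMod 5, n ^ 4 + P * n ^ 2 + R * n + S = 1 ∨ n ^ 4 + P * n ^ 2 + R * n + S = 2 ∨
      (n ^ 4 + P * n ^ 2 + R * n + S = 0 ∧ 4 * n ^ 3 + 2 * P * n + R = 0)) →
    (∃ n : ZMod 5, n ^ 4 + P * n ^ 2 + R * n + S = 2) → P = 0 ∧ R = 0 ∧ S = 1 := by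
  decide +kernel

theorem local5 (P R S : ℤ) (hV : ∀ x y : ℤ, InV (x ^ 4 + P * x ^ 2 * y ^ 2 + R * x * y ^ 3 + S * y ^ 4))
    (h2 : ∃ x y : ℤ, x ^ 4 + P * x ^ 2 * y ^ 2 + R * x * y ^ 3 + S * y ^ 4 = 2) :
    P % 5 = 0 ∧ R % 5 = 0 ∧ S % 5 = 1 := by
  have key1 : ∀ y : ZMod 5, y ≠ 0 → y ^ 4 = 1 := by decide
  have key2 : ∀ y : ZMod 5, y ^ 4 ≠ 2 := by decide
  have hfact : Fact (Nat.Prime 5) := ⟨by norm_num⟩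
  have hcast : ∀ a b : ℤ, a % 5 = b % 5 ↔ (a : ZMod 5) = b := by
    intro a b
    exact (ZMod.intCast_eq_intCast_iff' a b 5).symm
  have key := mod5_dec P R S ?_ ?_
  · obtain ⟨h1, h2, h3⟩ := key
    refine ⟨?_, ?_, ?_⟩
    · simpa using (hcast P 0).mpr (by simpa using h1)
    · simpa using (hcast R 0).mpr (by simpa using h2)
    · simpa using (hcast S 1).mpr (by simpa using h3)
  · intro n
    obtain ⟨n, rfl⟩ := ZMod.intCast_surjective n
    have a1 := InV_mod5 _ (hV n 1)
    have a2 := InV_mod5 _ (hV (n + 5) 1)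
    rcases a1 with a1 | a1 | a1
    · right; right
      constructor
      · have := (hcast (n ^ 4 + P * n ^ 2 * 1 ^ 2 + R * n * 1 ^ 3 + S * 1 ^ 4) 0).mp (by omega)
        push_cast at this
        rw [← this]; ring
      · have e : (n + 5) ^ 4 + P * (n + 5) ^ 2 * 1 ^ 2 + R * (n + 5) * 1 ^ 3 + S * 1 ^ 4 =
          (n ^ 4 + P * n ^ 2 * 1 ^ 2 + R * n * 1 ^ 3 + S * 1 ^ 4) + 5 * (4 * n ^ 3 + 2 * P * n + R) +
            25 * (6 * n ^ 2 + 20 * n + 25 + P) := by ring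
        rw [e] at a2
        have := (hcast (4 * n ^ 3 + 2 * P * n + R) 0).mp (by omega)
        push_cast at this
        exact this
    · left
      have := (hcast (n ^ 4 + P * n ^ 2 * 1 ^ 2 + R * n * 1 ^ 3 + S * 1 ^ 4) 1).mp (by omega)
      push_cast at this
      rw [← this]; ring
    · right; left
      have := (hcast (n ^ 4 + P * n ^ 2 * 1 ^ 2 + R * n * 1 ^ 3 + S * 1 ^ 4) 2).mp (by omega)
      push_cast at this
      rw [← this]; ring
  · obtain ⟨x, y, h⟩ := h2
    have hz : (x : ZMod 5) ^ 4 + P * x ^ 2 * y ^ 2 + R * x * y ^ 3 + S * y ^ 4 = 2 := by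
      exact_mod_cast congrArg (Int.cast : ℤ → ZMod 5) h
    generalize (x : ZMod 5) = x at hz
    generalize (y : ZMod 5) = y at hz
    generalize (P : ZMod 5) = P at hz ⊢
    generalize (R : ZMod 5) = R at hz ⊢
    generalize (S : ZMod 5) = S at hz ⊢
    have hy : y ≠ 0 := by
      rintro rfl
      have : x ^ 4 = 2 := by rw [← hz]; ring
      exact key2 x this
    have hy4 : y ^ 4 = 1 := by
      exact key1 y hy
    refine ⟨x * y ^ 3, ?_⟩
    have e1 : (x * y ^ 3) ^ 4 + P * (x * y ^ 3) ^ 2 + R * (x * y ^ 3) + S =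
      x ^ 4 * (y ^ 4) ^ 3 + P * x ^ 2 * y ^ 2 * y ^ 4 + R * x * y ^ 3 + S := by ring
    rw [e1, hy4, ← hz, hy4]; ring

theorem excl16 (P R S : ℤ) (hS : S % 16 = 0) (h1 : (P + R) % 16 = 0) (h3 : (P - R) % 16 = 0)
    (h2 : ∃ x y : ℤ, x ^ 4 + P * x ^ 2 * y ^ 2 + R * x * y ^ 3 + S * y ^ 4 = 2) : False := by
  obtain ⟨x, y, h⟩ := h2
  obtain ⟨P', hP'⟩ : ∃ P', P = 8 * P' := ⟨P / 8, by omega⟩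
  obtain ⟨j, hj⟩ : ∃ j, R = P + 16 * j := ⟨(R - P) / 16, by omega⟩
  obtain ⟨s, hs⟩ : ∃ s, S = 16 * s := ⟨S / 16, by omega⟩
  obtain ⟨w, hw⟩ : ∃ w, x * y * (x + y) = 2 * w := by
    rcases Int.even_or_odd' x with ⟨a, ha | ha⟩ <;> rcases Int.even_or_odd' y with ⟨b, hb | hb⟩
    · exact ⟨a * y * (x + y), by rw [ha]; ring⟩
    · exact ⟨a * y * (x + y), by rw [ha]; ring⟩
    · exact ⟨b * x * (x + y), by rw [hb]; ring⟩
    · exact ⟨x * y * (a + b + 1), by rw [ha, hb]; ring⟩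
  have e0 : x ^ 4 + P * x ^ 2 * y ^ 2 + R * x * y ^ 3 + S * y ^ 4 =
    x ^ 4 + 16 * (P' * y * w + j * x * y ^ 3 + s * y ^ 4) := by
    rw [hj, hs, hP']
    have : 16 * (P' * y * w) = 8 * P' * y * (2 * w) := by ring
    rw [mul_add, mul_add, this, ← hw]; ring
  rw [e0] at h
  have h4 : x ^ 4 % 16 = 0 ∨ x ^ 4 % 16 = 1 := by
    rcases Int.even_or_odd' x with ⟨k, rfl | rfl⟩
    · left; ring_nf; omega
    · right
      have e : (2 * k + 1) ^ 4 = 16 * (k ^ 4 + 2 * k ^ 3 + k ^ 2) + 8 * (k * (k + 1)) + 1 := by ring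
      obtain ⟨j, hj⟩ := Int.even_mul_succ_self k
      rw [e, hj]; omega
  omega

set_option maxHeartbeats 1000000 in
theorem local2 (c d e : ℚ)
    (hφ : ∀ x y : ℤ, ∃ v : ℤ, InV v ∧
      (x : ℚ) ^ 4 + 0 * x ^ 3 * y + c * x ^ 2 * y ^ 2 + d * x * y ^ 3 + e * y ^ 4 = v)
    (h2 : ∃ x y : ℤ,
      (x : ℚ) ^ 4 + 0 * x ^ 3 * y + c * x ^ 2 * y ^ 2 + d * x * y ^ 3 + e * y ^ 4 = 2) :
    ∃ p r S : ℤ, c = 40 * p ∧ d = -40 * r ∧ e = S ∧ S % 80 = 1 ∧ (p - r) % 2 = 0 := by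
  obtain ⟨S, B, C, β, eS, eB, eC, eβ, -, pat⟩ := local_pat 0 c d e hφ
  have hβ : β = 0 := by
    have : (β : ℚ) = 0 := by linarith
    exact_mod_cast this
  subst hβ
  have hBC : (B + C) % 2 = 0 := by omega
  obtain ⟨k, hk⟩ : ∃ k, B + C = 2 * k := ⟨(B + C) / 2, by omega⟩
  have hkq : (B : ℚ) + C = 2 * k := by exact_mod_cast hk
  obtain ⟨P, hP⟩ : ∃ P : ℤ, c = P := ⟨k - 1 - S, by push_cast; linarith⟩
  obtain ⟨R, hR⟩ : ∃ R : ℤ, d = R := ⟨B - k, by push_cast; linarith⟩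
  subst hP hR eS
  have iB : B = 1 + P + R + S := by
    have : (B : ℚ) = 1 + P + R + S := by linarith
    exact_mod_cast this
  have iC : C = 1 + P - R + S := by
    have : (C : ℚ) = 1 + P - R + S := by linarith
    exact_mod_cast this
  have hV : ∀ x y : ℤ, InV (x ^ 4 + P * x ^ 2 * y ^ 2 + R * x * y ^ 3 + S * y ^ 4) := by
    intro x y
    obtain ⟨v, hv, ev⟩ := hφ x y
    have : x ^ 4 + P * x ^ 2 * y ^ 2 + R * x * y ^ 3 + S * y ^ 4 = v := by
      have : (x : ℚ) ^ 4 + P * x ^ 2 * y ^ 2 + R * x * y ^ 3 + S * y ^ 4 = v := by linarith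
      exact_mod_cast this
    rw [this]; exact hv
  have h2' : ∃ x y : ℤ, x ^ 4 + P * x ^ 2 * y ^ 2 + R * x * y ^ 3 + S * y ^ 4 = 2 := by
    obtain ⟨x, y, h⟩ := h2
    refine ⟨x, y, ?_⟩
    have : (x : ℚ) ^ 4 + P * x ^ 2 * y ^ 2 + R * x * y ^ 3 + S * y ^ 4 = 2 := by linarith
    exact_mod_cast this
  obtain ⟨q1, q2, q3⟩ := local5 P R S hV h2'
  have hpat : S % 16 = 1 ∧ (P + R) % 16 = 0 ∧ (P - R) % 16 = 0 := by
    rcases pat with pat | pat | pat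
    · exfalso
      exact excl16 P R S (by omega) (by omega) (by omega) h2'
    · omega
    · omega
  obtain ⟨p, hp⟩ : ∃ p, P = 40 * p := ⟨P / 40, by omega⟩
  obtain ⟨r, hr⟩ : ∃ r, R = -40 * r := ⟨-(R / 40), by omega⟩
  refine ⟨p, r, S, ?_, ?_, rfl, by omega, by omega⟩
  · rw [hp]; push_cast; ring
  · rw [hr]; push_cast; ring

theorem sq_gap (a b : ℤ) (ha : 19 ≤ a ^ 2) (h0 : a ^ 2 ≠ b ^ 2) (h1 : a ^ 2 - b ^ 2 ≤ 5)
    (h2 : -5 ≤ a ^ 2 - b ^ 2) : False := by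
  rw [← sq_abs a, ← sq_abs b] at *
  have ha0 := abs_nonneg a
  have hb0 := abs_nonneg b
  generalize |a| = a at *
  generalize |b| = b at *
  have : 5 ≤ a := by nlinarith
  rcases lt_trichotomy a b with h | h | h
  · nlinarith
  · exact h0 (by rw [h])
  · nlinarith

theorem step3 (p S : ℤ) (hS80 : S % 80 = 1) (hpar : (p - 0) % 2 = 0)
    (hV : ∀ x y : ℤ, InV (ff p 0 S x y))
    (hval : ∀ v ∈ vals, ∃ x y : ℤ, ff p 0 S x y = v) : p = 0 ∧ S = 1 := by
  have hnn : ∀ x y : ℤ, 0 ≤ ff p 0 S x y := by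
    intro x y
    obtain ⟨t, u, e⟩ := hV x y
    rw [e]; positivity
  have hS0 : 0 ≤ S := by simpa [ff] using hnn 0 1
  obtain ⟨m, n, hn, emn⟩ := pos_point p 0 S 2 (by decide) (hval 2 (by decide))
  have hn2 : 1 ≤ n ^ 2 := by nlinarith
  have hn4 : 1 ≤ n ^ 4 := by nlinarith [sq_nonneg (n ^ 2)]
  rcases le_or_gt 0 p with hp | hp
  · simp only [ff] at emn
    push_cast at emn
    have hm : m ≠ 0 := by
      rintro rfl
      have e : S * n ^ 4 = 2 := by linarith
      have hd : S ∣ 2 := ⟨_, e.symm⟩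
      have := Int.le_of_dvd (by norm_num) hd
      have hS1 : S = 1 := by omega
      rw [hS1, one_mul] at e
      rcases (by omega : n = 1 ∨ 2 ≤ n) with h | h
      · rw [h] at e; omega
      · have : 4 ≤ n ^ 2 := by nlinarith
        nlinarith
    have hm2 : 1 ≤ m ^ 2 := by have := pow_pos (abs_pos.mpr hm) 2; rw [sq_abs] at this; omega
    have hm4 : 1 ≤ m ^ 4 := by nlinarith
    have h1 : 0 ≤ p * (m ^ 2 * n ^ 2) := by positivity
    have h2 : p ≤ p * (m ^ 2 * n ^ 2) := le_mul_of_one_le_right hp (by nlinarith)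
    have h3 : S ≤ S * n ^ 4 := le_mul_of_one_le_right hS0 hn4
    have h4 : m ^ 4 + 40 * (p * (m ^ 2 * n ^ 2)) + S * n ^ 4 = 2 := by linarith
    constructor <;> omega
  · exfalso
    have hT0 : 0 ≤ S - 400 * p ^ 2 := by
      have h1 := real_nonneg p 0 S hnn (√(-20 * p))
      have h2 : √(-20 * (p : ℝ)) ^ 2 = -20 * p := Real.sq_sqrt (by
        have : (p : ℝ) < 0 := by exact_mod_cast hp
        linarith)
      have h3 : √(-20 * (p : ℝ)) ^ 4 = (-20 * p) ^ 2 := by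
        calc √(-20 * (p : ℝ)) ^ 4 = (√(-20 * (p : ℝ)) ^ 2) ^ 2 := by ring
          _ = _ := by rw [h2]
      rw [h3, h2] at h1
      have : (0 : ℝ) ≤ ((S - 400 * p ^ 2 : ℤ) : ℝ) := by
        push_cast at h1 ⊢; linarith
      exact_mod_cast this
    obtain ⟨p', hp'⟩ : ∃ p', p = 2 * p' := ⟨p / 2, by omega⟩
    have hT80 : (S - 400 * p ^ 2) % 80 = 1 := by
      have : 400 * p ^ 2 = 80 * (20 * p' ^ 2) := by rw [hp']; ring
      omega
    set T := S - 400 * p ^ 2 with hT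
    have hff : ∀ x y, ff p 0 S x y = (x ^ 2 + 20 * p * y ^ 2) ^ 2 + T * y ^ 4 := by
      intro x y; rw [hT, ff]; ring
    rw [hff] at emn
    push_cast at emn
    have hT1 : T ≤ T * n ^ 4 := le_mul_of_one_le_right hT0 hn4
    have hT2 : T = 1 := by have := sq_nonneg (m ^ 2 + 20 * p * n ^ 2); omega
    obtain ⟨x, y, hy, exy⟩ := pos_point p 0 S 17 (by decide) (hval 17 (by decide))
    rw [hff] at exy
    rw [hT2] at exy emn
    push_cast at exy
    have hn1 : n = 1 := by
      by_contra hc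
      have : 2 ≤ n := by omega
      have : 4 ≤ n ^ 2 := by nlinarith
      nlinarith [sq_nonneg (m ^ 2 + 20 * p * n ^ 2)]
    subst hn1
    have hQ : m ^ 2 + 20 * p = 1 ∨ m ^ 2 + 20 * p = -1 := by
      have hQ' : (m ^ 2 + 20 * p - 1) * (m ^ 2 + 20 * p + 1) = 0 := by linarith
      rcases mul_eq_zero.mp hQ' with h | h
      · left; linarith
      · right; linarith
    have hy2 : y = 1 ∨ y = 2 := by
      by_contra hc
      have : 3 ≤ y := by omega
      have : 9 ≤ y ^ 2 := by nlinarith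
      nlinarith [sq_nonneg (x ^ 2 + 20 * p * y ^ 2)]
    rcases hy2 with rfl | rfl
    · have hQ' : (x ^ 2 + 20 * p - 4) * (x ^ 2 + 20 * p + 4) = 0 := by linarith
      rcases mul_eq_zero.mp hQ' with h | h <;> rcases hQ with hQ | hQ <;>
        exact sq_gap m x (by omega) (by omega) (by omega) (by omega)
    · have hQ' : (x ^ 2 + 80 * p - 1) * (x ^ 2 + 80 * p + 1) = 0 := by linarith
      have e4 : (2 * m) ^ 2 = 4 * m ^ 2 := by ring
      rcases mul_eq_zero.mp hQ' with h | h <;> rcases hQ with hQ | hQ <;>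
        exact sq_gap (2 * m) x (by omega) (by omega) (by omega) (by omega)

theorem core_int (p r S : ℤ) (hS80 : S % 80 = 1) (hpar : (p - r) % 2 = 0)
    (hV : ∀ x y : ℤ, InV (ff p r S x y))
    (hval : ∀ v ∈ vals, ∃ x y : ℤ, ff p r S x y = v) : p = 0 ∧ r = 0 ∧ S = 1 := by
  rcases lt_trichotomy r 0 with hr | hr | hr
  · exfalso
    have e : ∀ x y, ff p (-r) S x y = ff p r S (-x) y := by intro x y; simp only [ff]; ring
    refine step4 p (-r) S (by omega) hS80 (by omega) (fun x y => by rw [e]; exact hV _ _) ?_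
    intro v hv
    obtain ⟨x, y, h⟩ := hval v hv
    exact ⟨-x, y, by rw [e, neg_neg, h]⟩
  · subst hr
    have := step3 p S hS80 hpar hV hval
    exact ⟨this.1, rfl, this.2⟩
  · exact absurd (step4 p r S (by omega) hS80 hpar hV hval) id


theorem core_rat (b c d e : ℚ)
    (hφ : ∀ x y : ℤ, ∃ v : ℤ, InV v ∧
      (x:ℚ)^4+b*x^3*y+c*x^2*y^2+d*x*y^3+e*y^4 = v)
    (hval : ∀ v ∈ vals, ∃ x y : ℤ, (x:ℚ)^4+b*x^3*y+c*x^2*y^2+d*x*y^3+e*y^4 = (v : ℚ)) :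
    ∃ k : ℤ, b = 4 * k ∧ c = 6 * (k:ℚ)^2 ∧ d = 4 * (k:ℚ)^3 ∧ e = (k:ℚ)^4 + 1 := by
  obtain ⟨_, _, _, β, _, _, _, hβ, hβ24, _⟩ := local_pat b c d e hφ
  obtain ⟨k, rfl⟩ : ∃ k : ℤ, β = 24 * k := ⟨β / 24, by omega⟩
  have hb : b = 4 * (k:ℚ) := by push_cast at hβ; linarith
  have hψ : ∀ x y : ℤ, (x:ℚ)^4+0*x^3*y+(c-6*(k:ℚ)^2)*x^2*y^2
      +(8*(k:ℚ)^3-2*c*k+d)*x*y^3+(-3*(k:ℚ)^4+c*k^2-d*k+e)*y^4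
      = ((x - k*y : ℤ):ℚ)^4+b*((x - k*y : ℤ):ℚ)^3*y+c*((x - k*y : ℤ):ℚ)^2*y^2
        +d*((x - k*y : ℤ):ℚ)*y^3+e*y^4 := by
    intro x y
    rw [hb]; push_cast; ring
  have hψ2 : ∀ v ∈ vals, ∃ x y : ℤ, (x:ℚ)^4+0*x^3*y+(c-6*(k:ℚ)^2)*x^2*y^2
      +(8*(k:ℚ)^3-2*c*k+d)*x*y^3+(-3*(k:ℚ)^4+c*k^2-d*k+e)*y^4 = (v:ℚ) := by
    intro v hv
    obtain ⟨x, y, h⟩ := hval v hv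
    refine ⟨x + k * y, y, ?_⟩
    rw [hψ, ← h]
    have : x + k * y - k * y = x := by ring
    rw [this]
  obtain ⟨p, r, S, hc, hd, he, hS, hpr⟩ := local2 (c-6*(k:ℚ)^2) (8*(k:ℚ)^3-2*c*k+d)
    (-3*(k:ℚ)^4+c*k^2-d*k+e)
    (fun x y => by
      obtain ⟨v, hv, h⟩ := hφ (x - k * y) y
      exact ⟨v, hv, by rw [hψ, h]⟩)
    (by
      obtain ⟨x, y, h⟩ := hψ2 2 (by decide)
      exact ⟨x, y, by rw [h]; norm_num⟩)
  have hff : ∀ x y : ℤ, ((ff p r S x y : ℤ) : ℚ) = (x:ℚ)^4+0*x^3*y+(c-6*(k:ℚ)^2)*x^2*y^2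
      +(8*(k:ℚ)^3-2*c*k+d)*x*y^3+(-3*(k:ℚ)^4+c*k^2-d*k+e)*y^4 := by
    intro x y
    rw [hc, hd, he, ff]; push_cast; ring
  obtain ⟨rfl, rfl, rfl⟩ := core_int p r S hS hpr
    (fun x y => by
      obtain ⟨v, hv, h⟩ := hφ (x - k * y) y
      have h2 : ((ff p r S x y : ℤ) : ℚ) = v := by rw [hff, hψ, h]
      have h3 : ff p r S x y = v := by exact_mod_cast h2
      rw [h3]; exact hv)
    (fun v hv => by
      obtain ⟨x, y, h⟩ := hψ2 v hv
      refine ⟨x, y, ?_⟩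
      have h2 : ((ff p r S x y : ℤ) : ℚ) = v := by rw [hff, h]
      exact_mod_cast h2)
  have c1 : c = 6 * (k:ℚ)^2 := by push_cast at hc; linarith
  subst c1
  have d1 : d = 4 * (k:ℚ)^3 := by push_cast at hd; linarith
  subst d1
  have e1 : e = (k:ℚ)^4 + 1 := by push_cast at he; linarith
  exact ⟨k, hb, rfl, rfl, e1⟩

theorem quartic_expand (F : MvPolynomial (Fin 2) ℚ) (hF : F.IsHomogeneous 4) :
    ∃ a0 a1 a2 a3 a4 : ℚ, ∀ x y : ℚ, MvPolynomial.eval ![x, y] F =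
      a0*x^4+a1*x^3*y+a2*x^2*y^2+a3*x*y^3+a4*y^4 := by
  let mk : ℕ → (Fin 2 →₀ ℕ) := fun i => Finsupp.single 0 (4 - i) + Finsupp.single 1 i
  have hsup : F.support ⊆ (Finset.range 5).image mk := by
    intro m hm
    have hd := hF (MvPolynomial.mem_support_iff.mp hm)
    rw [Finsupp.weight_apply, Finsupp.sum_fintype _ _ (by simp)] at hd
    simp [Fin.sum_univ_two] at hd
    rw [Finset.mem_image]
    refine ⟨m 1, by simp; omega, ?_⟩
    ext i
    fin_cases i
    · simp [mk]; omega
    · simp [mk]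
  have hinj : Set.InjOn mk (Finset.range 5 : Finset ℕ) := by
    intro i _ j _ hij
    have := DFunLike.congr_fun hij 1
    simpa [mk] using this
  refine ⟨F.coeff (mk 0), F.coeff (mk 1), F.coeff (mk 2), F.coeff (mk 3), F.coeff (mk 4), ?_⟩
  intro x y
  rw [MvPolynomial.eval_eq']
  rw [Finset.sum_subset hsup (by
    intro m _ hm
    rw [MvPolynomial.notMem_support_iff.mp hm, zero_mul])]
  rw [Finset.sum_image hinj]
  simp [Finset.sum_range_succ, Fin.prod_univ_two, mk]
  ring

theorem main_aux (a0 a1 a2 a3 a4 : ℚ)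
    (hφ : ∀ x y : ℤ, ∃ t u : ℤ, a0*(x:ℚ)^4+a1*x^3*y+a2*x^2*y^2+a3*x*y^3+a4*y^4
      = (t:ℚ)^4+(u:ℚ)^4)
    (hval : ∀ t u : ℤ, ∃ x y : ℤ, a0*(x:ℚ)^4+a1*x^3*y+a2*x^2*y^2+a3*x*y^3+a4*y^4
      = (t:ℚ)^4+(u:ℚ)^4) :
    ∃ a b c d : ℤ, (a * d - b * c = 1 ∨ a * d - b * c = -1) ∧
      ∀ x y : ℚ, a0*x^4+a1*x^3*y+a2*x^2*y^2+a3*x*y^3+a4*y^4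
        = (a*x+c*y)^4+(b*x+d*y)^4 := by
  obtain ⟨x0, y0, h1⟩ := hval 1 0
  have h1' : a0*(x0:ℚ)^4+a1*x0^3*y0+a2*x0^2*y0^2+a3*x0*y0^3+a4*y0^4 = 1 := by
    rw [h1]; norm_num
  have hg : Int.gcd x0 y0 = 1 := by
    obtain ⟨x', hx'⟩ := Int.gcd_dvd_left x0 y0
    obtain ⟨y', hy'⟩ := Int.gcd_dvd_right x0 y0
    set g : ℕ := Int.gcd x0 y0
    obtain ⟨t, u, h⟩ := hφ x' y'
    rw [hx', hy'] at h1'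
    have h2 : ((g : ℤ):ℚ)^4 * ((t:ℚ)^4+(u:ℚ)^4) = 1 := by
      rw [← h, ← h1']; push_cast; ring
    have h3 : (g : ℤ)^4 * (t^4+u^4) = 1 := by exact_mod_cast h2
    have h4 : ((g:ℤ)) ∣ 1 := ⟨(g:ℤ)^3 * (t^4+u^4), by linarith⟩
    have h5 : g ∣ 1 := by exact_mod_cast h4
    exact Nat.dvd_one.mp h5
  obtain ⟨w, z, hwz⟩ : ∃ w z : ℤ, x0 * w - z * y0 = 1 := by
    have := Int.gcd_eq_gcd_ab x0 y0
    rw [hg] at this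
    exact ⟨Int.gcdA x0 y0, -Int.gcdB x0 y0, by push_cast at this; linarith⟩
  have hq : (x0:ℚ) * w - z * y0 = 1 := by exact_mod_cast hwz
  -- the transformed form
  obtain ⟨b, hb⟩ : ∃ b : ℚ, b = a0*4*x0^3*z + a1*(3*x0^2*z*y0+x0^3*w)
    + a2*(2*x0*z*y0^2+2*x0^2*y0*w) + a3*(z*y0^3+3*x0*y0^2*w) + a4*4*y0^3*w := ⟨_, rfl⟩
  obtain ⟨c, hc⟩ : ∃ c : ℚ, c = a0*6*x0^2*z^2 + a1*(3*x0*z^2*y0+3*x0^2*z*w)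
    + a2*(z^2*y0^2+4*x0*z*y0*w+x0^2*w^2) + a3*(3*z*y0^2*w+3*x0*y0*w^2) + a4*6*y0^2*w^2 := ⟨_, rfl⟩
  obtain ⟨d, hd⟩ : ∃ d : ℚ, d = a0*4*x0*z^3 + a1*(z^3*y0+3*x0*z^2*w)
    + a2*(2*z^2*y0*w+2*x0*z*w^2) + a3*(3*z*y0*w^2+x0*w^3) + a4*4*y0*w^3 := ⟨_, rfl⟩
  obtain ⟨e, he⟩ : ∃ e : ℚ, e = a0*z^4 + a1*z^3*w + a2*z^2*w^2 + a3*z*w^3 + a4*w^4 := ⟨_, rfl⟩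
  have htr : ∀ x y : ℚ, x^4+b*x^3*y+c*x^2*y^2+d*x*y^3+e*y^4 =
      a0*(x0*x+z*y)^4+a1*(x0*x+z*y)^3*(y0*x+w*y)+a2*(x0*x+z*y)^2*(y0*x+w*y)^2
      +a3*(x0*x+z*y)*(y0*x+w*y)^3+a4*(y0*x+w*y)^4 := by
    intro x y
    rw [hb, hc, hd, he]
    linear_combination (-x^4) * h1'
  clear hb hc hd he
  obtain ⟨k, hb, hc, hd, he⟩ := core_rat b c d e
    (by
      intro x y
      obtain ⟨t, u, h⟩ := hφ (x0*x+z*y) (y0*x+w*y)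
      refine ⟨t^4+u^4, ⟨t.natAbs, u.natAbs, ?_⟩, ?_⟩
      · simp [Even.pow_abs (show Even 4 by decide)]
      · rw [htr]; push_cast at h ⊢; exact h)
    (by
      have key : ∀ t u : ℤ, ∃ x y : ℤ,
          (x:ℚ)^4+b*x^3*y+c*x^2*y^2+d*x*y^3+e*y^4 = (t:ℚ)^4+(u:ℚ)^4 := by
        intro t u
        obtain ⟨x, y, h⟩ := hval t u
        refine ⟨w*x-z*y, -y0*x+x0*y, ?_⟩
        rw [htr, ← h]
        have e1 : (x0:ℚ)*((w*x-z*y:ℤ):ℚ)+z*((-y0*x+x0*y:ℤ):ℚ) = x := by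
          push_cast; linear_combination (x:ℚ) * hq
        have e2 : (y0:ℚ)*((w*x-z*y:ℤ):ℚ)+w*((-y0*x+x0*y:ℤ):ℚ) = y := by
          push_cast; linear_combination (y:ℚ) * hq
        rw [e1, e2]
      intro v hv
      simp only [vals, Finset.mem_insert, Finset.mem_singleton] at hv
      rcases hv with rfl | rfl | rfl | rfl | rfl | rfl
      · obtain ⟨x, y, h⟩ := key 1 1
        exact ⟨x, y, by rw [h]; norm_num⟩
      · obtain ⟨x, y, h⟩ := key 2 1
        exact ⟨x, y, by rw [h]; norm_num⟩
      · obtain ⟨x, y, h⟩ := key 3 1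
        exact ⟨x, y, by rw [h]; norm_num⟩
      · obtain ⟨x, y, h⟩ := key 3 2
        exact ⟨x, y, by rw [h]; norm_num⟩
      · obtain ⟨x, y, h⟩ := key 4 1
        exact ⟨x, y, by rw [h]; norm_num⟩
      · obtain ⟨x, y, h⟩ := key 4 3
        exact ⟨x, y, by rw [h]; norm_num⟩)
  refine ⟨w - k*y0, -y0, -z+k*x0, x0, Or.inl (by linear_combination hwz), ?_⟩
  intro x y
  have h := htr (w*x-z*y) (-y0*x+x0*y)
  have e1 : (x0:ℚ)*(w*x-z*y)+z*(-y0*x+x0*y) = x := by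
    linear_combination x * hq
  have e2 : (y0:ℚ)*(w*x-z*y)+w*(-y0*x+x0*y) = y := by
    linear_combination y * hq
  rw [e1, e2] at h
  rw [← h, hb, hc, hd, he]
  push_cast
  ring


open MvPolynomial in
/-- If `F` is a binary quartic form with rational coefficients and nonzero discriminant
whose set of values on ℤ² equals the set of sums of two fourth powers of integers, then
`F(X,Y) = (aX + cY)⁴ + (bX + dY)⁴` for some integers `a, b, c, d` with `ad - bc = ±1`. -/
theorem quartic_sum_of_fourth_powers (F : MvPolynomial (Fin 2) ℚ)
    (hF : IsBinForm 4 F)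
    (hval : valueSet F = {q : ℚ | ∃ t u : ℤ, q = (t : ℚ) ^ 4 + (u : ℚ) ^ 4}) :
    ∃ a b c d : ℤ, (a * d - b * c = 1 ∨ a * d - b * c = -1) ∧
      F = (C (a : ℚ) * X 0 + C (c : ℚ) * X 1) ^ 4
        + (C (b : ℚ) * X 0 + C (d : ℚ) * X 1) ^ 4 := by
  obtain ⟨a0, a1, a2, a3, a4, hexp⟩ := quartic_expand F hF.1
  obtain ⟨a, b, c, d, hdet, h⟩ := main_aux a0 a1 a2 a3 a4
    (by
      intro x y
      have hm : MvPolynomial.eval ![(x : ℚ), (y : ℚ)] F ∈ valueSet F := ⟨x, y, rfl⟩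
      rw [hval] at hm
      obtain ⟨t, u, h⟩ := hm
      exact ⟨t, u, by rw [← hexp, h]⟩)
    (by
      intro t u
      have hm : (t : ℚ) ^ 4 + (u : ℚ) ^ 4 ∈ valueSet F := by
        rw [hval]; exact ⟨t, u, rfl⟩
      obtain ⟨x, y, h⟩ := hm
      exact ⟨x, y, by rw [← hexp, h]⟩)
  refine ⟨a, b, c, d, hdet, ?_⟩
  apply MvPolynomial.funext
  intro s
  have hs : s = ![s 0, s 1] := by
    ext i; fin_cases i <;> rfl
  have h2 := hexp (s 0) (s 1)
  rw [← hs, h] at h2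
  rw [h2]
  simp
end

section
/- Let d ≥ 1 and let G ∈ Bin(d,ℚ) be written G(X,Y) = a_d X^d + a_{d−1} X^{d−1}Y + ⋯ + a_1 XY^{d−1} + a_0 Y^d, where a_k is the coefficient of X^k Y^{d−k}. Then D₄ ⊆ Aut(G,ℚ) if and only if a_k = 0 whenever k is odd and a_k = a_{d−k} for all 0 ≤ k ≤ d. In particular, if D₄ ⊆ Aut(G,ℚ) then d is even. -/
/-- `Aut(F, ℚ) = {γ ∈ GL(2,ℚ) : F ∘ γ = F}`, as a set of invertible rational matrices. -/
def AutQ (F : MvPolynomial (Fin 2) ℚ) : Set (Matrix (Fin 2) (Fin 2) ℚ) :=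
  {γ | γ.det ≠ 0 ∧ compForm F γ = F}

/-- The subgroup `D₄ ⊆ GL(2, ℚ)` generated by `[[0,1],[1,0]]` and `[[0,1],[-1,0]]`,
as a set of matrices.  (Both generators have finite multiplicative order, so the
multiplicative closure coincides with the generated subgroup.) -/
def D4 : Set (Matrix (Fin 2) (Fin 2) ℚ) :=
  (Submonoid.closure {!![0, 1; 1, 0], !![0, 1; -1, 0]} : Submonoid (Matrix (Fin 2) (Fin 2) ℚ))

open MvPolynomial in
theorem compForm_mul_aux (F : MvPolynomial (Fin 2) ℚ) (γ δ : Matrix (Fin 2) (Fin 2) ℚ) :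
    compForm F (γ * δ) = compForm (compForm F γ) δ := by
  unfold compForm
  rw [← AlgHom.comp_apply]
  congr 1
  apply MvPolynomial.algHom_ext
  intro i
  simp only [AlgHom.comp_apply, aeval_X, map_add, map_mul, Matrix.mul_apply, Fin.sum_univ_two,
    algHom_C, algebraMap_eq]
  ring

open MvPolynomial in
theorem compForm_one_aux (F : MvPolynomial (Fin 2) ℚ) : compForm F 1 = F := by
  unfold compForm
  conv_rhs => rw [← aeval_X_left_apply F]
  congr 1
  apply MvPolynomial.algHom_ext
  intro i
  fin_cases i <;> simp

theorem finsupp_pair_aux (m : Fin 2 →₀ ℕ) :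
    m = Finsupp.single 0 (m 0) + Finsupp.single 1 (m 1) := by
  ext i
  fin_cases i <;> simp

theorem finsupp_pair_inj_aux (a b i j : ℕ) :
    ((Finsupp.single 0 a + Finsupp.single 1 b : Fin 2 →₀ ℕ)
      = Finsupp.single 0 i + Finsupp.single 1 j) ↔ (a = i ∧ b = j) := by
  constructor
  · intro h
    have h0 := DFunLike.congr_fun h 0
    have h1 := DFunLike.congr_fun h 1
    simp at h0 h1
    exact ⟨h0, h1⟩
  · rintro ⟨rfl, rfl⟩
    rfl

open MvPolynomial in
theorem coeff_compForm_anti (F : MvPolynomial (Fin 2) ℚ) (s t : ℚ) (i j : ℕ) :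
    coeff (Finsupp.single 0 i + Finsupp.single 1 j) (compForm F !![0, s; t, 0])
      = s ^ j * t ^ i * coeff (Finsupp.single 0 j + Finsupp.single 1 i) F := by
  induction F using MvPolynomial.induction_on' with
  | add p q hp hq =>
    have : compForm (p + q) !![0, s; t, 0]
        = compForm p !![0, s; t, 0] + compForm q !![0, s; t, 0] := by
      simp [compForm]
    rw [this, coeff_add, hp, hq, coeff_add]
    ring
  | monomial m c =>
    have key : compForm (monomial m c) !![0, s; t, 0]
        = monomial (Finsupp.single 0 (m 1) + Finsupp.single 1 (m 0))
            (c * s ^ (m 0) * t ^ (m 1)) := by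
      rw [compForm, aeval_monomial, Finsupp.prod_fintype _ _ (by simp), Fin.prod_univ_two]
      have : ∀ (a b : ℕ) (r : ℚ), monomial (Finsupp.single (0 : Fin 2) a + Finsupp.single 1 b) r
          = C r * (X 0 ^ a * X 1 ^ b) := by
        intro a b r
        rw [X_pow_eq_monomial, X_pow_eq_monomial, monomial_mul, C_mul_monomial]
        simp
      rw [this]
      simp [mul_pow]
      ring
    rw [key, coeff_monomial]
    conv_rhs => rw [finsupp_pair_aux m]
    rw [coeff_monomial]
    simp only [finsupp_pair_inj_aux]
    by_cases h : m 1 = i ∧ m 0 = j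
    · obtain ⟨rfl, rfl⟩ := h
      simp
      ring
    · rw [if_neg h, if_neg (fun h' => h ⟨h'.2, h'.1⟩)]
      simp

open MvPolynomial in
theorem compForm_anti_eq_iff (F : MvPolynomial (Fin 2) ℚ) (s t : ℚ) :
    compForm F !![0, s; t, 0] = F ↔ ∀ i j : ℕ,
      s ^ j * t ^ i * coeff (Finsupp.single 0 j + Finsupp.single 1 i) F
        = coeff (Finsupp.single 0 i + Finsupp.single 1 j) F := by
  constructor
  · intro h i j
    rw [← coeff_compForm_anti, h]
  · intro h
    ext m
    rw [finsupp_pair_aux m, coeff_compForm_anti, h]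

theorem D4_subset_iff_aux (F : MvPolynomial (Fin 2) ℚ) :
    D4 ⊆ AutQ F ↔
      compForm F !![0, 1; 1, 0] = F ∧ compForm F !![0, 1; -1, 0] = F := by
  constructor
  · intro h
    exact ⟨(h (Submonoid.subset_closure (by simp))).2, (h (Submonoid.subset_closure (by simp))).2⟩
  · rintro ⟨h1, h2⟩ γ hγ
    induction hγ using Submonoid.closure_induction with
    | mem x hx =>
      rcases hx with rfl | rfl
      · exact ⟨by simp [Matrix.det_fin_two], h1⟩
      · exact ⟨by simp [Matrix.det_fin_two], h2⟩
    | one => exact ⟨by simp, compForm_one_aux F⟩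
    | mul x y _ _ hx hy =>
      refine ⟨?_, ?_⟩
      · rw [Matrix.det_mul]
        exact mul_ne_zero hx.1 hy.1
      · rw [compForm_mul_aux, hx.2, hy.2]

/-- For `G ∈ Bin(d, ℚ)` written `G = ∑ₖ aₖ Xᵏ Y^{d-k}`, one has `D₄ ⊆ Aut(G, ℚ)` iff
`aₖ = 0` for odd `k` and `aₖ = a_{d-k}` for all `0 ≤ k ≤ d`.  In particular, if
`D₄ ⊆ Aut(G, ℚ)` then `d` is even. -/
theorem D4_subset_aut_iff (d : ℕ) (hd : 1 ≤ d)
    (G : MvPolynomial (Fin 2) ℚ) (hG : IsBinForm d G) :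
    (D4 ⊆ AutQ G ↔
      ((∀ k ≤ d, Odd k →
          MvPolynomial.coeff (Finsupp.single 0 k + Finsupp.single 1 (d - k)) G = 0) ∧
        (∀ k ≤ d,
          MvPolynomial.coeff (Finsupp.single 0 k + Finsupp.single 1 (d - k)) G
            = MvPolynomial.coeff
                (Finsupp.single 0 (d - k) + Finsupp.single 1 k) G)))
    ∧ (D4 ⊆ AutQ G → Even d) := by
  obtain ⟨hhom, hsq⟩ := hG
  have hne : G ≠ 0 := hsq.ne_zero
  have hdeg : ∀ i j : ℕ, i + j ≠ d →
      MvPolynomial.coeff (Finsupp.single 0 i + Finsupp.single 1 j) G = 0 := by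
    intro i j hij
    apply hhom.coeff_eq_zero
    simpa [Finsupp.degree_eq_sum] using hij
  rw [D4_subset_iff_aux, compForm_anti_eq_iff, compForm_anti_eq_iff]
  simp only [one_pow, one_mul]
  have hodd : (∀ i j : ℕ, MvPolynomial.coeff (Finsupp.single 0 j + Finsupp.single 1 i) G
        = MvPolynomial.coeff (Finsupp.single 0 i + Finsupp.single 1 j) G) →
      (∀ i j : ℕ, (-1 : ℚ) ^ i * MvPolynomial.coeff (Finsupp.single 0 j + Finsupp.single 1 i) G
        = MvPolynomial.coeff (Finsupp.single 0 i + Finsupp.single 1 j) G) →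
      ∀ i j : ℕ, Odd i →
        MvPolynomial.coeff (Finsupp.single 0 i + Finsupp.single 1 j) G = 0 := by
    intro h1 h2 i j hi
    have a := h1 i j
    have b := h2 i j
    rw [hi.neg_one_pow] at b
    linarith
  refine ⟨⟨?_, ?_⟩, ?_⟩
  · rintro ⟨h1, h2⟩
    exact ⟨fun k _ hk => hodd h1 h2 k _ hk, fun k _ => h1 _ _⟩
  · rintro ⟨h1, h2⟩
    have hs : ∀ i j : ℕ, MvPolynomial.coeff (Finsupp.single 0 j + Finsupp.single 1 i) G
        = MvPolynomial.coeff (Finsupp.single 0 i + Finsupp.single 1 j) G := by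
      intro i j
      by_cases hij : i + j = d
      · have := h2 i (by omega)
        rw [show d - i = j by omega] at this
        exact this.symm
      · rw [hdeg i j hij, hdeg j i (by omega)]
    refine ⟨hs, fun i j => ?_⟩
    rw [hs]
    rcases Nat.even_or_odd i with hi | hi
    · rw [hi.neg_one_pow, one_mul]
    · have : MvPolynomial.coeff (Finsupp.single 0 i + Finsupp.single 1 j) G = 0 := by
        by_cases hij : i + j = d
        · have := h1 i (by omega) hi
          rwa [show d - i = j by omega] at this
        · exact hdeg i j hij
      rw [this, mul_zero]
  · rintro ⟨h1, h2⟩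
    by_contra hd'
    rw [Nat.not_even_iff_odd] at hd'
    apply hne
    ext m
    rw [finsupp_pair_aux m, MvPolynomial.coeff_zero]
    by_cases hij : m 0 + m 1 = d
    · rcases Nat.even_or_odd (m 0) with hi | hi
      · rw [← h1]
        apply hodd h1 h2
        rw [← hij] at hd'
        exact (Nat.odd_add'.1 hd').2 hi
      · exact hodd h1 h2 _ _ hi
    · exact hdeg _ _ hij
end

section
/- Let k ≥ 1 and let 𝒞 := {Λ₁, …, Λ_k} be a covering of ℤ² by lattices. Then there exists an integer 1 ≤ k' ≤ k, an injection φ : {1,…,k'} → {1,…,k}, and lattices Λ'_j (1 ≤ j ≤ k') such that 𝒞' := {Λ'₁, …, Λ'_{k'}} is a minimal covering of ℤ², and Λ'_j ⊆ Λ_{φ(j)} for all 1 ≤ j ≤ k'. -/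
/-- A lattice: a finite-index (equivalently, rank-2) subgroup of ℤ². -/
def IsLattice (L : AddSubgroup (ℤ × ℤ)) : Prop := L.index ≠ 0

/-- A finite family of lattices covering ℤ². -/
def IsCovering {k : ℕ} (L : Fin k → AddSubgroup (ℤ × ℤ)) : Prop :=
  (∀ i, IsLattice (L i)) ∧ ∀ p : ℤ × ℤ, ∃ i, p ∈ L i

/-- A minimal covering of ℤ² by lattices: replacing any member by a proper
sublattice destroys the covering property. -/
def IsMinimalCovering {k : ℕ} (L : Fin k → AddSubgroup (ℤ × ℤ)) : Prop :=
  IsCovering L ∧ ∀ (i : Fin k) (L' : AddSubgroup (ℤ × ℤ)),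
    IsLattice L' → L' < L i → ¬ IsCovering (Function.update L i L')

/-- From any covering of ℤ² by `k ≥ 1` lattices one can extract a minimal covering:
there are `1 ≤ k' ≤ k`, an injection `φ : Fin k' → Fin k` and lattices `L'_j ⊆ L_{φ(j)}`
forming a minimal covering of ℤ². -/
theorem exists_minimal_subcovering (k : ℕ) (hk : 1 ≤ k)
    (L : Fin k → AddSubgroup (ℤ × ℤ)) (hL : IsCovering L) :
    ∃ (k' : ℕ), 1 ≤ k' ∧ k' ≤ k ∧
      ∃ (φ : Fin k' → Fin k), Function.Injective φ ∧
        ∃ (L' : Fin k' → AddSubgroup (ℤ × ℤ)),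
          IsMinimalCovering L' ∧ ∀ j, L' j ≤ L (φ j) := by
  classical
  have : Nonempty (Fin k) := ⟨⟨0, hk⟩⟩
  -- a minimal covering by arbitrary subgroups, by Zorn
  obtain ⟨M, hML, hMmin⟩ : ∃ M : Fin k → AddSubgroup (ℤ × ℤ), M ≤ L ∧
      Minimal (fun M : Fin k → AddSubgroup (ℤ × ℤ) => ∀ p, ∃ i, p ∈ M i) M := by
    have := zorn_le_nonempty₀ (α := (Fin k → AddSubgroup (ℤ × ℤ))ᵒᵈ)
      {M | ∀ p, ∃ i, p ∈ (OrderDual.ofDual M) i} ?_ (OrderDual.toDual L) hL.2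
    · obtain ⟨M, hLM, hM⟩ := this
      exact ⟨OrderDual.ofDual M, hLM, hM.1, fun N hN h => hM.2 (y := OrderDual.toDual N) hN h⟩
    · intro c hc hchain y hy
      refine ⟨OrderDual.toDual (sInf (OrderDual.toDual ⁻¹' c)), ?_, ?_⟩
      · intro p
        by_contra hcon
        have h1 : ∀ i, ∃ f ∈ c, p ∉ (OrderDual.ofDual f) i := by
          intro i
          by_contra h2
          push Not at h2
          apply hcon
          refine ⟨i, ?_⟩
          simp only [OrderDual.ofDual_toDual, sInf_apply, AddSubgroup.mem_iInf]
          rintro ⟨f, hf⟩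
          exact h2 _ hf
        choose f hfc hf using h1
        obtain ⟨m, ⟨i, rfl⟩, hm⟩ := (Set.finite_range f).exists_maximal (Set.range_nonempty f)
        obtain ⟨j, hj⟩ := hc (hfc i) p
        have hle : f j ≤ f i := by
          rcases hchain.total (hfc j) (hfc i) with h | h
          · exact h
          · exact hm ⟨j, rfl⟩ h
        exact hf j (hle j hj)
      · intro z hz
        exact sInf_le (a := OrderDual.ofDual z) hz
  have hcov := hMmin.1
  let S : Finset (Fin k) := Finset.univ.filter fun i => (M i).FiniteIndex
  have hS : ∀ p, ∃ i ∈ S, p ∈ M i := by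
    have := AddSubgroup.leftCoset_cover_filter_FiniteIndex (s := Finset.univ) (H := M)
      (g := fun _ => 0) (by
        ext p
        simpa using hcov p)
    intro p
    have hp : p ∈ (Set.univ : Set (ℤ × ℤ)) := trivial
    rw [← this] at hp
    simpa [S] using hp
  let e := S.equivFin
  refine ⟨S.card, ?_, ?_, fun j => (e.symm j : Fin k), ?_, fun j => M (e.symm j), ⟨⟨?_, ?_⟩, ?_⟩, ?_⟩
  · obtain ⟨i, hi, _⟩ := hS 0
    exact Finset.card_pos.2 ⟨i, hi⟩
  · simpa using S.card_le_univ
  · exact Subtype.val_injective.comp e.symm.injective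
  · intro j
    exact (Finset.mem_filter.1 (e.symm j).2).2.index_ne_zero
  · intro p
    obtain ⟨i, hi, hp⟩ := hS p
    exact ⟨e ⟨i, hi⟩, by simpa using hp⟩
  · intro j N _ hlt hc
    have hle : Function.update M (e.symm j) N ≤ M := by
      rw [update_le_iff]
      exact ⟨hlt.le, fun _ _ => le_rfl⟩
    have h2 := hMmin.2 (y := Function.update M (e.symm j) N) ?_ hle (e.symm j)
    · simp only [Function.update_self] at h2
      exact absurd h2 (not_le_of_gt hlt)
    · intro p
      obtain ⟨i, hi⟩ := hc.2 p
      refine ⟨e.symm i, ?_⟩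
      by_cases h : i = j
      · subst h
        simpa using hi
      · rw [Function.update_of_ne h] at hi
        rw [Function.update_of_ne]
        · exact hi
        · intro h3
          exact h (e.symm.injective (Subtype.ext h3))
  · intro j
    exact hML _
end

section
/- Every minimal covering of ℤ² by at most four lattices is, up to permutation of its members, one of the following six families (each lattice given by two generating column vectors): (1) {ℤ²}; (2) {⟨(1,0),(0,2)⟩, ⟨(2,0),(0,1)⟩, ⟨(1,1),(0,2)⟩}; (3) {⟨(1,0),(0,2)⟩, ⟨(4,0),(0,1)⟩, ⟨(1,1),(0,2)⟩, ⟨(2,1),(0,2)⟩}; (4) {⟨(1,0),(0,4)⟩, ⟨(2,0),(0,1)⟩, ⟨(1,1),(0,2)⟩, ⟨(1,2),(0,4)⟩}; (5) {⟨(1,0),(0,2)⟩, ⟨(2,0),(0,1)⟩, ⟨(1,1),(0,4)⟩, ⟨(1,3),(0,4)⟩}; (6) {⟨(1,0),(0,3)⟩, ⟨(3,0),(0,1)⟩, ⟨(1,1),(0,3)⟩, ⟨(1,2),(0,3)⟩}. In particular, there is no minimal covering of length two, and the family (2) is the unique minimal covering of length three. -/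
/-- The sublattice `⟨(a,b),(c,d)⟩ = ℤ·(a,b) + ℤ·(c,d)` of ℤ². -/
def latticeOf (u v : ℤ × ℤ) : AddSubgroup (ℤ × ℤ) := AddSubgroup.closure {u, v}


theorem lc {A : AddSubgroup (ℤ × ℤ)} {u v w : ℤ × ℤ} (hu : u ∈ A) (hv : v ∈ A) (a b : ℤ)
    (h : a • u + b • v = w) : w ∈ A := by
  rw [← h]
  exact A.add_mem (A.zsmul_mem hu a) (A.zsmul_mem hv b)

theorem nt {A : AddSubgroup (ℤ × ℤ)} {u v : ℤ × ℤ}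
    (t : ((1, 0) : ℤ × ℤ) ∈ A → ((0, 1) : ℤ × ℤ) ∈ A → False)
    (hu : u ∈ A) (hv : v ∈ A) (a b c d : ℤ)
    (h : a • u + b • v = (1, 0)) (h' : c • u + d • v = (0, 1)) : False :=
  t (lc hu hv a b h) (lc hu hv c d h')

theorem eq_top_of {A : AddSubgroup (ℤ × ℤ)} (h1 : ((1, 0) : ℤ × ℤ) ∈ A)
    (h2 : ((0, 1) : ℤ × ℤ) ∈ A) : A = ⊤ := by
  rw [eq_top_iff]
  rintro ⟨x, y⟩ -
  exact lc h1 h2 x y (by simp)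

theorem isLattice_of {A : AddSubgroup (ℤ × ℤ)} (m : ℕ) (hm : m ≠ 0)
    (h1 : ((m, 0) : ℤ × ℤ) ∈ A) (h2 : ((0, m) : ℤ × ℤ) ∈ A) : IsLattice A := by
  have : NeZero m := ⟨hm⟩
  let f : ℤ × ℤ →+ ZMod m × ZMod m :=
    AddMonoidHom.prodMap (Int.castAddHom (ZMod m)) (Int.castAddHom (ZMod m))
  have hf : f.ker ≤ A := by
    rintro ⟨x, y⟩ h
    have h' : ((x : ZMod m), (y : ZMod m)) = 0 := h
    rw [Prod.mk_eq_zero, ZMod.intCast_zmod_eq_zero_iff_dvd, ZMod.intCast_zmod_eq_zero_iff_dvd] at h'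
    obtain ⟨⟨a, ha⟩, ⟨b, hb⟩⟩ := h'
    refine lc h1 h2 a b ?_
    simp [ha, hb, mul_comm]
  have hk : f.ker.index ≠ 0 := by
    rw [AddSubgroup.index_ker]
    exact Nat.card_pos.ne'
  intro h0
  have := AddSubgroup.index_dvd_of_le hf
  rw [h0] at this
  exact hk (Nat.eq_zero_of_zero_dvd this)

theorem exists_lt {A : AddSubgroup (ℤ × ℤ)} (hA : IsLattice A) :
    ∃ A', IsLattice A' ∧ A' < A := by
  have hn : A.index ≠ 0 := hA
  have h1 : ∀ p : ℤ × ℤ, A.index • p ∈ A := fun p => AddSubgroup.nsmul_index_mem A p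
  have h10 := h1 (1, 0)
  have h01 := h1 (0, 1)
  refine ⟨A.map (zsmulAddGroupHom 2), ?_, ?_⟩
  · refine isLattice_of (2 * A.index) (by omega) ⟨_, h10, ?_⟩ ⟨_, h01, ?_⟩ <;> simp
  · refine lt_of_le_of_ne ?_ ?_
    · rintro _ ⟨p, hp, rfl⟩
      exact A.zsmul_mem hp 2
    · intro he
      have key : ∀ k : ℕ, ∀ p ∈ A, (2 : ℤ) ^ k ∣ p.1 := by
        intro k
        induction k with
        | zero => intro p _; simp
        | succ k ih =>
          intro p hp
          rw [← he] at hp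
          obtain ⟨q, hq, rfl⟩ := hp
          obtain ⟨c, hc⟩ := ih q hq
          exact ⟨c, by simp [hc]; ring⟩
      have h3 := key A.index _ h10
      have h4 : (2 : ℤ) ^ A.index ∣ (A.index : ℤ) := by simpa using h3
      have h5 : 2 ^ A.index ∣ A.index := by exact_mod_cast h4
      have h6 := Nat.le_of_dvd (Nat.pos_of_ne_zero hn) h5
      have h7 : A.index < 2 ^ A.index := Nat.lt_two_pow_self
      omega

theorem not_redundant {k : ℕ} {L : Fin k → AddSubgroup (ℤ × ℤ)} (h : IsMinimalCovering L)
    (i : Fin k) (hr : ∀ p, ∃ j, j ≠ i ∧ p ∈ L j) : False := by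
  obtain ⟨A', h1, h2⟩ := exists_lt (h.1.1 i)
  refine h.2 i A' h1 h2 ⟨?_, ?_⟩
  · intro j
    by_cases hj : j = i
    · subst hj; simpa using h1
    · simpa [Function.update_of_ne hj] using h.1.1 j
  · intro p
    obtain ⟨j, hj, hp⟩ := hr p
    exact ⟨j, by simpa [Function.update_of_ne hj] using hp⟩

theorem eq_of_cover {k : ℕ} {L : Fin k → AddSubgroup (ℤ × ℤ)} (h : IsMinimalCovering L)
    (i : Fin k) (M : AddSubgroup (ℤ × ℤ)) (hM : IsLattice M) (hle : M ≤ L i)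
    (hr : ∀ p, p ∈ M ∨ ∃ j, j ≠ i ∧ p ∈ L j) : L i = M := by
  by_contra hne
  refine h.2 i M hM (lt_of_le_of_ne hle (Ne.symm hne)) ⟨?_, ?_⟩
  · intro j
    by_cases hj : j = i
    · subst hj; simpa using hM
    · simpa [Function.update_of_ne hj] using h.1.1 j
  · intro p
    rcases hr p with hp | ⟨j, hj, hp⟩
    · exact ⟨i, by simpa using hp⟩
    · exact ⟨j, by simpa [Function.update_of_ne hj] using hp⟩

theorem not_top {k : ℕ} (hk : 2 ≤ k) {L : Fin k → AddSubgroup (ℤ × ℤ)} (h : IsMinimalCovering L)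
    (i : Fin k) (h1 : ((1, 0) : ℤ × ℤ) ∈ L i) (h2 : ((0, 1) : ℤ × ℤ) ∈ L i) : False := by
  have : Nontrivial (Fin k) := Fin.nontrivial_iff_two_le.2 hk
  obtain ⟨j, hj⟩ := exists_ne i
  refine not_redundant h j fun p => ⟨i, hj.symm, ?_⟩
  rw [eq_top_of h1 h2]
  trivial

theorem latticeOf_le {u v : ℤ × ℤ} {A : AddSubgroup (ℤ × ℤ)} (hu : u ∈ A) (hv : v ∈ A) :
    latticeOf u v ≤ A := by
  unfold latticeOf
  rw [AddSubgroup.closure_le]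
  rintro w (rfl | hw)
  · exact hu
  · rw [Set.mem_singleton_iff] at hw
    rw [hw]; exact hv

theorem mem_left (u v : ℤ × ℤ) : u ∈ latticeOf u v := AddSubgroup.subset_closure (by simp)
theorem mem_right (u v : ℤ × ℤ) : v ∈ latticeOf u v := AddSubgroup.subset_closure (by simp)

theorem isLattice_latticeOf {u v : ℤ × ℤ} (a b c d : ℤ)
    (h1 : a • u + b • v = (12, 0)) (h2 : c • u + d • v = (0, 12)) : IsLattice (latticeOf u v) :=
  isLattice_of 12 (by norm_num) (lc (mem_left u v) (mem_right u v) a b (by simpa using h1))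
    (lc (mem_left u v) (mem_right u v) c d (by simpa using h2))

theorem span1 {A : AddSubgroup (ℤ × ℤ)} {b d : ℤ} (h1 : ((1, b) : ℤ × ℤ) ∈ A)
    (h2 : ((0, d) : ℤ × ℤ) ∈ A) (x y : ℤ) (h : d ∣ y - b * x) : (x, y) ∈ A := by
  obtain ⟨c, hc⟩ := h
  refine lc h1 h2 x c ?_
  ext
  · simp
  · simp; linarith

theorem span2 {A : AddSubgroup (ℤ × ℤ)} {d : ℤ} (h1 : ((d, 0) : ℤ × ℤ) ∈ A)
    (h2 : ((0, 1) : ℤ × ℤ) ∈ A) (x y : ℤ) (h : d ∣ x) : (x, y) ∈ A := by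
  obtain ⟨c, hc⟩ := h
  refine lc h1 h2 c y ?_
  ext
  · simp; linarith
  · simp

theorem span3 {A : AddSubgroup (ℤ × ℤ)} (h1 : ((2, 1) : ℤ × ℤ) ∈ A)
    (h2 : ((0, 2) : ℤ × ℤ) ∈ A) (x y : ℤ) (h : 4 ∣ x - 2 * y) : (x, y) ∈ A := by
  obtain ⟨c, hc⟩ := h
  refine lc h1 h2 (2 * c + y) (-c) ?_
  ext
  · simp; linarith
  · simp; linarith

theorem cover2 {A B C : AddSubgroup (ℤ × ℤ)}
    (a1 : ((1, 0) : ℤ × ℤ) ∈ A) (a2 : ((0, 2) : ℤ × ℤ) ∈ A)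
    (b1 : ((2, 0) : ℤ × ℤ) ∈ B) (b2 : ((0, 1) : ℤ × ℤ) ∈ B)
    (c1 : ((1, 1) : ℤ × ℤ) ∈ C) (c2 : ((0, 2) : ℤ × ℤ) ∈ C) (p : ℤ × ℤ) :
    p ∈ A ∨ p ∈ B ∨ p ∈ C := by
  obtain ⟨x, y⟩ := p
  have : 2 ∣ y - 0 * x ∨ 2 ∣ x ∨ 2 ∣ y - 1 * x := by omega
  exact this.imp (span1 a1 a2 x y) (Or.imp (span2 b1 b2 x y) (span1 c1 c2 x y))

set_option maxHeartbeats 4000000 in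
theorem core4 {A B C D : AddSubgroup (ℤ × ℤ)}
    (hc : ∀ p, p ∈ A ∨ p ∈ B ∨ p ∈ C ∨ p ∈ D)
    (tA : ((1, 0) : ℤ × ℤ) ∈ A → ((0, 1) : ℤ × ℤ) ∈ A → False)
    (tB : ((1, 0) : ℤ × ℤ) ∈ B → ((0, 1) : ℤ × ℤ) ∈ B → False)
    (tC : ((1, 0) : ℤ × ℤ) ∈ C → ((0, 1) : ℤ × ℤ) ∈ C → False)
    (tD : ((1, 0) : ℤ × ℤ) ∈ D → ((0, 1) : ℤ × ℤ) ∈ D → False)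
    (rA : (∀ p, p ∈ B ∨ p ∈ C ∨ p ∈ D) → False)
    (rB : (∀ p, p ∈ A ∨ p ∈ C ∨ p ∈ D) → False)
    (rC : (∀ p, p ∈ A ∨ p ∈ B ∨ p ∈ D) → False)
    (rD : (∀ p, p ∈ A ∨ p ∈ B ∨ p ∈ C) → False)
    (hm : ∀ A' B' C' D', IsLattice A' → IsLattice B' → IsLattice C' → IsLattice D' →
      A' ≤ A → B' ≤ B → C' ≤ C → D' ≤ D → (∀ p, p ∈ A' ∨ p ∈ B' ∨ p ∈ C' ∨ p ∈ D') →
      A = A' ∧ B = B' ∧ C = C' ∧ D = D')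
    (a1 : ((1, 0) : ℤ × ℤ) ∈ A) (b1 : ((0, 1) : ℤ × ℤ) ∈ B) (c1 : ((1, 1) : ℤ × ℤ) ∈ C) :
    (A = latticeOf (1,0) (0,2) ∧ B = latticeOf (4,0) (0,1) ∧
      C = latticeOf (1,1) (0,2) ∧ D = latticeOf (2,1) (0,2)) ∨
    (A = latticeOf (1,0) (0,4) ∧ B = latticeOf (2,0) (0,1) ∧
      C = latticeOf (1,1) (0,2) ∧ D = latticeOf (1,2) (0,4)) ∨
    (A = latticeOf (1,0) (0,2) ∧ B = latticeOf (2,0) (0,1) ∧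
      C = latticeOf (1,1) (0,4) ∧ D = latticeOf (1,3) (0,4)) ∨
    (A = latticeOf (1,0) (0,3) ∧ B = latticeOf (3,0) (0,1) ∧
      C = latticeOf (1,1) (0,3) ∧ D = latticeOf (1,2) (0,3)) := by
  have n12 : (0, 2) ∈ A ∨ (1, 2) ∈ D := by
    rcases hc (1, 2) with h | h | h | h
    · exact Or.inl (lc a1 h (-1) 1 (by simp))
    · exact (nt tB b1 h (-2) 1 1 0 (by simp) (by simp)).elim
    · exact (nt tC c1 h 2 (-1) (-1) 1 (by simp) (by simp)).elim
    · exact Or.inr h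
  have n21 : (2, 0) ∈ B ∨ (2, 1) ∈ D := by
    rcases hc (2, 1) with h | h | h | h
    · exact (nt tA a1 h 1 0 (-2) 1 (by simp) (by simp)).elim
    · exact Or.inl (lc b1 h (-1) 1 (by simp))
    · exact (nt tC c1 h (-1) 1 2 (-1) (by simp) (by simp)).elim
    · exact Or.inr h
  by_cases c2 : ((0, 2) : ℤ × ℤ) ∈ C
  · -- here C contains all points with both coordinates of the same parity
    have noC : ∀ {x y : ℤ}, (x, y) ∈ C → 2 ∣ y - x := by
      intro x y h
      by_contra h'
      have h3 : ((0, 1) : ℤ × ℤ) ∈ C := by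
        have h4 : (x, y - 1) ∈ C := span1 c1 c2 x (y - 1) (by omega)
        exact lc h h4 1 (-1) (by simp)
      exact tC (lc c1 h3 1 (-1) (by simp)) h3
    have q12 : (0, 2) ∈ A ∨ (1, -2) ∈ D := by
      rcases hc (1, -2) with h | h | h | h
      · exact Or.inl (lc a1 h 1 (-1) (by simp))
      · exact (nt tB b1 h 2 1 1 0 (by simp) (by simp)).elim
      · have := noC h; omega
      · exact Or.inr h
    have q21 : (2, 0) ∈ B ∨ (2, -1) ∈ D := by
      rcases hc (2, -1) with h | h | h | h
      · exact (nt tA a1 h 1 0 2 (-1) (by simp) (by simp)).elim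
      · exact Or.inl (lc b1 h 1 1 (by simp))
      · have := noC h; omega
      · exact Or.inr h
    by_cases a2 : ((0, 2) : ℤ × ℤ) ∈ A
    · have nb : ((2, 0) : ℤ × ℤ) ∉ B := fun h => rD (cover2 a1 a2 h b1 c1 c2)
      have d1 := n21.resolve_left nb
      have d2 := q21.resolve_left nb
      have d3 : ((0, 2) : ℤ × ℤ) ∈ D := lc d1 d2 1 (-1) (by simp)
      have b2 : ((4, 0) : ℤ × ℤ) ∈ B := by
        rcases hc (4, 1) with h | h | h | h
        · exact (nt tA a1 h 1 0 (-4) 1 (by simp) (by simp)).elim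
        · exact lc b1 h (-1) 1 (by simp)
        · have := noC h; omega
        · refine (rB fun p => ?_).elim
          have e : ((2, 0) : ℤ × ℤ) ∈ D := lc d1 h (-1) 1 (by simp)
          have e' : ((0, 1) : ℤ × ℤ) ∈ D := lc d1 e 1 (-1) (by simp)
          rcases cover2 a1 a2 e e' c1 c2 p with hp | hp | hp
          exacts [Or.inl hp, Or.inr (Or.inr hp), Or.inr (Or.inl hp)]
      left
      refine hm _ _ _ _ (isLattice_latticeOf 12 0 0 6 (by simp) (by simp))
        (isLattice_latticeOf 3 0 0 12 (by simp) (by simp))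
        (isLattice_latticeOf 12 (-6) 0 6 (by simp) (by simp))
        (isLattice_latticeOf 6 (-3) 0 6 (by simp) (by simp))
        (latticeOf_le a1 a2) (latticeOf_le b2 b1) (latticeOf_le c1 c2) (latticeOf_le d1 d3) ?_
      rintro ⟨x, y⟩
      have : 2 ∣ y - 0 * x ∨ 4 ∣ x ∨ 2 ∣ y - 1 * x ∨ 4 ∣ x - 2 * y := by omega
      exact this.imp (span1 (mem_left _ _) (mem_right _ _) x y)
        (Or.imp (span2 (mem_left _ _) (mem_right _ _) x y)
        (Or.imp (span1 (mem_left _ _) (mem_right _ _) x y)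
          (span3 (mem_left _ _) (mem_right _ _) x y)))
    · have d1 := n12.resolve_left a2
      have d2 := q12.resolve_left a2
      have d3 : ((0, 4) : ℤ × ℤ) ∈ D := lc d1 d2 1 (-1) (by simp)
      rcases n21 with b2 | h
      · have a3 : ((0, 4) : ℤ × ℤ) ∈ A := by
          rcases hc (1, 4) with h | h | h | h
          · exact lc a1 h (-1) 1 (by simp)
          · exact (nt tB b1 h (-4) 1 1 0 (by simp) (by simp)).elim
          · have := noC h; omega
          · refine (rA fun p => ?_).elim
            have e : ((0, 2) : ℤ × ℤ) ∈ D := lc d1 h (-1) 1 (by simp)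
            have e' : ((1, 0) : ℤ × ℤ) ∈ D := lc d1 e 1 (-1) (by simp)
            rcases cover2 e' e b2 b1 c1 c2 p with hp | hp | hp
            exacts [Or.inr (Or.inr hp), Or.inl hp, Or.inr (Or.inl hp)]
        right; left
        refine hm _ _ _ _ (isLattice_latticeOf 12 0 0 3 (by simp) (by simp))
          (isLattice_latticeOf 6 0 0 12 (by simp) (by simp))
          (isLattice_latticeOf 12 (-6) 0 6 (by simp) (by simp))
          (isLattice_latticeOf 12 (-6) 0 3 (by simp) (by simp))
          (latticeOf_le a1 a3) (latticeOf_le b2 b1) (latticeOf_le c1 c2) (latticeOf_le d1 d3) ?_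
        rintro ⟨x, y⟩
        have : 4 ∣ y - 0 * x ∨ 2 ∣ x ∨ 2 ∣ y - 1 * x ∨ 4 ∣ y - 2 * x := by omega
        exact this.imp (span1 (mem_left _ _) (mem_right _ _) x y)
          (Or.imp (span2 (mem_left _ _) (mem_right _ _) x y)
          (Or.imp (span1 (mem_left _ _) (mem_right _ _) x y)
            (span1 (mem_left _ _) (mem_right _ _) x y)))
      · have e : ((0, 3) : ℤ × ℤ) ∈ D := lc d1 h 2 (-1) (by simp)
        have e' : ((0, 1) : ℤ × ℤ) ∈ D := lc d3 e 1 (-1) (by simp)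
        exact (tD (lc d1 e' 1 (-2) (by simp)) e').elim
  · -- here the point (1,-1) lies in D
    have d1 : ((1, -1) : ℤ × ℤ) ∈ D := by
      rcases hc (1, -1) with h | h | h | h
      · exact (nt tA a1 h 1 0 1 (-1) (by simp) (by simp)).elim
      · exact (nt tB b1 h 1 1 1 0 (by simp) (by simp)).elim
      · exact (c2 (lc c1 h 1 (-1) (by simp))).elim
      · exact h
    have m12 : (0, 2) ∈ A ∨ (1, -2) ∈ C := by
      rcases hc (1, -2) with h | h | h | h
      · exact Or.inl (lc a1 h 1 (-1) (by simp))
      · exact (nt tB b1 h 2 1 1 0 (by simp) (by simp)).elim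
      · exact Or.inr h
      · exact (nt tD d1 h 2 (-1) 1 (-1) (by simp) (by simp)).elim
    have m21 : (2, 0) ∈ B ∨ (2, -1) ∈ C := by
      rcases hc (2, -1) with h | h | h | h
      · exact (nt tA a1 h 1 0 2 (-1) (by simp) (by simp)).elim
      · exact Or.inl (lc b1 h 1 1 (by simp))
      · exact Or.inr h
      · exact (nt tD d1 h (-1) 1 (-2) 1 (by simp) (by simp)).elim
    by_cases hab : ((0, 2) : ℤ × ℤ) ∈ A ∧ ((2, 0) : ℤ × ℤ) ∈ B
    · obtain ⟨a2, b2⟩ := hab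
      have nd : ((0, 2) : ℤ × ℤ) ∉ D := fun h => rC fun p =>
        cover2 a1 a2 b2 b1 (lc d1 h 1 1 (by simp)) h p
      have d3 : ((1, 3) : ℤ × ℤ) ∈ D := by
        rcases hc (1, 3) with h | h | h | h
        · exact (tA a1 (lc (lc a1 h (-1) 1 (w := (0, 3)) (by simp)) a2 1 (-1) (by simp))).elim
        · exact (nt tB b1 h (-3) 1 1 0 (by simp) (by simp)).elim
        · exact (c2 (lc c1 h (-1) 1 (by simp))).elim
        · exact h
      have c3 : ((1, -3) : ℤ × ℤ) ∈ C := by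
        rcases hc (1, -3) with h | h | h | h
        · exact (tA a1 (lc (lc a1 h 1 (-1) (w := (0, 3)) (by simp)) a2 1 (-1) (by simp))).elim
        · exact (nt tB b1 h 3 1 1 0 (by simp) (by simp)).elim
        · exact h
        · exact (nd (lc d1 h 1 (-1) (by simp))).elim
      have d4 : ((0, 4) : ℤ × ℤ) ∈ D := lc d1 d3 (-1) 1 (by simp)
      have c4 : ((0, 4) : ℤ × ℤ) ∈ C := lc c1 c3 1 (-1) (by simp)
      right; right; left
      refine hm _ _ _ _ (isLattice_latticeOf 12 0 0 6 (by simp) (by simp))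
        (isLattice_latticeOf 6 0 0 12 (by simp) (by simp))
        (isLattice_latticeOf 12 (-3) 0 3 (by simp) (by simp))
        (isLattice_latticeOf 12 (-9) 0 3 (by simp) (by simp))
        (latticeOf_le a1 a2) (latticeOf_le b2 b1) (latticeOf_le c1 c4) (latticeOf_le d3 d4) ?_
      rintro ⟨x, y⟩
      have : 2 ∣ y - 0 * x ∨ 2 ∣ x ∨ 4 ∣ y - 1 * x ∨ 4 ∣ y - 3 * x := by omega
      exact this.imp (span1 (mem_left _ _) (mem_right _ _) x y)
        (Or.imp (span2 (mem_left _ _) (mem_right _ _) x y)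
        (Or.imp (span1 (mem_left _ _) (mem_right _ _) x y)
          (span1 (mem_left _ _) (mem_right _ _) x y)))
    · have cd : ((0, 3) : ℤ × ℤ) ∈ C ∧ ((0, 3) : ℤ × ℤ) ∈ D := by
        by_cases a2 : ((0, 2) : ℤ × ℤ) ∈ A
        · have b2 : ((2, 0) : ℤ × ℤ) ∉ B := fun h => hab ⟨a2, h⟩
          exact ⟨lc c1 (m21.resolve_left b2) 2 (-1) (by simp),
            lc d1 (n21.resolve_left b2) (-2) 1 (by simp)⟩
        · exact ⟨lc c1 (m12.resolve_left a2) 1 (-1) (by simp),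
            lc d1 (n12.resolve_left a2) (-1) 1 (by simp)⟩
      obtain ⟨c3, d3⟩ := cd
      have d2 : ((1, 2) : ℤ × ℤ) ∈ D := lc d1 d3 1 1 (by simp)
      have a3 : ((0, 3) : ℤ × ℤ) ∈ A := by
        rcases hc (1, 3) with h | h | h | h
        · exact lc a1 h (-1) 1 (by simp)
        · exact (nt tB b1 h (-3) 1 1 0 (by simp) (by simp)).elim
        · have e : ((1, 0) : ℤ × ℤ) ∈ C := lc h c3 1 (-1) (by simp)
          exact (tC e (lc c1 e 1 (-1) (by simp))).elim
        · have e : ((1, 0) : ℤ × ℤ) ∈ D := lc h d3 1 (-1) (by simp)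
          exact (tD e (lc e d1 1 (-1) (by simp))).elim
      have b3 : ((3, 0) : ℤ × ℤ) ∈ B := by
        rcases hc (3, 1) with h | h | h | h
        · exact (nt tA a1 h 1 0 (-3) 1 (by simp) (by simp)).elim
        · exact lc b1 h (-1) 1 (by simp)
        · have e : ((0, 2) : ℤ × ℤ) ∈ C := lc c1 h 3 (-1) (by simp)
          exact (c2 e).elim
        · have e : ((0, 4) : ℤ × ℤ) ∈ D := lc d1 h (-3) 1 (by simp)
          have e' : ((0, 1) : ℤ × ℤ) ∈ D := lc e d3 1 (-1) (by simp)
          exact (tD (lc d1 e' 1 1 (by simp)) e').elim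
      right; right; right
      refine hm _ _ _ _ (isLattice_latticeOf 12 0 0 4 (by simp) (by simp))
        (isLattice_latticeOf 4 0 0 12 (by simp) (by simp))
        (isLattice_latticeOf 12 (-4) 0 4 (by simp) (by simp))
        (isLattice_latticeOf 12 (-8) 0 4 (by simp) (by simp))
        (latticeOf_le a1 a3) (latticeOf_le b3 b1) (latticeOf_le c1 c3) (latticeOf_le d2 d3) ?_
      rintro ⟨x, y⟩
      have : 3 ∣ y - 0 * x ∨ 3 ∣ x ∨ 3 ∣ y - 1 * x ∨ 3 ∣ y - 2 * x := by
        have hx : x % 3 = 0 ∨ x % 3 = 1 ∨ x % 3 = 2 := by omega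
        have hy : y % 3 = 0 ∨ y % 3 = 1 ∨ y % 3 = 2 := by omega
        rcases hx with hx | hx | hx <;> rcases hy with hy | hy | hy <;> omega
      exact this.imp (span1 (mem_left _ _) (mem_right _ _) x y)
        (Or.imp (span2 (mem_left _ _) (mem_right _ _) x y)
        (Or.imp (span1 (mem_left _ _) (mem_right _ _) x y)
          (span1 (mem_left _ _) (mem_right _ _) x y)))

theorem three_distinct {k : ℕ} (hk : 2 ≤ k) {L : Fin k → AddSubgroup (ℤ × ℤ)}
    (h : IsMinimalCovering L) : ∃ a b c : Fin k, a ≠ b ∧ a ≠ c ∧ b ≠ c ∧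
      ((1, 0) : ℤ × ℤ) ∈ L a ∧ ((0, 1) : ℤ × ℤ) ∈ L b ∧ ((1, 1) : ℤ × ℤ) ∈ L c := by
  obtain ⟨a, ha⟩ := h.1.2 (1, 0)
  obtain ⟨b, hb⟩ := h.1.2 (0, 1)
  obtain ⟨c, hc⟩ := h.1.2 (1, 1)
  refine ⟨a, b, c, ?_, ?_, ?_, ha, hb, hc⟩
  · rintro rfl; exact not_top hk h a ha hb
  · rintro rfl; exact not_top hk h a ha (lc ha hc (-1) 1 (by simp))
  · rintro rfl; exact not_top hk h b (lc hb hc (-1) 1 (by simp)) hb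

theorem range_three {α : Type*} (L : Fin 3 → α) (a b c : Fin 3) (h : ∀ m, m = a ∨ m = b ∨ m = c) :
    Set.range L = {L a, L b, L c} := by
  ext x
  simp only [Set.mem_range, Set.mem_insert_iff, Set.mem_singleton_iff]
  constructor
  · rintro ⟨m, rfl⟩
    rcases h m with rfl | rfl | rfl <;> simp
  · rintro (rfl | rfl | rfl) <;> exact ⟨_, rfl⟩

theorem range_four {α : Type*} (L : Fin 4 → α) (a b c d : Fin 4)
    (h : ∀ m, m = a ∨ m = b ∨ m = c ∨ m = d) :
    Set.range L = {L a, L b, L c, L d} := by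
  ext x
  simp only [Set.mem_range, Set.mem_insert_iff, Set.mem_singleton_iff]
  constructor
  · rintro ⟨m, rfl⟩
    rcases h m with rfl | rfl | rfl | rfl <;> simp
  · rintro (rfl | rfl | rfl | rfl) <;> exact ⟨_, rfl⟩

theorem case_two (L : Fin 2 → AddSubgroup (ℤ × ℤ)) : ¬ IsMinimalCovering L := by
  intro h
  obtain ⟨a, b, c, h1, h2, h3, -⟩ := three_distinct le_rfl h
  omega

theorem case_three (L : Fin 3 → AddSubgroup (ℤ × ℤ)) (h : IsMinimalCovering L) :
    Set.range L = {latticeOf (1,0) (0,2), latticeOf (2,0) (0,1), latticeOf (1,1) (0,2)} := by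
  obtain ⟨a, b, c, hab, hac, hbc, a1, b1, c1⟩ := three_distinct (by norm_num) h
  have hm : ∀ m, m = a ∨ m = b ∨ m = c := by intro m; omega
  have hc : ∀ p, p ∈ L a ∨ p ∈ L b ∨ p ∈ L c := by
    intro p
    obtain ⟨m, hp⟩ := h.1.2 p
    rcases hm m with rfl | rfl | rfl <;> tauto
  have tA := not_top (by norm_num) h a
  have tB := not_top (by norm_num) h b
  have tC := not_top (by norm_num) h c
  have c2 : ((0, 2) : ℤ × ℤ) ∈ L c := by
    rcases hc (1, -1) with h | h | h
    · exact (nt tA a1 h 1 0 1 (-1) (by simp) (by simp)).elim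
    · exact (nt tB b1 h 1 1 1 0 (by simp) (by simp)).elim
    · exact lc c1 h 1 (-1) (by simp)
  have a2 : ((0, 2) : ℤ × ℤ) ∈ L a := by
    rcases hc (1, 2) with h | h | h
    · exact lc a1 h (-1) 1 (by simp)
    · exact (nt tB b1 h (-2) 1 1 0 (by simp) (by simp)).elim
    · exact (nt tC c1 h 2 (-1) (-1) 1 (by simp) (by simp)).elim
  have b2 : ((2, 0) : ℤ × ℤ) ∈ L b := by
    rcases hc (2, 1) with h | h | h
    · exact (nt tA a1 h 1 0 (-2) 1 (by simp) (by simp)).elim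
    · exact lc b1 h (-1) 1 (by simp)
    · exact (nt tC c1 h (-1) 1 2 (-1) (by simp) (by simp)).elim
  have eA : L a = latticeOf (1,0) (0,2) := by
    refine eq_of_cover h a _ (isLattice_latticeOf 12 0 0 6 (by simp) (by simp))
      (latticeOf_le a1 a2) fun p => ?_
    rcases cover2 (mem_left _ _) (mem_right _ _) b2 b1 c1 c2 p with hp | hp | hp
    · exact Or.inl hp
    · exact Or.inr ⟨b, hab.symm, hp⟩
    · exact Or.inr ⟨c, hac.symm, hp⟩
  have eB : L b = latticeOf (2,0) (0,1) := by
    refine eq_of_cover h b _ (isLattice_latticeOf 6 0 0 12 (by simp) (by simp))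
      (latticeOf_le b2 b1) fun p => ?_
    rcases cover2 a1 a2 (mem_left _ _) (mem_right _ _) c1 c2 p with hp | hp | hp
    · exact Or.inr ⟨a, hab, hp⟩
    · exact Or.inl hp
    · exact Or.inr ⟨c, hbc.symm, hp⟩
  have eC : L c = latticeOf (1,1) (0,2) := by
    refine eq_of_cover h c _ (isLattice_latticeOf 12 (-6) 0 6 (by simp) (by simp))
      (latticeOf_le c1 c2) fun p => ?_
    rcases cover2 a1 a2 b2 b1 (mem_left _ _) (mem_right _ _) p with hp | hp | hp
    · exact Or.inr ⟨a, hac, hp⟩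
    · exact Or.inr ⟨b, hbc, hp⟩
    · exact Or.inl hp
  rw [range_three L a b c hm, eA, eB, eC]

theorem exists_fourth : ∀ a b c : Fin 4, a ≠ b → a ≠ c → b ≠ c →
    ∃ d, a ≠ d ∧ b ≠ d ∧ c ≠ d ∧ ∀ m, m = a ∨ m = b ∨ m = c ∨ m = d := by
  decide

theorem case_four (L : Fin 4 → AddSubgroup (ℤ × ℤ)) (h : IsMinimalCovering L) :
      Set.range L = {latticeOf (1,0) (0,2), latticeOf (4,0) (0,1),
        latticeOf (1,1) (0,2), latticeOf (2,1) (0,2)} ∨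
      Set.range L = {latticeOf (1,0) (0,4), latticeOf (2,0) (0,1),
        latticeOf (1,1) (0,2), latticeOf (1,2) (0,4)} ∨
      Set.range L = {latticeOf (1,0) (0,2), latticeOf (2,0) (0,1),
        latticeOf (1,1) (0,4), latticeOf (1,3) (0,4)} ∨
      Set.range L = {latticeOf (1,0) (0,3), latticeOf (3,0) (0,1),
        latticeOf (1,1) (0,3), latticeOf (1,2) (0,3)} := by
  obtain ⟨a, b, c, hab, hac, hbc, a1, b1, c1⟩ := three_distinct (by norm_num) h
  obtain ⟨d, had, hbd, hcd, hm⟩ := exists_fourth a b c hab hac hbc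
  have hc : ∀ p, p ∈ L a ∨ p ∈ L b ∨ p ∈ L c ∨ p ∈ L d := by
    intro p
    obtain ⟨m, hp⟩ := h.1.2 p
    rcases hm m with rfl | rfl | rfl | rfl <;> tauto
  have key := core4 hc (not_top (by norm_num) h a) (not_top (by norm_num) h b)
    (not_top (by norm_num) h c) (not_top (by norm_num) h d)
    (fun hr => not_redundant h a fun p => by
      rcases hr p with hp | hp | hp
      exacts [⟨_, hab.symm, hp⟩, ⟨_, hac.symm, hp⟩, ⟨_, had.symm, hp⟩])
    (fun hr => not_redundant h b fun p => by
      rcases hr p with hp | hp | hp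
      exacts [⟨_, hab, hp⟩, ⟨_, hbc.symm, hp⟩, ⟨_, hbd.symm, hp⟩])
    (fun hr => not_redundant h c fun p => by
      rcases hr p with hp | hp | hp
      exacts [⟨_, hac, hp⟩, ⟨_, hbc, hp⟩, ⟨_, hcd.symm, hp⟩])
    (fun hr => not_redundant h d fun p => by
      rcases hr p with hp | hp | hp
      exacts [⟨_, had, hp⟩, ⟨_, hbd, hp⟩, ⟨_, hcd, hp⟩])
    (fun A' B' C' D' lA lB lC lD hA hB hC hD hr => by
      refine ⟨eq_of_cover h a A' lA hA fun p => ?_, eq_of_cover h b B' lB hB fun p => ?_,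
        eq_of_cover h c C' lC hC fun p => ?_, eq_of_cover h d D' lD hD fun p => ?_⟩
      · rcases hr p with hp | hp | hp | hp
        exacts [Or.inl hp, Or.inr ⟨_, hab.symm, hB hp⟩, Or.inr ⟨_, hac.symm, hC hp⟩,
          Or.inr ⟨_, had.symm, hD hp⟩]
      · rcases hr p with hp | hp | hp | hp
        exacts [Or.inr ⟨_, hab, hA hp⟩, Or.inl hp, Or.inr ⟨_, hbc.symm, hC hp⟩,
          Or.inr ⟨_, hbd.symm, hD hp⟩]
      · rcases hr p with hp | hp | hp | hp
        exacts [Or.inr ⟨_, hac, hA hp⟩, Or.inr ⟨_, hbc, hB hp⟩, Or.inl hp,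
          Or.inr ⟨_, hcd.symm, hD hp⟩]
      · rcases hr p with hp | hp | hp | hp
        exacts [Or.inr ⟨_, had, hA hp⟩, Or.inr ⟨_, hbd, hB hp⟩, Or.inr ⟨_, hcd, hC hp⟩,
          Or.inl hp])
    a1 b1 c1
  rw [range_four L a b c d hm]
  rcases key with ⟨e1, e2, e3, e4⟩ | ⟨e1, e2, e3, e4⟩ | ⟨e1, e2, e3, e4⟩ | ⟨e1, e2, e3, e4⟩
  · left; rw [e1, e2, e3, e4]
  · right; left; rw [e1, e2, e3, e4]
  · right; right; left; rw [e1, e2, e3, e4]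
  · right; right; right; rw [e1, e2, e3, e4]

/-- **Classification of minimal coverings of ℤ² of length at most four.**
Every minimal covering of ℤ² by at most four lattices is, up to permutation
(i.e. as a set of lattices), one of six explicit families.  In particular there is
no minimal covering of length two, and the length-three one is unique. -/
theorem minimal_coverings_length_le_four :
    (∀ (k : ℕ), k ≤ 4 → ∀ L : Fin k → AddSubgroup (ℤ × ℤ), IsMinimalCovering L →
      Set.range L = {(⊤ : AddSubgroup (ℤ × ℤ))} ∨
      Set.range L = {latticeOf (1,0) (0,2), latticeOf (2,0) (0,1), latticeOf (1,1) (0,2)} ∨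
      Set.range L = {latticeOf (1,0) (0,2), latticeOf (4,0) (0,1),
        latticeOf (1,1) (0,2), latticeOf (2,1) (0,2)} ∨
      Set.range L = {latticeOf (1,0) (0,4), latticeOf (2,0) (0,1),
        latticeOf (1,1) (0,2), latticeOf (1,2) (0,4)} ∨
      Set.range L = {latticeOf (1,0) (0,2), latticeOf (2,0) (0,1),
        latticeOf (1,1) (0,4), latticeOf (1,3) (0,4)} ∨
      Set.range L = {latticeOf (1,0) (0,3), latticeOf (3,0) (0,1),
        latticeOf (1,1) (0,3), latticeOf (1,2) (0,3)}) ∧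
    (∀ L : Fin 2 → AddSubgroup (ℤ × ℤ), ¬ IsMinimalCovering L) ∧
    (∀ L : Fin 3 → AddSubgroup (ℤ × ℤ), IsMinimalCovering L →
      Set.range L = {latticeOf (1,0) (0,2), latticeOf (2,0) (0,1), latticeOf (1,1) (0,2)}) := by
  refine ⟨?_, case_two, case_three⟩
  intro k hk L h
  have hk' : k = 0 ∨ k = 1 ∨ k = 2 ∨ k = 3 ∨ k = 4 := by omega
  rcases hk' with rfl | rfl | rfl | rfl | rfl
  · obtain ⟨i, -⟩ := h.1.2 0
    exact i.elim0
  · left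
    have h0 : ∀ p, p ∈ L 0 := by
      intro p
      obtain ⟨i, hi⟩ := h.1.2 p
      rwa [Subsingleton.elim i 0] at hi
    have h1 : L 0 = ⊤ := (AddSubgroup.eq_top_iff' _).2 h0
    rw [Set.range_unique]
    exact congrArg _ h1
  · exact (case_two L h).elim
  · right; left; exact case_three L h
  · right; right; exact case_four L h
end

section
/- The four lattices L₁ = {(x,y) ∈ ℤ² : y ≡ 0 (mod 2)}, L₂ = {(x,y) ∈ ℤ² : x ≡ 0 (mod 4)}, L₃ = {(x,y) ∈ ℤ² : x ≡ y (mod 2)}, and L₄ = {(x,y) ∈ ℤ² : x ≡ 2y (mod 4)} (generated respectively by (1,0),(0,2); (4,0),(0,1); (1,1),(0,2); and (2,1),(0,2)) form a minimal covering of ℤ². -/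
/-- The sublattice of ℤ² defined by the congruence `a·x₁ + b·x₂ ≡ 0 (mod n)`. -/
def congLat (a b n : ℤ) : AddSubgroup (ℤ × ℤ) where
  carrier := {p : ℤ × ℤ | n ∣ a * p.1 + b * p.2}
  zero_mem' := by simp
  add_mem' := by
    intro p q hp hq
    simp only [Set.mem_setOf_eq, Prod.fst_add, Prod.snd_add] at *
    have e : a * (p.1 + q.1) + b * (p.2 + q.2)
        = (a * p.1 + b * p.2) + (a * q.1 + b * q.2) := by ring
    rw [e]; exact dvd_add hp hq
  neg_mem' := by
    intro p hp
    simp only [Set.mem_setOf_eq, Prod.fst_neg, Prod.snd_neg] at *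
    have e : a * (-p.1) + b * (-p.2) = -(a * p.1 + b * p.2) := by ring
    rw [e]; exact hp.neg_right

theorem mem_congLat (a b n : ℤ) (p : ℤ × ℤ) : p ∈ congLat a b n ↔ n ∣ a * p.1 + b * p.2 := Iff.rfl

theorem isLattice_congLat (a b : ℤ) (n : ℕ) [NeZero n] : IsLattice (congLat a b n) := by
  let f : ℤ × ℤ →+ ZMod n :=
    { toFun := fun p => ((a * p.1 + b * p.2 : ℤ) : ZMod n)
      map_zero' := by simp
      map_add' := by intro p q; simp only [Prod.fst_add, Prod.snd_add]; push_cast; ring }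
  have h : congLat a b n = f.ker := by
    ext p
    rw [mem_congLat, AddMonoidHom.mem_ker]
    exact (ZMod.intCast_zmod_eq_zero_iff_dvd _ _).symm
  unfold IsLattice
  rw [h]
  exact (AddSubgroup.finiteIndex_ker f).index_ne_zero

theorem comb_mem (L : AddSubgroup (ℤ × ℤ)) (u v p : ℤ × ℤ) (hu : u ∈ L) (hv : v ∈ L)
    (a b : ℤ) (h1 : p.1 = a * u.1 + b * v.1) (h2 : p.2 = a * u.2 + b * v.2) : p ∈ L := by
  have : p = a • u + b • v := by
    ext <;> simp [h1, h2]
  rw [this]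
  exact L.add_mem (L.zsmul_mem hu a) (L.zsmul_mem hv b)

/-- The four lattices `{y ≡ 0 (2)}`, `{x ≡ 0 (4)}`, `{x ≡ y (2)}`, `{x ≡ 2y (4)}`
form a minimal covering of ℤ². -/
theorem minimal_covering_stmt :
    IsMinimalCovering ![congLat 0 1 2, congLat 1 0 4, congLat 1 (-1) 2, congLat 1 (-2) 4] := by
  refine ⟨⟨?_, ?_⟩, ?_⟩
  · intro i
    fin_cases i
    · exact isLattice_congLat 0 1 2
    · exact isLattice_congLat 1 0 4
    · exact isLattice_congLat 1 (-1) 2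
    · exact isLattice_congLat 1 (-2) 4
  · rintro ⟨x, y⟩
    simp only [Fin.exists_fin_succ, Matrix.cons_val_zero, Matrix.cons_val_succ, mem_congLat]
    simp
    omega
  · intro i L' _ hlt hcov
    have hc := hcov.2
    apply hlt.not_ge
    rintro ⟨x, y⟩ hp
    fin_cases i
    · have h1 := hc (1, 0)
      have h2 := hc (1, 2)
      simp [Fin.exists_fin_succ, Function.update, mem_congLat] at h1 h2 hp
      norm_num at h1 h2
      obtain ⟨k, rfl⟩ := hp
      exact comb_mem L' _ _ _ h1 h2 (x - k) k (by simp) (by simp; ring)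
    · have h1 := hc (0, 1)
      have h2 := hc (4, 1)
      simp [Fin.exists_fin_succ, Function.update, mem_congLat] at h1 h2 hp
      norm_num at h1 h2
      obtain ⟨k, rfl⟩ := hp
      exact comb_mem L' _ _ _ h1 h2 (y - k) k (by simp; ring) (by simp)
    · have h1 := hc (1, 1)
      have h2 := hc (1, 3)
      simp [Fin.exists_fin_succ, Function.update, mem_congLat] at h1 h2 hp
      norm_num at h1 h2
      obtain ⟨k, hk⟩ := hp
      exact comb_mem L' _ _ _ h1 h2 (x + k) (-k) (by simp) (by simp; linarith)
    · have h1 := hc (2, 1)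
      have h2 := hc (2, -1)
      simp [Fin.exists_fin_succ, Function.update, mem_congLat] at h1 h2 hp
      norm_num at h1 h2
      obtain ⟨k, hk⟩ := hp
      exact comb_mem L' _ _ _ h1 h2 (y + k) k (by simp; linarith) (by simp)
end

section
/- Let d ≥ 3 and let G₁, G₂ ∈ Bin(d,ℚ). Let γ ∈ GL(2,ℚ) satisfy G₂∘γ = G₁, and assume that [ℤ² : L(γ)] ≤ [ℤ² : L(τ)] for every τ ∈ GL(2,ℚ) such that G₁∘τ = G₂ or G₂∘τ = G₁. If there exists σ ∈ Aut(G₂,ℚ) such that the matrix γ⁻¹σ has integer coefficients (equivalently, L(γ⁻¹σ) = ℤ²), then G₁ and G₂ are GL(2,ℤ)-equivalent, i.e. there exists M ∈ GL(2,ℤ) with G₁∘M = G₂. -/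
/-- The lattice `L(γ) = {(x,y) ∈ ℤ² : γ·(x,y)ᵀ ∈ ℤ²}` associated to a rational matrix. -/
def latticeOfMatrix (γ : Matrix (Fin 2) (Fin 2) ℚ) : AddSubgroup (ℤ × ℤ) where
  carrier := {p : ℤ × ℤ | ∀ i, ∃ n : ℤ, γ.mulVec ![(p.1 : ℚ), (p.2 : ℚ)] i = n}
  zero_mem' := by
    intro i
    refine ⟨0, ?_⟩
    have h : (![(((0 : ℤ × ℤ).1 : ℚ)), (((0 : ℤ × ℤ).2 : ℚ))] : Fin 2 → ℚ) = 0 := by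
      funext j; fin_cases j <;> simp
    rw [h, Matrix.mulVec_zero]
    simp
  add_mem' := by
    intro p q hp hq i
    obtain ⟨m, hm⟩ := hp i
    obtain ⟨n, hn⟩ := hq i
    refine ⟨m + n, ?_⟩
    have h : (![(((p + q : ℤ × ℤ)).1 : ℚ), (((p + q : ℤ × ℤ)).2 : ℚ)] : Fin 2 → ℚ)
        = ![(p.1 : ℚ), (p.2 : ℚ)] + ![(q.1 : ℚ), (q.2 : ℚ)] := by
      funext j; fin_cases j <;> simp [Prod.fst_add, Prod.snd_add]
    rw [h, Matrix.mulVec_add, Pi.add_apply, hm, hn]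
    push_cast; ring
  neg_mem' := by
    intro p hp i
    obtain ⟨m, hm⟩ := hp i
    refine ⟨-m, ?_⟩
    have h : (![(((-p : ℤ × ℤ)).1 : ℚ), (((-p : ℤ × ℤ)).2 : ℚ)] : Fin 2 → ℚ)
        = -![(p.1 : ℚ), (p.2 : ℚ)] := by
      funext j; fin_cases j <;> simp [Prod.fst_neg, Prod.snd_neg]
    rw [h, Matrix.mulVec_neg, Pi.neg_apply, hm]
    push_cast; ring

open MvPolynomial in
theorem aux_compForm_comp (F : MvPolynomial (Fin 2) ℚ) (γ δ : Matrix (Fin 2) (Fin 2) ℚ) :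
    compForm (compForm F γ) δ = compForm F (γ * δ) := by
  unfold compForm
  rw [← AlgHom.comp_apply, MvPolynomial.comp_aeval]
  congr 2
  funext i
  simp [Matrix.mul_apply, Fin.sum_univ_two, algebraMap_eq]
  ring

/-- Chain rule for a derivation applied to a polynomial expression. -/
theorem aux_chain {A : Type*} [CommRing A] [Algebra ℚ A] (D : Derivation ℚ A A)
    (g : Fin 2 → A) (F : MvPolynomial (Fin 2) ℚ) :
    D (MvPolynomial.aeval g F) =
      ∑ i, MvPolynomial.aeval g (MvPolynomial.pderiv i F) * D (g i) := by
  induction F using MvPolynomial.induction_on with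
  | C a => simp
  | add p q hp hq => simp [hp, hq, Fin.sum_univ_two]; ring
  | mul_X p j hp =>
    rw [map_mul, Derivation.leibniz, hp]
    fin_cases j <;> simp [Fin.sum_univ_two, MvPolynomial.pderiv_X] <;> ring

theorem aux_scale {A : Type*} [CommRing A] [Algebra ℚ A] {F : MvPolynomial (Fin 2) ℚ} {n : ℕ}
    (hF : F.IsHomogeneous n) (c : A) (v : Fin 2 → A) :
    MvPolynomial.aeval (fun i => c * v i) F = c ^ n * MvPolynomial.aeval v F := by
  rw [MvPolynomial.aeval_def, MvPolynomial.aeval_def, MvPolynomial.eval₂_eq',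
    MvPolynomial.eval₂_eq', Finset.mul_sum]
  refine Finset.sum_congr rfl fun m hm => ?_
  have h := hF (MvPolynomial.mem_support_iff.1 hm)
  simp [Finsupp.weight_apply, Finsupp.sum_fintype, Fin.sum_univ_two] at h
  simp only [Fin.prod_univ_two, mul_pow, ← h, pow_add]
  ring

open Polynomial in
theorem aux_dehom_squarefree {d : ℕ} {F : MvPolynomial (Fin 2) ℚ} (hF : F.IsHomogeneous d)
    (hs : Squarefree F) : Squarefree (MvPolynomial.aeval ![(X : ℚ[X]), 1] F) := by
  set f := MvPolynomial.aeval ![(X : ℚ[X]), 1] F with hf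
  have hFf : f.homogenize d = F := homogenize_eq_of_isHomogeneous hF rfl
  have hf0 : f ≠ 0 := by
    intro h
    rw [h, homogenize_zero] at hFf
    exact hs.ne_zero hFf.symm
  have hdeg : f.natDegree ≤ d := by
    rw [hf, MvPolynomial.aeval_def, MvPolynomial.eval₂_eq']
    refine natDegree_sum_le_of_forall_le _ _ fun m hm => ?_
    have h := hF (MvPolynomial.mem_support_iff.1 hm)
    simp [Finsupp.weight_apply, Finsupp.sum_fintype, Fin.sum_univ_two] at h
    simp only [Fin.prod_univ_two]
    simp
    refine (natDegree_C_mul_X_pow_le _ _).trans (by omega)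
  rintro p ⟨r, hr⟩
  have hp0 : p ≠ 0 := by rintro rfl; simp at hr; exact hf0 hr
  have hr0 : r ≠ 0 := by rintro rfl; simp at hr; exact hf0 hr
  have hn : f.natDegree = p.natDegree + p.natDegree + r.natDegree := by
    rw [hr, natDegree_mul (mul_ne_zero hp0 hp0) hr0, natDegree_mul hp0 hp0]
  obtain ⟨k, hk⟩ := Nat.exists_eq_add_of_le (show p.natDegree + p.natDegree ≤ d by omega)
  have hdvd : p.homogenize p.natDegree * p.homogenize p.natDegree ∣ F := by
    rw [← hFf, hr, hk, homogenize_mul _ _ (natDegree_mul_le) (by omega),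
      homogenize_mul _ _ le_rfl le_rfl]
    exact dvd_mul_right _ _
  have hu := (hs _ hdvd).map (MvPolynomial.aeval ![(X : ℚ[X]), 1])
  rwa [aeval_homogenize_X_one _ le_rfl] at hu

open Polynomial in
theorem aux_smooth_affine {d : ℕ} {F : MvPolynomial (Fin 2) ℚ} (hF : F.IsHomogeneous d)
    (hs : Squarefree F) (v : Fin 2 → ℂ) (hv : v 1 ≠ 0) (h0 : MvPolynomial.aeval v F = 0)
    (h1 : MvPolynomial.aeval v (MvPolynomial.pderiv 0 F) = 0) : False := by
  have hsep := PerfectField.separable_iff_squarefree.2 (aux_dehom_squarefree hF hs)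
  have hv' : v = fun i => v 1 * (![v 0 / v 1, 1] : Fin 2 → ℂ) i := by
    funext i; fin_cases i <;> simp; field_simp
  have key : ∀ G : MvPolynomial (Fin 2) ℚ, aeval (v 0 / v 1)
      (MvPolynomial.aeval ![(X : ℚ[X]), 1] G) = MvPolynomial.aeval ![v 0 / v 1, 1] G := by
    intro G
    rw [← AlgHom.comp_apply, MvPolynomial.comp_aeval]
    congr 2
    funext i; fin_cases i <;> simp
  rw [hv', aux_scale hF] at h0
  rw [hv', aux_scale hF.pderiv] at h1
  have h0' := (mul_eq_zero.1 h0).resolve_left (pow_ne_zero _ hv)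
  have h1' := (mul_eq_zero.1 h1).resolve_left (pow_ne_zero _ hv)
  obtain ⟨a, b, hab⟩ := hsep
  have hch := aux_chain (derivative' (R := ℚ)) ![(X : ℚ[X]), 1] F
  simp [Fin.sum_univ_two] at hch
  rw [hch] at hab
  have := congrArg (aeval (v 0 / v 1)) hab
  simp [key, h0', h1'] at this

theorem aux_smooth {d : ℕ} (hd : d ≠ 0) {F : MvPolynomial (Fin 2) ℚ} (hF : F.IsHomogeneous d)
    (hs : Squarefree F) (v : Fin 2 → ℂ) (hv : v ≠ 0)
    (h : ∀ i, MvPolynomial.aeval v (MvPolynomial.pderiv i F) = 0) : False := by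
  have h0 : MvPolynomial.aeval v F = 0 := by
    have := congrArg (MvPolynomial.aeval v) hF.sum_X_mul_pderiv
    simp [Fin.sum_univ_two, h, hd] at this
    exact this
  by_cases h1 : v 1 = 0
  · have hv0 : v 0 ≠ 0 := by
      intro h2; apply hv; funext i; fin_cases i <;> simp [h1, h2]
    let e := Equiv.swap (0 : Fin 2) 1
    have hc : (v ∘ e) ∘ e = v := by funext i; simp [e]
    refine aux_smooth_affine (F := MvPolynomial.rename e F) (hF.rename_isHomogeneous)
      ?_ (v ∘ e) (by simpa [e] using hv0) ?_ ?_
    · rintro p ⟨r, hr⟩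
      let φ := MvPolynomial.renameEquiv ℚ e
      have hr' : F = φ.symm p * φ.symm p * φ.symm r := by
        rw [← map_mul, ← map_mul, ← hr]
        exact (φ.symm_apply_apply F).symm
      have hu := (hs _ ⟨_, hr'⟩).map φ
      rwa [AlgEquiv.apply_symm_apply] at hu
    · rw [MvPolynomial.aeval_rename, hc, h0]
    · have := MvPolynomial.pderiv_rename e.injective 1 F
      rw [show e 1 = 0 by simp [e]] at this
      rw [this, MvPolynomial.aeval_rename, hc, h]
  · exact aux_smooth_affine hF hs v h1 h0 (h 0)

theorem aux_eigen {d : ℕ} (hd : 3 ≤ d) {F : MvPolynomial (Fin 2) ℚ} (hF : F.IsHomogeneous d)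
    (hs : Squarefree F) (σ : Matrix (Fin 2) (Fin 2) ℚ) (hσ : compForm F σ = F)
    (l m : ℂ) (hadd : l + m = σ 0 0 + σ 1 1) (hmul : l * m = σ.det) :
    l ^ d = 1 ∨ l ^ (d - 1) * m = 1 := by
  rw [Matrix.det_fin_two] at hmul
  push_cast at hmul
  let M : Matrix (Fin 2) (Fin 2) ℂ := !![σ 0 0 - l, σ 0 1; σ 1 0, σ 1 1 - l]
  have hM : M.det = 0 := by
    simp only [M, Matrix.det_fin_two_of]
    linear_combination l * hadd - hmul
  obtain ⟨v, hv, hMv⟩ := Matrix.exists_mulVec_eq_zero_iff.2 hM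
  have e0 := congrFun hMv 0
  have e1 := congrFun hMv 1
  simp [M, Matrix.mulVec, dotProduct, Fin.sum_univ_two] at e0 e1
  have hg : ∀ G : MvPolynomial (Fin 2) ℚ, ∀ n, G.IsHomogeneous n →
      MvPolynomial.aeval v (compForm G σ) = l ^ n * MvPolynomial.aeval v G := by
    intro G n hG
    rw [← aux_scale hG, compForm, ← AlgHom.comp_apply, MvPolynomial.comp_aeval]
    congr 2
    funext i
    fin_cases i <;> simp
    · linear_combination e0
    · linear_combination e1
  let u : Fin 2 → ℂ := fun i => MvPolynomial.aeval v (MvPolynomial.pderiv i F)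
  have hu : u ≠ 0 := fun h => aux_smooth (by omega) hF hs v hv (fun i => congrFun h i)
  have hch : ∀ j, u j = l ^ (d - 1) * (u 0 * σ 0 j + u 1 * σ 1 j) := by
    intro j
    have h := aux_chain (MvPolynomial.pderiv j)
      (fun i => MvPolynomial.C (σ i 0) * MvPolynomial.X 0
        + MvPolynomial.C (σ i 1) * MvPolynomial.X 1) F
    change MvPolynomial.pderiv j (compForm F σ) =
      ∑ i, compForm (MvPolynomial.pderiv i F) σ * _ at h
    rw [hσ] at h
    have h2 := congrArg (MvPolynomial.aeval v) h
    rw [Fin.sum_univ_two, map_add, map_mul, map_mul, hg _ _ hF.pderiv, hg _ _ hF.pderiv] at h2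
    simp only [u]
    rw [h2]
    fin_cases j <;> simp [MvPolynomial.pderiv_X] <;> ring
  let N : Matrix (Fin 2) (Fin 2) ℂ := !![l ^ (d - 1) * σ 0 0 - 1, l ^ (d - 1) * σ 0 1;
    l ^ (d - 1) * σ 1 0, l ^ (d - 1) * σ 1 1 - 1]
  have hN : N.det = 0 := by
    refine Matrix.exists_vecMul_eq_zero_iff.1 ⟨u, hu, ?_⟩
    funext j
    have := hch j
    fin_cases j <;> simp [N, Matrix.vecMul, dotProduct, Fin.sum_univ_two] at this ⊢ <;>
      linear_combination -this
  simp only [N, Matrix.det_fin_two_of] at hN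
  have hld : l ^ d = l ^ (d - 1) * l := by rw [← pow_succ]; congr 1; omega
  have : (l ^ d - 1) * (l ^ (d - 1) * m - 1) = 0 := by
    rw [hld]
    linear_combination hN + (l ^ (d - 1)) ^ 2 * hmul - l ^ (d - 1) * hadd
  rcases mul_eq_zero.1 this with h | h
  · exact Or.inl (sub_eq_zero.1 h)
  · exact Or.inr (sub_eq_zero.1 h)

theorem aux_det {d : ℕ} (hd : 3 ≤ d) {F : MvPolynomial (Fin 2) ℚ} (hF : F.IsHomogeneous d)
    (hs : Squarefree F) (σ : Matrix (Fin 2) (Fin 2) ℚ) (hσ : compForm F σ = F) :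
    σ.det = 1 ∨ σ.det = -1 := by
  obtain ⟨l, hl⟩ : ∃ l : ℂ, l ^ 2 - (σ 0 0 + σ 1 1) * l + σ.det = 0 := by
    obtain ⟨s, hs⟩ := IsAlgClosed.exists_pow_nat_eq
      (((σ 0 0 : ℂ) + σ 1 1) ^ 2 - 4 * (σ.det : ℂ)) (n := 2) (by norm_num)
    refine ⟨((σ 0 0 : ℂ) + σ 1 1 + s) / 2, ?_⟩
    linear_combination hs / 4
  set m : ℂ := σ 0 0 + σ 1 1 - l with hm
  have hadd : l + m = σ 0 0 + σ 1 1 := by rw [hm]; ring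
  have hmul : l * m = σ.det := by rw [hm]; linear_combination -hl
  have h1 := aux_eigen hd hF hs σ hσ l m hadd hmul
  have h2 := aux_eigen hd hF hs σ hσ m l (by rw [add_comm, hadd]) (by rw [mul_comm, hmul])
  obtain ⟨k, rfl⟩ : ∃ k, d = k + 1 := ⟨d - 1, by omega⟩
  simp only [Nat.add_sub_cancel] at h1 h2
  have key : (l * m) ^ ((k + 1) * k) = 1 := by
    rcases h1 with h1 | h1 <;> rcases h2 with h2 | h2
    · rw [pow_mul, mul_pow, h1, h2]; simp
    · have : m ^ (k * (k + 1)) = 1 := by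
        have := congrArg (· ^ (k + 1)) h2
        simpa [mul_pow, h1, ← pow_mul] using this
      rw [mul_pow, pow_mul, h1, mul_comm (k + 1), this]; simp
    · have : l ^ (k * (k + 1)) = 1 := by
        have := congrArg (· ^ (k + 1)) h1
        simpa [mul_pow, h2, ← pow_mul] using this
      rw [mul_pow, pow_mul m, h2, mul_comm (k + 1), this]; simp
    · have : (l * m) ^ (k + 1) = 1 := by
        rw [mul_pow, pow_succ, pow_succ]
        linear_combination h2 * (l ^ k * m) + h1
      rw [pow_mul, this, one_pow]
  rw [hmul] at key
  have key' : σ.det ^ ((k + 1) * k) = 1 := by exact_mod_cast key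
  rcases pow_eq_one_iff_cases.1 key' with h | h | h
  · rcases Nat.mul_eq_zero.1 h with h | h <;> omega
  · exact Or.inl h
  · exact Or.inr h.1

theorem aux_integral (γ : Matrix (Fin 2) (Fin 2) ℚ) (h : latticeOfMatrix γ = ⊤) :
    ∃ a b c e : ℤ, γ = !![(a : ℚ), (b : ℚ); (c : ℚ), (e : ℚ)] := by
  have h1 : ((1, 0) : ℤ × ℤ) ∈ latticeOfMatrix γ := by rw [h]; trivial
  have h2 : ((0, 1) : ℤ × ℤ) ∈ latticeOfMatrix γ := by rw [h]; trivial
  obtain ⟨a, ha⟩ := h1 0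
  obtain ⟨c, hc⟩ := h1 1
  obtain ⟨b, hb⟩ := h2 0
  obtain ⟨e, he⟩ := h2 1
  simp [Matrix.mulVec, dotProduct, Fin.sum_univ_two] at ha hb hc he
  refine ⟨a, b, c, e, ?_⟩
  ext i j
  fin_cases i <;> fin_cases j <;> simp [*]

theorem aux_index (γ : Matrix (Fin 2) (Fin 2) ℚ) : (latticeOfMatrix γ).index ≠ 0 := by
  let N : ℤ := (γ 0 0).den * (γ 0 1).den * ((γ 1 0).den * (γ 1 1).den)
  have hN : N ≠ 0 := by simp [N]
  have hden : ∀ i j, ∃ k : ℤ, γ i j * N = k := by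
    intro i j
    have hd : ((γ i j).den : ℤ) ∣ N := by
      fin_cases i <;> fin_cases j <;> simp only [N]
      · exact (dvd_mul_right _ _).mul_right _
      · exact (dvd_mul_left _ _).mul_right _
      · exact (dvd_mul_right _ _).mul_left _
      · exact (dvd_mul_left _ _).mul_left _
    obtain ⟨k, hk⟩ := hd
    refine ⟨(γ i j).num * k, ?_⟩
    rw [hk]
    push_cast
    rw [← mul_assoc, Rat.mul_den_eq_num]
  have hle : (AddSubgroup.zmultiples N).prod (AddSubgroup.zmultiples N) ≤ latticeOfMatrix γ := by
    rintro ⟨x, y⟩ hxy i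
    obtain ⟨hx, hy⟩ := AddSubgroup.mem_prod.1 hxy
    obtain ⟨s, rfl⟩ := Int.mem_zmultiples_iff.1 hx
    obtain ⟨t, rfl⟩ := Int.mem_zmultiples_iff.1 hy
    obtain ⟨k, hk⟩ := hden i 0
    obtain ⟨k', hk'⟩ := hden i 1
    refine ⟨k * s + k' * t, ?_⟩
    simp [Matrix.mulVec, dotProduct, Fin.sum_univ_two, ← hk, ← hk']
    ring
  have hne : ((AddSubgroup.zmultiples N).prod (AddSubgroup.zmultiples N)).index ≠ 0 := by
    rw [AddSubgroup.index_prod, Int.index_zmultiples]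
    simpa using hN
  intro h0
  exact hne (Nat.eq_zero_of_zero_dvd (h0 ▸ AddSubgroup.index_dvd_of_le hle))

/-- Let `G₁, G₂ ∈ Bin(d, ℚ)` with `d ≥ 3`, let `γ ∈ GL(2,ℚ)` with `G₂ ∘ γ = G₁` and
with `[ℤ² : L(γ)]` minimal among all isomorphisms between `G₁` and `G₂` (in either
direction).  If some `σ ∈ Aut(G₂, ℚ)` is such that `γ⁻¹σ` has integer coefficients
(equivalently `L(γ⁻¹σ) = ℤ²`), then `G₁` and `G₂` are `GL(2,ℤ)`-equivalent. -/
theorem glz_equivalent_of_integral_isom (d : ℕ) (hd : 3 ≤ d)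
    (G₁ G₂ : MvPolynomial (Fin 2) ℚ) (hG₁ : IsBinForm d G₁) (hG₂ : IsBinForm d G₂)
    (γ : Matrix (Fin 2) (Fin 2) ℚ) (hγ : γ.det ≠ 0) (hγiso : compForm G₂ γ = G₁)
    (hmin : ∀ τ : Matrix (Fin 2) (Fin 2) ℚ, τ.det ≠ 0 →
      (compForm G₁ τ = G₂ ∨ compForm G₂ τ = G₁) →
      (latticeOfMatrix γ).index ≤ (latticeOfMatrix τ).index)
    (hσ : ∃ σ : Matrix (Fin 2) (Fin 2) ℚ, σ.det ≠ 0 ∧ compForm G₂ σ = G₂ ∧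
      latticeOfMatrix (γ⁻¹ * σ) = ⊤) :
    ∃ a b c e : ℤ, (a * e - b * c = 1 ∨ a * e - b * c = -1) ∧
      compForm G₁ !![(a : ℚ), (b : ℚ); (c : ℚ), (e : ℚ)] = G₂ := by
  obtain ⟨σ, hσ0, hσ, hL⟩ := hσ
  have hγu : IsUnit γ.det := isUnit_iff_ne_zero.2 hγ
  have hγτ : γ * (γ⁻¹ * σ) = σ := Matrix.mul_nonsing_inv_cancel_left γ σ hγu
  have hτ : compForm G₁ (γ⁻¹ * σ) = G₂ := by
    rw [← hγiso, aux_compForm_comp, hγτ, hσ]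
  generalize γ⁻¹ * σ = τ at *
  have hdet : γ.det * τ.det = σ.det := by rw [← Matrix.det_mul, hγτ]
  have hτ0 : τ.det ≠ 0 := by
    intro h; rw [h, mul_zero] at hdet; exact hσ0 hdet.symm
  have hle := hmin τ hτ0 (Or.inl hτ)
  rw [hL, AddSubgroup.index_top] at hle
  have hγL : latticeOfMatrix γ = ⊤ := by
    have := aux_index γ
    exact AddSubgroup.index_eq_one.1 (by omega)
  obtain ⟨a, b, c, e, rfl⟩ := aux_integral τ hL
  obtain ⟨a', b', c', e', rfl⟩ := aux_integral γ hγL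
  refine ⟨a, b, c, e, ?_, hτ⟩
  have hd1 := aux_det hd hG₂.1 hG₂.2 σ hσ
  rw [← hdet] at hd1
  simp only [Matrix.det_fin_two_of] at hd1
  have hd2 : (a' * e' - b' * c') * (a * e - b * c) = 1 ∨
      (a' * e' - b' * c') * (a * e - b * c) = -1 := by exact_mod_cast hd1
  apply Int.isUnit_iff.1
  refine isUnit_of_mul_isUnit_right (x := a' * e' - b' * c') ?_
  exact Int.isUnit_iff.2 hd2
end

section
/- Let D and ν be positive integers, let γ := [[D,0],[0,D/ν]] ∈ GL(2,ℚ), let t₁,t₂,t₃,t₄ be integers with d₂ := |t₁t₄ − t₂t₃| ≠ 0, and set T₂ := [[t₁,t₂],[t₃,t₄]], A₁ := [[0,1],[-1,0]], A₂ := [[0,1],[1,0]], A₃ := [[1,0],[0,-1]]. Then: L(γ⁻¹) = Λ₀, L(γ⁻¹T₂⁻¹A₁T₂) = Λ₁, L(γ⁻¹T₂⁻¹A₂T₂) = Λ₂, and L(γ⁻¹T₂⁻¹A₃T₂) = Λ₃, where Λ₀ := {(x₁,x₂) ∈ ℤ² : x₁ ≡ 0 (mod D) and νx₂ ≡ 0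 (mod D)}; Λ₁ := {(x₁,x₂) ∈ ℤ² : (t₁t₂+t₃t₄)x₁ + (t₂²+t₄²)x₂ ≡ 0 (mod d₂D) and ν((t₁²+t₃²)x₁ + (t₁t₂+t₃t₄)x₂) ≡ 0 (mod d₂D)}; Λ₂ := {(x₁,x₂) ∈ ℤ² : (t₃t₄−t₁t₂)x₁ + (t₄²−t₂²)x₂ ≡ 0 (mod d₂D) and ν((t₁²−t₃²)x₁ + (t₁t₂−t₃t₄)x₂) ≡ 0 (mod d₂D)}; Λ₃ := {(x₁,x₂) ∈ ℤ² : (t₂t₃+t₁t₄)x₁ + 2t₂t₄x₂ ≡ 0 (mod d₂D) and ν(2t₁t₃x₁ + (t₂t₃+t₁t₄)x₂) ≡ 0 (mod d₂D)}. -/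
theorem row_int_iff (n k a b x y : ℤ) (hn : n ≠ 0) (hk : |n| = |k|) :
    (∃ z : ℤ, (a : ℚ) / n * x + (b : ℚ) / n * y = z) ↔ k ∣ a * x + b * y := by
  have hn' : (n : ℚ) ≠ 0 := by exact_mod_cast hn
  rw [← abs_dvd, ← hk, abs_dvd]
  constructor
  · rintro ⟨z, hz⟩
    refine ⟨z, ?_⟩
    field_simp at hz
    exact_mod_cast hz
  · rintro ⟨z, hz⟩
    refine ⟨z, ?_⟩
    field_simp
    exact_mod_cast hz

theorem lattice_eq_aux (M : Matrix (Fin 2) (Fin 2) ℚ) (n m k a b c e : ℤ)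
    (hn : n ≠ 0) (hm : m ≠ 0) (hnk : |n| = |k|) (hmk : |m| = |k|)
    (hM : M = !![(a : ℚ) / n, (b : ℚ) / n; (c : ℚ) / m, (e : ℚ) / m]) :
    latticeOfMatrix M = congLat a b k ⊓ congLat c e k := by
  ext p
  rw [AddSubgroup.mem_inf]
  change (∀ i, ∃ z : ℤ, M.mulVec ![(p.1 : ℚ), (p.2 : ℚ)] i = z) ↔
    (k ∣ a * p.1 + b * p.2) ∧ (k ∣ c * p.1 + e * p.2)
  rw [← row_int_iff n k a b _ _ hn hnk, ← row_int_iff m k c e _ _ hm hmk, hM, Fin.forall_fin_two]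
  simp [Matrix.mulVec, dotProduct, Fin.sum_univ_two]

theorem inv_gamma (D ν : ℚ) (hD : D ≠ 0) (hν : ν ≠ 0) :
    (!![D, 0; 0, D / ν])⁻¹ = !![1 / D, 0; 0, ν / D] := by
  apply Matrix.inv_eq_right_inv
  ext i j
  fin_cases i <;> fin_cases j <;> simp [Matrix.mul_apply, Fin.sum_univ_two] <;> field_simp

theorem inv_T (a b c d : ℚ) (h : a * d - b * c ≠ 0) :
    (!![a, b; c, d])⁻¹ = !![d / (a * d - b * c), -b / (a * d - b * c);
      -c / (a * d - b * c), a / (a * d - b * c)] := by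
  obtain ⟨e, he⟩ : ∃ e, e = a * d - b * c := ⟨_, rfl⟩
  rw [← he] at h ⊢
  apply Matrix.inv_eq_right_inv
  ext i j
  fin_cases i <;> fin_cases j <;> simp [Matrix.mul_apply, Fin.sum_univ_two] <;> field_simp <;> linarith

/-- Explicit congruence equations for the lattices `L(γ⁻¹σ)`, where
`γ = [[D,0],[0,D/ν]]` and `σ` runs over `id, T₂⁻¹A₁T₂, T₂⁻¹A₂T₂, T₂⁻¹A₃T₂` with
`T₂ = [[t₁,t₂],[t₃,t₄]]`, `d₂ = |t₁t₄ - t₂t₃| ≠ 0`. -/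
theorem latticeOfMatrix_eq_congLat (D ν : ℤ) (hD : 0 < D) (hν : 0 < ν)
    (t1 t2 t3 t4 : ℤ) (hd2 : t1 * t4 - t2 * t3 ≠ 0) :
    latticeOfMatrix (!![(D : ℚ), 0; 0, (D : ℚ) / (ν : ℚ)])⁻¹
        = congLat 1 0 D ⊓ congLat 0 ν D ∧
    latticeOfMatrix ((!![(D : ℚ), 0; 0, (D : ℚ) / (ν : ℚ)])⁻¹
        * (!![(t1 : ℚ), (t2 : ℚ); (t3 : ℚ), (t4 : ℚ)])⁻¹ * !![0, 1; -1, 0]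
        * !![(t1 : ℚ), (t2 : ℚ); (t3 : ℚ), (t4 : ℚ)])
      = congLat (t1 * t2 + t3 * t4) (t2 ^ 2 + t4 ^ 2) (|t1 * t4 - t2 * t3| * D) ⊓
        congLat (ν * (t1 ^ 2 + t3 ^ 2)) (ν * (t1 * t2 + t3 * t4))
          (|t1 * t4 - t2 * t3| * D) ∧
    latticeOfMatrix ((!![(D : ℚ), 0; 0, (D : ℚ) / (ν : ℚ)])⁻¹
        * (!![(t1 : ℚ), (t2 : ℚ); (t3 : ℚ), (t4 : ℚ)])⁻¹ * !![0, 1; 1, 0]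
        * !![(t1 : ℚ), (t2 : ℚ); (t3 : ℚ), (t4 : ℚ)])
      = congLat (t3 * t4 - t1 * t2) (t4 ^ 2 - t2 ^ 2) (|t1 * t4 - t2 * t3| * D) ⊓
        congLat (ν * (t1 ^ 2 - t3 ^ 2)) (ν * (t1 * t2 - t3 * t4))
          (|t1 * t4 - t2 * t3| * D) ∧
    latticeOfMatrix ((!![(D : ℚ), 0; 0, (D : ℚ) / (ν : ℚ)])⁻¹
        * (!![(t1 : ℚ), (t2 : ℚ); (t3 : ℚ), (t4 : ℚ)])⁻¹ * !![1, 0; 0, -1]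
        * !![(t1 : ℚ), (t2 : ℚ); (t3 : ℚ), (t4 : ℚ)])
      = congLat (t2 * t3 + t1 * t4) (2 * t2 * t4) (|t1 * t4 - t2 * t3| * D) ⊓
        congLat (ν * (2 * t1 * t3)) (ν * (t2 * t3 + t1 * t4))
          (|t1 * t4 - t2 * t3| * D) := by
  have hDq : (D : ℚ) ≠ 0 := by exact_mod_cast hD.ne'
  have hνq : (ν : ℚ) ≠ 0 := by exact_mod_cast hν.ne'
  have hdq : (t1 : ℚ) * t4 - t2 * t3 ≠ 0 := by exact_mod_cast hd2
  have hn : (t1 * t4 - t2 * t3) * D ≠ 0 := mul_ne_zero hd2 hD.ne'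
  refine ⟨?_, ?_, ?_, ?_⟩
  · refine lattice_eq_aux _ D D _ _ _ _ _ hD.ne' hD.ne' rfl rfl ?_
    rw [inv_gamma _ _ hDq hνq]
    simp
  · refine lattice_eq_aux _ ((t1 * t4 - t2 * t3) * D) (-((t1 * t4 - t2 * t3) * D)) _ _ _ _ _ hn (by simpa using hn)
      (by simp [abs_mul]) (by simp [abs_mul]) ?_
    rw [inv_gamma _ _ hDq hνq, inv_T _ _ _ _ hdq]
    push_cast
    ext i j
    fin_cases i <;> fin_cases j <;> simp [Matrix.mul_apply, Fin.sum_univ_two] <;> field_simp <;> ring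
  · refine lattice_eq_aux _ ((t1 * t4 - t2 * t3) * D) ((t1 * t4 - t2 * t3) * D) _ _ _ _ _ hn (by simpa using hn)
      (by simp [abs_mul]) (by simp [abs_mul]) ?_
    rw [inv_gamma _ _ hDq hνq, inv_T _ _ _ _ hdq]
    push_cast
    ext i j
    fin_cases i <;> fin_cases j <;> simp [Matrix.mul_apply, Fin.sum_univ_two] <;> field_simp <;> ring
  · refine lattice_eq_aux _ ((t1 * t4 - t2 * t3) * D) (-((t1 * t4 - t2 * t3) * D)) _ _ _ _ _ hn (by simpa using hn)
      (by simp [abs_mul]) (by simp [abs_mul]) ?_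
    rw [inv_gamma _ _ hDq hνq, inv_T _ _ _ _ hdq]
    push_cast
    ext i j
    fin_cases i <;> fin_cases j <;> simp [Matrix.mul_apply, Fin.sum_univ_two] <;> field_simp <;> ring
end

section
/- Let D and ν be positive integers with D | ν, 1 ≤ ν ≤ D², and Dν > 1, and let t₁,t₂,t₃,t₄ be integers with gcd(t₁,t₂,t₃,t₄) = 1 and d₂ := |t₁t₄ − t₂t₃| ≠ 0. Define the four subgroups of ℤ²: Λ₀ := {(x₁,x₂) : x₁ ≡ 0 (mod D) and νx₂ ≡ 0 (mod D)}; Λ₁ := {(x₁,x₂) : (t₁t₂+t₃t₄)x₁ + (t₂²+t₄²)x₂ ≡ 0 (mod d₂D) and ν((t₁²+t₃²)x₁ + (t₁t₂+t₃t₄)x₂) ≡ 0 (mod d₂D)}; Λ₂ := {(x₁,x₂) : (t₃t₄−t₁t₂)x₁ + (t₄²−t₂²)x₂ ≡ 0 (mod d₂D) and ν((t₁²−t₃²)x₁ + (t₁t₂−t₃t₄)x₂) ≡ 0 (mod d₂D)}; Λ₃ := {(x₁,x₂) : (t₂t₃+t₁t₄)x₁ + 2t₂t₄x₂ ≡ 0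 (mod d₂D) and ν(2t₁t₃x₁ + (t₂t₃+t₁t₄)x₂) ≡ 0 (mod d₂D)}. If Λ₀ ∪ Λ₁ ∪ Λ₂ ∪ Λ₃ = ℤ² and Λᵢ ≠ ℤ² for all i ∈ {0,1,2,3}, then 2 ≤ D ≤ 4. -/
/-- `Λ₀ = {(x₁,x₂) : x₁ ≡ 0 (mod D), ν·x₂ ≡ 0 (mod D)}`. -/
def Lam0 (D ν : ℤ) : AddSubgroup (ℤ × ℤ) := congLat 1 0 D ⊓ congLat 0 ν D

/-- `Λ₁`, cut out by `(t₁t₂+t₃t₄)x₁ + (t₂²+t₄²)x₂ ≡ 0` and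
`ν((t₁²+t₃²)x₁ + (t₁t₂+t₃t₄)x₂) ≡ 0 (mod d₂D)`, where `d₂ = |t₁t₄ - t₂t₃|`. -/
def Lam1 (D ν t1 t2 t3 t4 : ℤ) : AddSubgroup (ℤ × ℤ) :=
  congLat (t1 * t2 + t3 * t4) (t2 ^ 2 + t4 ^ 2) (|t1 * t4 - t2 * t3| * D) ⊓
    congLat (ν * (t1 ^ 2 + t3 ^ 2)) (ν * (t1 * t2 + t3 * t4)) (|t1 * t4 - t2 * t3| * D)

/-- `Λ₂`, cut out by `(t₃t₄-t₁t₂)x₁ + (t₄²-t₂²)x₂ ≡ 0` and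
`ν((t₁²-t₃²)x₁ + (t₁t₂-t₃t₄)x₂) ≡ 0 (mod d₂D)`. -/
def Lam2 (D ν t1 t2 t3 t4 : ℤ) : AddSubgroup (ℤ × ℤ) :=
  congLat (t3 * t4 - t1 * t2) (t4 ^ 2 - t2 ^ 2) (|t1 * t4 - t2 * t3| * D) ⊓
    congLat (ν * (t1 ^ 2 - t3 ^ 2)) (ν * (t1 * t2 - t3 * t4)) (|t1 * t4 - t2 * t3| * D)

/-- `Λ₃`, cut out by `(t₂t₃+t₁t₄)x₁ + 2t₂t₄x₂ ≡ 0` and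
`ν(2t₁t₃x₁ + (t₂t₃+t₁t₄)x₂) ≡ 0 (mod d₂D)`. -/
def Lam3 (D ν t1 t2 t3 t4 : ℤ) : AddSubgroup (ℤ × ℤ) :=
  congLat (t2 * t3 + t1 * t4) (2 * t2 * t4) (|t1 * t4 - t2 * t3| * D) ⊓
    congLat (ν * (2 * t1 * t3)) (ν * (t2 * t3 + t1 * t4)) (|t1 * t4 - t2 * t3| * D)

theorem aux_facts (A : AddSubgroup (ℤ × ℤ)) (y u : ℤ × ℤ) (hy : y ∉ A) :
    (¬ (y + u ∈ A ∧ y + (2:ℤ) • u ∈ A)) ∧ (¬ (y + (2:ℤ) • u ∈ A ∧ y + (3:ℤ) • u ∈ A)) ∧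
    (¬ (y + (3:ℤ) • u ∈ A ∧ y + (4:ℤ) • u ∈ A)) ∧
    (¬ (y + (2:ℤ) • u ∈ A ∧ y + (4:ℤ) • u ∈ A)) ∧
    (u ∈ A → y + u ∉ A ∧ y + (2:ℤ) • u ∉ A ∧ y + (3:ℤ) • u ∉ A ∧ y + (4:ℤ) • u ∉ A) := by
  have key : ∀ (a b : ℤ) (p q : ℤ × ℤ), p ∈ A → q ∈ A → y = a • p + b • q → False := by
    intro a b p q hp hq h
    exact hy (h ▸ A.add_mem (A.zsmul_mem hp a) (A.zsmul_mem hq b))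
  refine ⟨fun h => key 2 (-1) _ _ h.1 h.2 (by module),
    fun h => key 3 (-2) _ _ h.1 h.2 (by module),
    fun h => key 4 (-3) _ _ h.1 h.2 (by module),
    fun h => key 2 (-1) _ _ h.1 h.2 (by module),
    fun hu => ⟨fun h => key 1 (-1) _ _ h hu (by module),
      fun h => key 1 (-2) _ _ h hu (by module),
      fun h => key 1 (-3) _ _ h hu (by module),
      fun h => key 1 (-4) _ _ h hu (by module)⟩⟩

theorem aux_drop (A B C : AddSubgroup (ℤ × ℤ)) (y u : ℤ × ℤ)
    (hu : u ∈ A ∨ u ∈ B ∨ u ∈ C)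
    (h1 : y + u ∈ A ∨ y + u ∈ B ∨ y + u ∈ C)
    (h2 : y + (2:ℤ) • u ∈ A ∨ y + (2:ℤ) • u ∈ B ∨ y + (2:ℤ) • u ∈ C)
    (h3 : y + (3:ℤ) • u ∈ A ∨ y + (3:ℤ) • u ∈ B ∨ y + (3:ℤ) • u ∈ C)
    (h4 : y + (4:ℤ) • u ∈ A ∨ y + (4:ℤ) • u ∈ B ∨ y + (4:ℤ) • u ∈ C) :
    y ∈ A ∨ y ∈ B ∨ y ∈ C := by
  by_contra hn
  have hA := aux_facts A y u (fun h => hn (Or.inl h))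
  have hB := aux_facts B y u (fun h => hn (Or.inr (Or.inl h)))
  have hC := aux_facts C y u (fun h => hn (Or.inr (Or.inr h)))
  clear hn
  grind

theorem aux_two (B C : AddSubgroup (ℤ × ℤ)) (hB : B ≠ ⊤) (hC : C ≠ ⊤) :
    ∃ a, a ∉ B ∧ a ∉ C := by
  obtain ⟨p, hp⟩ : ∃ p, p ∉ B := by
    by_contra! h
    exact hB ((AddSubgroup.eq_top_iff' B).2 h)
  obtain ⟨q, hq⟩ : ∃ q, q ∉ C := by
    by_contra! h
    exact hC ((AddSubgroup.eq_top_iff' C).2 h)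
  by_cases hpC : p ∈ C
  · by_cases hqB : q ∈ B
    · exact ⟨p + q, fun h => hp ((B.add_mem_cancel_right hqB).1 h),
        fun h => hq ((C.add_mem_cancel_left hpC).1 h)⟩
    · exact ⟨q, hqB, hq⟩
  · exact ⟨p, hp, hpC⟩

theorem aux_half (A B C : AddSubgroup (ℤ × ℤ)) (a x : ℤ × ℤ) (hB : a ∉ B) (hC : a ∉ C)
    (hx : x ∉ A) (hxB : x ∈ B) (h : ∀ p, p ∈ A ∨ p ∈ B ∨ p ∈ C) : x + x ∈ A := by
  have haA : a ∈ A := by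
    have := h a
    tauto
  have h1 : x + a ∈ C := by
    rcases h (x + a) with h' | h' | h'
    · exact absurd ((A.add_mem_cancel_right haA).1 h') hx
    · exact absurd ((B.add_mem_cancel_left hxB).1 h') hB
    · exact h'
  have h2 : x - a ∈ C := by
    rcases h (x - a) with h' | h' | h'
    · exact absurd (by simpa using A.add_mem h' haA) hx
    · exact absurd (by simpa using B.sub_mem hxB h') hB
    · exact h'
  have h3 : x + x ∈ C := by
    have := C.add_mem h1 h2
    have e : x + a + (x - a) = x + x := by abel
    rwa [e] at this
  rcases h (x + x + a) with h' | h' | h'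
  · exact (A.add_mem_cancel_right haA).1 h'
  · exact absurd ((B.add_mem_cancel_left (B.add_mem hxB hxB)).1 h') hB
  · exact absurd ((C.add_mem_cancel_left h3).1 h') hC

theorem aux_double (A B C : AddSubgroup (ℤ × ℤ)) (hB : B ≠ ⊤) (hC : C ≠ ⊤)
    (h : ∀ p, p ∈ A ∨ p ∈ B ∨ p ∈ C) (x : ℤ × ℤ) : x + x ∈ A := by
  obtain ⟨a, haB, haC⟩ := aux_two B C hB hC
  by_cases hx : x ∈ A
  · exact A.add_mem hx hx
  · rcases h x with h' | h' | h'
    · exact absurd h' hx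
    · exact aux_half A B C a x haB haC hx h' h
    · exact aux_half A C B a x haC haB hx h' (fun p => by have := h p; tauto)

theorem aux_mem (a b n : ℤ) (h : ((1, 0) + (1, 0) : ℤ × ℤ) ∈ congLat a b n) : n ∣ 2 * a := by
  have h' : n ∣ a * ((1, 0) + (1, 0) : ℤ × ℤ).1 + b * ((1, 0) + (1, 0) : ℤ × ℤ).2 := h
  simp at h'
  have e : 2 * a = a * (1 + 1) := by ring
  rw [e]; exact h'

theorem aux_arith (D t1 t2 t3 t4 : ℤ) (hd2 : t1 * t4 - t2 * t3 ≠ 0)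
    (h1 : |t1 * t4 - t2 * t3| * D ∣ 2 * (t1 * t2 + t3 * t4))
    (h2 : |t1 * t4 - t2 * t3| * D ∣ 2 * (t3 * t4 - t1 * t2))
    (h3 : |t1 * t4 - t2 * t3| * D ∣ 2 * (t2 * t3 + t1 * t4)) : D ≤ 2 := by
  set n := |t1 * t4 - t2 * t3| * D with hn
  have e1 : n ∣ 4 * (t3 * t4) := by
    have := dvd_add h1 h2
    ring_nf at this ⊢
    exact this
  have e2 : n ∣ 4 * (t1 * t2) := by
    have := dvd_sub h1 h2
    ring_nf at this ⊢
    exact this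
  have e3 := dvd_sub (mul_dvd_mul h3 h3) (mul_dvd_mul e1 e2)
  have e4 : n * n = (t1 * t4 - t2 * t3) ^ 2 * D ^ 2 := by
    rw [hn, ← sq_abs (t1 * t4 - t2 * t3)]; ring
  have e5 : 2 * (t2 * t3 + t1 * t4) * (2 * (t2 * t3 + t1 * t4))
      - 4 * (t3 * t4) * (4 * (t1 * t2)) = (t1 * t4 - t2 * t3) ^ 2 * 4 := by ring
  rw [e4, e5] at e3
  have e6 : D ^ 2 ∣ 4 := (mul_dvd_mul_iff_left (pow_ne_zero 2 hd2)).1 e3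
  have e7 := Int.le_of_dvd (by norm_num) e6
  nlinarith

theorem aux_not_mem (D ν : ℤ) (y : ℤ × ℤ) (k : ℤ) (h : y ∈ Lam0 D ν) (hk : 0 < k) (hkD : k < D) :
    y + k • ((1, 0) : ℤ × ℤ) ∉ Lam0 D ν := by
  intro h'
  have h2 : k • ((1, 0) : ℤ × ℤ) ∈ Lam0 D ν := ((Lam0 D ν).add_mem_cancel_left h).1 h'
  have h3 : D ∣ 1 * (k • ((1, 0) : ℤ × ℤ)).1 + 0 * (k • ((1, 0) : ℤ × ℤ)).2 := h2.1
  simp at h3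
  exact absurd (Int.le_of_dvd hk h3) (by omega)

/-- If the four lattices `Λ₀, Λ₁, Λ₂, Λ₃` cover ℤ² and none of them equals ℤ²,
then `2 ≤ D ≤ 4`. -/
theorem lattice_covering_stmt (D ν t1 t2 t3 t4 : ℤ)
    (hD : 0 < D) (hν : 0 < ν) (hdvd : D ∣ ν) (hle : ν ≤ D ^ 2) (hgt : 1 < D * ν)
    (hgcd : Int.gcd (Int.gcd (Int.gcd t1 t2) t3) t4 = 1)
    (hd2 : t1 * t4 - t2 * t3 ≠ 0)
    (hcover : ∀ p : ℤ × ℤ, p ∈ Lam0 D ν ∨ p ∈ Lam1 D ν t1 t2 t3 t4 ∨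
      p ∈ Lam2 D ν t1 t2 t3 t4 ∨ p ∈ Lam3 D ν t1 t2 t3 t4)
    (hproper : Lam0 D ν ≠ ⊤ ∧ Lam1 D ν t1 t2 t3 t4 ≠ ⊤ ∧
      Lam2 D ν t1 t2 t3 t4 ≠ ⊤ ∧ Lam3 D ν t1 t2 t3 t4 ≠ ⊤) :
    2 ≤ D ∧ D ≤ 4 := by
  obtain ⟨hp0, hp1, hp2, hp3⟩ := hproper
  constructor
  · by_contra hlt
    have hD1 : D = 1 := by omega
    subst hD1
    apply hp0
    rw [AddSubgroup.eq_top_iff']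
    intro p
    exact ⟨one_dvd _, one_dvd _⟩
  · by_contra hlt
    have hD5 : 5 ≤ D := by omega
    have hc : ∀ p : ℤ × ℤ, p ∈ Lam1 D ν t1 t2 t3 t4 ∨
        p ∈ Lam2 D ν t1 t2 t3 t4 ∨ p ∈ Lam3 D ν t1 t2 t3 t4 := by
      intro y
      rcases hcover y with hy | hy
      · have hk : ∀ z ∈ Lam0 D ν, ∀ k : ℤ, 0 < k → k < 5 →
            z + k • ((1, 0) : ℤ × ℤ) ∈ Lam1 D ν t1 t2 t3 t4 ∨
            z + k • ((1, 0) : ℤ × ℤ) ∈ Lam2 D ν t1 t2 t3 t4 ∨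
            z + k • ((1, 0) : ℤ × ℤ) ∈ Lam3 D ν t1 t2 t3 t4 := by
          intro z hz k hk hk5
          exact (hcover _).resolve_left (aux_not_mem D ν z k hz hk (by omega))
        have hu := hk 0 (Lam0 D ν).zero_mem 1 (by norm_num) (by norm_num)
        rw [zero_add, one_zsmul] at hu
        have h1 := hk y hy 1 (by norm_num) (by norm_num)
        rw [one_zsmul] at h1
        exact aux_drop _ _ _ y (1, 0) hu h1
          (hk y hy 2 (by norm_num) (by norm_num))
          (hk y hy 3 (by norm_num) (by norm_num))
          (hk y hy 4 (by norm_num) (by norm_num))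
      · exact hy
    have m1 := aux_double _ _ _ hp2 hp3 hc (1, 0)
    have m2 := aux_double (Lam2 D ν t1 t2 t3 t4) _ _ hp1 hp3 (fun p => by have := hc p; tauto) (1, 0)
    have m3 := aux_double (Lam3 D ν t1 t2 t3 t4) _ _ hp1 hp2 (fun p => by have := hc p; tauto) (1, 0)
    have := aux_arith D t1 t2 t3 t4 hd2 (aux_mem _ _ _ m1.1) (aux_mem _ _ _ m2.1)
      (aux_mem _ _ _ m3.1)
    omega
end
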